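/- There is a constant C, depending only on n, α, Σ and w, such that for every open set E ⊆ Σ with 0 < w(E) < ∞ and Per_w(E) < ∞ one has A_w(E) ≤ C √(δ_w(E)). -/

import Mathlib

open MeasureTheory Metric Set
open scoped RealInnerProductSpace ENNReal NNReal Topology

noncomputable section

abbrev Euc (n : ℕ) := EuclideanSpace ℝ (Fin n)

def IsOpenConvexCone {n : ℕ} (S : Set (Euc n)) : Prop :=
  IsOpen S ∧ Convex ℝ S ∧ ∀ x ∈ S, ∀ t : ℝ, 0 < t → t • x ∈ S

def IsAdmissibleWeight {n : ℕ} (S : Set (Euc n)) (α : ℝ) (w : Euc n → ℝ) : Prop :=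
  ContinuousOn w (closure S) ∧ (∀ x ∈ closure S, 0 ≤ w x) ∧
  (∃ x ∈ closure S, w x ≠ 0) ∧
  (∀ x ∈ closure S, ∀ t : ℝ, 0 < t → w (t • x) = t ^ α * w x) ∧
  ConcaveOn ℝ S (fun x => w x ^ (1 / α))

def wVol {n : ℕ} (w : Euc n → ℝ) (E : Set (Euc n)) : ℝ≥0∞ :=
  ∫⁻ x in E, ENNReal.ofReal (w x)

def wPer {n : ℕ} (S : Set (Euc n)) (w : Euc n → ℝ) (E : Set (Euc n)) : ℝ≥0∞ :=
  ∫⁻ x in frontier E ∩ S, ENNReal.ofReal (w x) ∂(μH[(n : ℝ) - 1])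

def linSpan (n k : ℕ) : Set (Euc n) := {x | ∀ i : Fin n, k ≤ (i : ℕ) → x i = 0}

/-- The isoperimetric quotient `Per_w(E) / w(E)^((D-1)/D)`, `D = n + α`. -/
def isoQuot {n : ℕ} (S : Set (Euc n)) (α : ℝ) (w : Euc n → ℝ) (E : Set (Euc n)) : ℝ :=
  (wPer S w E).toReal / (wVol w E).toReal ^ (((n : ℝ) + α - 1) / ((n : ℝ) + α))

/-- The weighted isoperimetric deficit `δ_w(E) = Per_w(E)/(c_* w(E)^((D-1)/D)) - 1`. -/
def wDeficit {n : ℕ} (S : Set (Euc n)) (α : ℝ) (w : Euc n → ℝ) (E : Set (Euc n)) : ℝ :=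
  isoQuot S α w E / isoQuot S α w (ball (0 : Euc n) 1 ∩ S) - 1

/-- The asymmetry `A_w(E)` (given the radius `r` with `w(B_r ∩ Σ) = w(E)`). -/
def wAsym {n : ℕ} (S : Set (Euc n)) (w : Euc n → ℝ) (k : ℕ) (E : Set (Euc n)) (r : ℝ) : ℝ :=
  sInf {a : ℝ | ∃ x₀ ∈ linSpan n k,
    a = (wVol w (symmDiff E (ball x₀ r ∩ S))).toReal / (wVol w E).toReal}


section PartA
/-- Bundled hypotheses of the theorem. -/
structure CW (n k : ℕ) (α : ℝ) (S : Set (Euc n)) (w : Euc n → ℝ) : Prop where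
  hk : k < n
  hα : 0 < α
  hS : IsOpenConvexCone S
  hSL : ∀ x ∈ S, ∀ v ∈ linSpan n k, x + v ∈ S
  hNL : ∀ p v : Euc n, (∀ t : ℝ, p + t • v ∈ S) → v ∈ linSpan n k
  hw : IsAdmissibleWeight S α w

/-- The concave root of the weight. -/
def hh {n : ℕ} (α : ℝ) (w : Euc n → ℝ) (x : Euc n) : ℝ := w x ^ (1 / α)

namespace CW
variable {n k : ℕ} {α : ℝ} {S : Set (Euc n)} {w : Euc n → ℝ}

theorem isOpen (H : CW n k α S w) : IsOpen S := H.hS.1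
theorem convex (H : CW n k α S w) : Convex ℝ S := H.hS.2.1
theorem smul_mem (H : CW n k α S w) {x : Euc n} (hx : x ∈ S) {t : ℝ} (ht : 0 < t) : t • x ∈ S :=
  H.hS.2.2 x hx t ht
theorem nonempty (H : CW n k α S w) : S.Nonempty := by
  obtain ⟨x, hx, -⟩ := H.hw.2.2.1
  exact closure_nonempty_iff.1 ⟨x, hx⟩

theorem w_nonneg (H : CW n k α S w) {x : Euc n} (hx : x ∈ closure S) : 0 ≤ w x := H.hw.2.1 x hx
theorem w_cont (H : CW n k α S w) : ContinuousOn w (closure S) := H.hw.1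
theorem w_smul (H : CW n k α S w) {x : Euc n} (hx : x ∈ closure S) {t : ℝ} (ht : 0 < t) :
    w (t • x) = t ^ α * w x := H.hw.2.2.2.1 x hx t ht

theorem smul_mem_cl (H : CW n k α S w) {x : Euc n} (hx : x ∈ closure S) {t : ℝ} (ht : 0 < t) :
    t • x ∈ closure S := by
  have h1 : MapsTo (fun y : Euc n => t • y) S S := fun y hy => H.smul_mem hy ht
  exact h1.closure (by fun_prop) hx

theorem add_mem (H : CW n k α S w) {x y : Euc n} (hx : x ∈ S) (hy : y ∈ closure S) :
    x + y ∈ S := by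
  have h1 : (1/2 : ℝ) • x + (1/2 : ℝ) • y ∈ interior S :=
    H.convex.combo_interior_closure_mem_interior (by rwa [H.isOpen.interior_eq]) hy
      (by norm_num) (by norm_num) (by norm_num)
  rw [H.isOpen.interior_eq] at h1
  have h2 := H.smul_mem h1 (t := 2) (by norm_num)
  convert h2 using 1
  rw [smul_add, smul_smul, smul_smul]; norm_num

theorem add_smul_mem (H : CW n k α S w) {x y : Euc n} (hx : x ∈ S) (hy : y ∈ closure S) {s : ℝ}
    (hs : 0 ≤ s) : x + s • y ∈ S := by
  rcases hs.eq_or_lt with rfl | hs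
  · simpa using hx
  · exact H.add_mem hx (H.smul_mem_cl hy hs)

theorem zero_cl (H : CW n k α S w) : (0 : Euc n) ∈ closure S := by
  obtain ⟨x, hx⟩ := H.nonempty
  have h : Filter.Tendsto (fun t : ℝ => t • x) (𝓝[>] 0) (𝓝 0) := by
    have : Filter.Tendsto (fun t : ℝ => t • x) (𝓝 0) (𝓝 ((0:ℝ) • x)) := by
      apply Continuous.tendsto; fun_prop
    rw [zero_smul] at this
    exact this.mono_left nhdsWithin_le_nhds
  exact mem_closure_of_tendsto h (by
    filter_upwards [self_mem_nhdsWithin] with t ht using H.smul_mem hx ht)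

theorem tendsto_add (x p : Euc n) :
    Filter.Tendsto (fun t : ℝ => x + t • p) (𝓝[>] 0) (𝓝 x) := by
  have : Filter.Tendsto (fun t : ℝ => x + t • p) (𝓝 0) (𝓝 (x + (0:ℝ) • p)) := by
      apply Continuous.tendsto; fun_prop
  rw [zero_smul, add_zero] at this
  exact this.mono_left nhdsWithin_le_nhds

theorem add_cl (H : CW n k α S w) {x y : Euc n} (hx : x ∈ closure S) (hy : y ∈ closure S) :
    x + y ∈ closure S := by
  obtain ⟨p, hp⟩ := H.nonempty
  refine mem_closure_of_tendsto (tendsto_add (x + y) p) ?_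
  filter_upwards [self_mem_nhdsWithin] with t ht
  have := H.add_mem (H.add_mem (H.smul_mem hp ht) hx) hy
  convert this using 1
  abel

theorem lin_cl (H : CW n k α S w) {v : Euc n} (hv : v ∈ linSpan n k) : v ∈ closure S := by
  obtain ⟨p, hp⟩ := H.nonempty
  refine mem_closure_of_tendsto (tendsto_add v p) ?_
  filter_upwards [self_mem_nhdsWithin] with t ht
  rw [add_comm]
  exact H.hSL _ (H.smul_mem hp ht) v hv

theorem lin_neg {v : Euc n} (hv : v ∈ linSpan n k) : -v ∈ linSpan n k := by
  intro i hi; simp [hv i hi]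
theorem lin_smul {v : Euc n} (hv : v ∈ linSpan n k) (t : ℝ) : t • v ∈ linSpan n k := by
  intro i hi; simp [hv i hi]

theorem zero_not_mem (H : CW n k α S w) : (0 : Euc n) ∉ S := by
  intro h0
  have huniv : ∀ x : Euc n, x ∈ S := by
    intro x
    have h1 : ∀ᶠ t in 𝓝[>] (0:ℝ), (0:Euc n) + t • x ∈ S := (tendsto_add 0 x).eventually
      (H.isOpen.mem_nhds h0)
    obtain ⟨t, ht, ht2⟩ := (h1.and self_mem_nhdsWithin).exists
    have := H.smul_mem ht (t := t⁻¹) (inv_pos.2 ht2)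
    rwa [zero_add, smul_smul, inv_mul_cancel₀ (ne_of_gt ht2), one_smul] at this
  have := H.hNL 0 (EuclideanSpace.single ⟨k, H.hk⟩ 1) (fun t => huniv _) ⟨k, H.hk⟩ le_rfl
  simp at this

theorem hh_nonneg (H : CW n k α S w) {x : Euc n} (hx : x ∈ closure S) : 0 ≤ hh α w x :=
  Real.rpow_nonneg (H.w_nonneg hx) _

theorem hh_cont (H : CW n k α S w) : ContinuousOn (hh α w) (closure S) :=
  H.w_cont.rpow_const fun _ _ => Or.inr (by have := H.hα; positivity)

theorem hh_pow (H : CW n k α S w) {x : Euc n} (hx : x ∈ closure S) : hh α w x ^ α = w x := by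
  unfold hh
  rw [← Real.rpow_mul (H.w_nonneg hx), one_div_mul_cancel H.hα.ne', Real.rpow_one]

theorem hh_smul (H : CW n k α S w) {x : Euc n} (hx : x ∈ closure S) {t : ℝ} (ht : 0 < t) :
    hh α w (t • x) = t * hh α w x := by
  unfold hh
  rw [H.w_smul hx ht, Real.mul_rpow (Real.rpow_nonneg ht.le _) (H.w_nonneg hx),
    ← Real.rpow_mul ht.le, mul_one_div_cancel H.hα.ne', Real.rpow_one]

theorem hh_add0 (H : CW n k α S w) {x y : Euc n} (hx : x ∈ S) (hy : y ∈ S) :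
    hh α w x + hh α w y ≤ hh α w (x + y) := by
  have h0 : ConcaveOn ℝ S (fun x => w x ^ (1 / α)) := H.hw.2.2.2.2
  have h1 := h0.2 hx hy (show (0:ℝ) ≤ 1/2 by norm_num) (show (0:ℝ) ≤ 1/2 by norm_num) (by norm_num)
  have h2 : hh α w (x + y) = 2 * hh α w ((1/2 : ℝ) • x + (1/2 : ℝ) • y) := by
    rw [← H.hh_smul _ two_pos]
    · congr 1; rw [smul_add, smul_smul, smul_smul]; norm_num
    · exact subset_closure (H.convex hx hy (by norm_num) (by norm_num) (by norm_num))
  rw [h2]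
  simp only [smul_eq_mul] at h1
  unfold hh
  linarith

theorem hh_tendsto (H : CW n k α S w) {x p : Euc n} (hx : x ∈ closure S) (hp : p ∈ S) :
    Filter.Tendsto (fun t : ℝ => hh α w (x + t • p)) (𝓝[>] 0) (𝓝 (hh α w x)) := by
  refine (H.hh_cont x hx).tendsto.comp ?_
  refine tendsto_nhdsWithin_iff.2 ⟨tendsto_add x p, ?_⟩
  filter_upwards [self_mem_nhdsWithin] with t ht
  exact H.add_cl hx (subset_closure (H.smul_mem hp ht))

theorem hh_add (H : CW n k α S w) {x y : Euc n} (hx : x ∈ closure S) (hy : y ∈ closure S) :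
    hh α w x + hh α w y ≤ hh α w (x + y) := by
  obtain ⟨p, hp⟩ := H.nonempty
  have h1 := (H.hh_tendsto hx hp).add (H.hh_tendsto hy hp)
  have h2 := H.hh_tendsto (H.add_cl hx hy) (H.add_mem hp (subset_closure hp))
  refine le_of_tendsto_of_tendsto h1 h2 ?_
  filter_upwards [self_mem_nhdsWithin] with t ht
  have := H.hh_add0 (x := x + t • p) (y := y + t • p)
    (by rw [add_comm]; exact H.add_mem (H.smul_mem hp ht) hx)
    (by rw [add_comm]; exact H.add_mem (H.smul_mem hp ht) hy)
  have e : x + y + t • (p + p) = x + t • p + (y + t • p) := by rw [smul_add]; abel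
  rw [e]; exact this

theorem hh_add_smul (H : CW n k α S w) {x y : Euc n} (hx : x ∈ closure S) (hy : y ∈ closure S)
    {s : ℝ} (hs : 0 ≤ s) : hh α w x + s * hh α w y ≤ hh α w (x + s • y) := by
  rcases hs.eq_or_lt with rfl | hs
  · simp
  · rw [← H.hh_smul hy hs]; exact H.hh_add hx (H.smul_mem_cl hy hs)

theorem hh_pos (H : CW n k α S w) {x : Euc n} (hx : x ∈ S) : 0 < hh α w x := by
  obtain ⟨z, hz, hwz⟩ := H.hw.2.2.1
  have hz0 : 0 < hh α w z := Real.rpow_pos_of_pos (lt_of_le_of_ne (H.w_nonneg hz) hwz.symm) _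
  have h1 : ∀ᶠ t in 𝓝[>] (0:ℝ), x + t • (-z) ∈ S := (tendsto_add x (-z)).eventually
      (H.isOpen.mem_nhds hx)
  obtain ⟨t, ht, ht2⟩ := (h1.and self_mem_nhdsWithin).exists
  have ht2 : 0 < t := ht2
  have h2 := H.hh_add_smul (subset_closure ht) hz ht2.le
  have h3 : x + t • -z + t • z = x := by simp
  rw [h3] at h2
  have h4 := H.hh_nonneg (subset_closure ht)
  have : 0 < t * hh α w z := by positivity
  linarith

theorem w_pos (H : CW n k α S w) {x : Euc n} (hx : x ∈ S) : 0 < w x := by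
  rw [← H.hh_pow (subset_closure hx)]
  exact Real.rpow_pos_of_pos (H.hh_pos hx) _

theorem hh_add_lin (H : CW n k α S w) {x v : Euc n} (hx : x ∈ closure S) (hv : v ∈ linSpan n k) :
    hh α w (x + v) = hh α w x := by
  have h1 := H.hh_add hx (H.lin_cl hv)
  have h2 := H.hh_add (H.add_cl hx (H.lin_cl hv)) (H.lin_cl (lin_neg hv))
  rw [add_neg_cancel_right] at h2
  have := H.hh_nonneg (H.lin_cl hv)
  have := H.hh_nonneg (H.lin_cl (lin_neg hv))
  linarith

theorem w_add_lin (H : CW n k α S w) {x v : Euc n} (hx : x ∈ closure S) (hv : v ∈ linSpan n k) :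
    w (x + v) = w x := by
  rw [← H.hh_pow hx, ← H.hh_add_lin hx hv, H.hh_pow (H.add_cl hx (H.lin_cl hv))]

theorem mem_add_lin (H : CW n k α S w) {x v : Euc n} (hv : v ∈ linSpan n k) :
    x + v ∈ S ↔ x ∈ S := by
  constructor
  · intro h
    have := H.hSL _ h _ (lin_neg hv)
    simpa using this
  · exact fun h => H.hSL _ h _ hv

/-! distance to the complement -/

theorem compl_nonempty (H : CW n k α S w) : (Sᶜ).Nonempty := ⟨0, H.zero_not_mem⟩

theorem d_pos (H : CW n k α S w) {x : Euc n} : 0 < infDist x Sᶜ ↔ x ∈ S := by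
  rw [← H.isOpen.isClosed_compl.notMem_iff_infDist_pos H.compl_nonempty]; simp

theorem d_le (H : CW n k α S w) {x : Euc n} {r : ℝ} (h : ball x r ⊆ S) : r ≤ infDist x Sᶜ := by
  refine (le_infDist H.compl_nonempty).2 fun y hy => ?_
  by_contra hlt
  push Not at hlt
  exact hy (h (by rwa [mem_ball, dist_comm]))

theorem ball_sub {x : Euc n} {r : ℝ} (hr : r ≤ infDist x Sᶜ) : ball x r ⊆ S := by
  intro y hy
  by_contra h
  have := infDist_le_dist_of_mem (x := x) (show y ∈ Sᶜ from h)
  rw [mem_ball, dist_comm] at hy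
  linarith

theorem d_add (H : CW n k α S w) {x y : Euc n} (hy : y ∈ closure S) :
    infDist x Sᶜ ≤ infDist (x + y) Sᶜ := by
  refine H.d_le fun z hz => ?_
  have h1 : z - y ∈ S := ball_sub le_rfl (x := x) (by
    rw [mem_ball, dist_eq_norm] at hz ⊢; convert hz using 2; abel)
  simpa using H.add_mem h1 hy

theorem d_smul (H : CW n k α S w) {x : Euc n} {t : ℝ} (ht : 0 < t) :
    infDist (t • x) Sᶜ = t * infDist x Sᶜ := by
  have key : ∀ (x : Euc n) {t : ℝ} (_ : 0 < t), t * infDist x Sᶜ ≤ infDist (t • x) Sᶜ := by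
    intro x t ht
    refine H.d_le fun z hz => ?_
    have h1 : t⁻¹ • z ∈ S := ball_sub le_rfl (x := x) (by
      rw [mem_ball, dist_eq_norm] at hz ⊢
      have : t⁻¹ • z - x = t⁻¹ • (z - t • x) := by
        rw [smul_sub, smul_smul, inv_mul_cancel₀ ht.ne', one_smul]
      rw [this, norm_smul, norm_inv, Real.norm_eq_abs, abs_of_pos ht, inv_mul_lt_iff₀ ht]
      exact hz)
    have := H.smul_mem h1 ht
    rwa [smul_smul, mul_inv_cancel₀ ht.ne', one_smul] at this
  apply le_antisymm _ (key x ht)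
  have := key (t • x) (inv_pos.2 ht)
  rw [smul_smul, inv_mul_cancel₀ ht.ne', one_smul, inv_mul_le_iff₀ ht] at this
  exact this

theorem d_add_lin (H : CW n k α S w) {x v : Euc n} (hv : v ∈ linSpan n k) :
    infDist (x + v) Sᶜ = infDist x Sᶜ := by
  apply le_antisymm _ (H.d_add (H.lin_cl hv))
  have := H.d_add (x := x + v) (H.lin_cl (lin_neg hv))
  simpa using this

end CW
end PartA

section PartB
set_option linter.unusedSectionVars false

/-- bounded Lipschitz functions -/
def BL {X Y : Type*} [PseudoMetricSpace X] [NormedAddCommGroup Y] (f : X → Y) : Prop :=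
  (∃ K, LipschitzWith K f) ∧ ∃ M : ℝ, ∀ x, ‖f x‖ ≤ M

namespace BL
variable {X Y Z : Type*} [PseudoMetricSpace X] [NormedAddCommGroup Y] [NormedSpace ℝ Y]
  [NormedAddCommGroup Z] [NormedSpace ℝ Z]

theorem cont {f : X → Y} (hf : BL f) : Continuous f := hf.1.choose_spec.continuous

theorem of_dist {f : X → Y} {K M : ℝ} (h1 : ∀ x y, dist (f x) (f y) ≤ K * dist x y)
    (h2 : ∀ x, ‖f x‖ ≤ M) : BL f := by
  refine ⟨⟨K.toNNReal, LipschitzWith.of_dist_le_mul fun x y => (h1 x y).trans ?_⟩, M, h2⟩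
  gcongr
  exact Real.le_coe_toNNReal K

theorem bd {f : X → Y} (hf : BL f) : ∃ K M : ℝ, 0 ≤ K ∧ 0 ≤ M ∧
    (∀ x y, dist (f x) (f y) ≤ K * dist x y) ∧ ∀ x, ‖f x‖ ≤ M := by
  obtain ⟨⟨K, hK⟩, M, hM⟩ := hf
  exact ⟨K, |M|, K.2, abs_nonneg _, fun x y => hK.dist_le_mul x y,
    fun x => (hM x).trans (le_abs_self M)⟩

theorem smul {f : X → ℝ} {g : X → Y} (hf : BL f) (hg : BL g) : BL (fun x => f x • g x) := by
  obtain ⟨K, M, hK, hM, h1, h2⟩ := hf.bd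
  obtain ⟨K', M', hK', hM', h1', h2'⟩ := hg.bd
  refine of_dist (K := M * K' + K * M') (M := M * M') (fun x y => ?_) (fun x => ?_)
  · have e : f x • g x - f y • g y = f x • (g x - g y) + (f x - f y) • g y := by
      rw [smul_sub, sub_smul]; abel
    rw [dist_eq_norm, e]
    calc _ ≤ ‖f x‖ * ‖g x - g y‖ + ‖f x - f y‖ * ‖g y‖ := by
          rw [← norm_smul, ← norm_smul]; exact norm_add_le _ _
      _ ≤ M * (K' * dist x y) + (K * dist x y) * M' := by
          rw [← dist_eq_norm, ← dist_eq_norm]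
          gcongr
          · exact h2 x
          · exact h1' x y
          · exact h1 x y
          · exact h2' y
      _ = _ := by ring
  · rw [norm_smul]; gcongr
    · exact h2 x
    · exact h2' x

theorem mul {f g : X → ℝ} (hf : BL f) (hg : BL g) : BL (fun x => f x * g x) := hf.smul hg

theorem add {f g : X → Y} (hf : BL f) (hg : BL g) : BL (fun x => f x + g x) := by
  obtain ⟨⟨K, hK⟩, M, hM⟩ := hf
  obtain ⟨⟨K', hK'⟩, M', hM'⟩ := hg
  exact ⟨⟨_, hK.add hK'⟩, M + M', fun x => (norm_add_le _ _).trans (add_le_add (hM x) (hM' x))⟩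

theorem neg {f : X → Y} (hf : BL f) : BL (fun x => - f x) := by
  obtain ⟨⟨K, hK⟩, M, hM⟩ := hf
  exact ⟨⟨_, hK.neg⟩, M, fun x => by simpa using hM x⟩

theorem sub {f g : X → Y} (hf : BL f) (hg : BL g) : BL (fun x => f x - g x) := by
  simpa [sub_eq_add_neg] using hf.add hg.neg

theorem const (c : Y) : BL (fun _ : X => c) := ⟨⟨0, LipschitzWith.const c⟩, ‖c‖, fun _ => le_rfl⟩

theorem clm {f : X → Y} (hf : BL f) (L : Y →L[ℝ] Z) : BL (fun x => L (f x)) := by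
  obtain ⟨⟨K, hK⟩, M, hM⟩ := hf
  refine ⟨⟨_, L.lipschitz.comp hK⟩, ‖L‖ * M, fun x => (L.le_opNorm _).trans ?_⟩
  gcongr; exact hM x

theorem comp {f : X → Y} {g : Y → Z} (hf : ∃ K, LipschitzWith K f) (hg : BL g) :
    BL (fun x => g (f x)) := by
  obtain ⟨K, hK⟩ := hf
  obtain ⟨⟨K', hK'⟩, M, hM⟩ := hg
  exact ⟨⟨_, hK'.comp hK⟩, M, fun x => hM _⟩

theorem norm {f : X → Y} (hf : BL f) : BL (fun x => ‖f x‖) := by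
  obtain ⟨⟨K, hK⟩, M, hM⟩ := hf
  exact ⟨⟨_, lipschitzWith_one_norm.comp hK⟩, M, fun x => by simpa using hM x⟩

/-- truncation of a real Lipschitz function -/
theorem trunc {f : X → ℝ} (hf : ∃ K, LipschitzWith K f) (M : ℝ) (hM : 0 ≤ M) :
    BL (fun x => max (-M) (min (f x) M)) := by
  obtain ⟨K, hK⟩ := hf
  refine ⟨⟨K, (hK.min_const M).const_max (-M)⟩, M, fun x => ?_⟩
  rw [Real.norm_eq_abs, abs_le]
  exact ⟨le_max_left _ _, max_le (by linarith) (min_le_right _ _)⟩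

end BL

theorem deriv_nonneg_of_right {g : ℝ → ℝ} {g' : ℝ} (hg : HasDerivAt g g' 0) (h0 : g 0 = 0)
    (hpos : ∀ s, 0 < s → 0 ≤ g s) : 0 ≤ g' := by
  have h1 := hg.tendsto_slope_zero_right
  refine ge_of_tendsto h1 ?_
  filter_upwards [self_mem_nhdsWithin] with t ht
  have ht : 0 < t := ht
  simp only [zero_add, h0, sub_zero, smul_eq_mul]
  exact mul_nonneg (by positivity) (hpos t ht)

namespace CW
variable {n k : ℕ} {α : ℝ} {S : Set (Euc n)} {w : Euc n → ℝ}

theorem hasDerivAt_line {f : Euc n → ℝ} {x : Euc n} (hf : DifferentiableAt ℝ f x) (y : Euc n) :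
    HasDerivAt (fun s : ℝ => f (x + s • y)) (fderiv ℝ f x y) 0 := by
  have h1 : HasFDerivAt f (fderiv ℝ f x) (x + (0:ℝ) • y) := by simpa using hf.hasFDerivAt
  have h2 : HasDerivAt (fun s : ℝ => x + s • y) y 0 := by
    simpa using ((hasDerivAt_id (0:ℝ)).smul_const y).const_add x
  exact h1.comp_hasDerivAt (0:ℝ) h2

theorem fderiv_w_ge (H : CW n k α S w) {x y : Euc n} (hx : x ∈ S) (hd : DifferentiableAt ℝ w x)
    (hy : y ∈ closure S) : α * w x * (hh α w y / hh α w x) ≤ fderiv ℝ w x y := by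
  have hp := H.hh_pos hx
  have h1 := hasDerivAt_line hd y
  have h2 : HasDerivAt (fun s : ℝ => (hh α w x + s * hh α w y) ^ α)
      (hh α w y * α * hh α w x ^ (α - 1)) 0 := by
    have h3 : HasDerivAt (fun s : ℝ => hh α w x + s * hh α w y) (hh α w y) 0 := by
      simpa using ((hasDerivAt_id (0:ℝ)).mul_const (hh α w y)).const_add (hh α w x)
    have := h3.rpow_const (p := α) (Or.inl (by simpa using hp.ne'))
    simpa using this
  have h4 := deriv_nonneg_of_right (h1.sub h2) (by simp [H.hh_pow (subset_closure hx)]) (by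
    intro s hs
    have h5 := H.hh_add_smul (subset_closure hx) hy hs.le
    simp only [Pi.sub_apply]
    rw [← H.hh_pow (subset_closure (H.add_smul_mem hx hy hs.le)), sub_nonneg]
    have := H.hh_nonneg hy
    exact Real.rpow_le_rpow (by positivity) h5 H.hα.le)
  have h6 : hh α w x ^ (α - 1) = w x / hh α w x := by
    rw [Real.rpow_sub_one hp.ne', H.hh_pow (subset_closure hx)]
  rw [h6] at h4
  have : α * w x * (hh α w y / hh α w x) = hh α w y * α * (w x / hh α w x) := by ring
  rw [this]; linarith

theorem fderiv_w_eq (H : CW n k α S w) {x x0 : Euc n} (hx : x ∈ S) (hd : DifferentiableAt ℝ w x)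
    (h0 : x0 ∈ linSpan n k) : fderiv ℝ w x (x - x0) = α * w x := by
  have h1 := hasDerivAt_line hd (x - x0)
  have h2 : HasDerivAt (fun s : ℝ => (1 + s) ^ α * w x) (α * w x) 0 := by
    have h3 : HasDerivAt (fun s : ℝ => 1 + s) 1 0 := by
      simpa using (hasDerivAt_id (0:ℝ)).const_add 1
    have := (h3.rpow_const (p := α) (Or.inl (by simp))).mul_const (w x)
    simpa using this
  refine h1.unique (h2.congr_of_eventuallyEq ?_)
  filter_upwards [Ioi_mem_nhds (show (-1:ℝ) < 0 by norm_num)] with s hs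
  have hs : 0 < 1 + s := by have : -1 < s := hs; linarith
  rw [← H.w_smul (subset_closure hx) hs,
    ← H.w_add_lin (subset_closure (H.smul_mem hx hs)) (lin_smul (lin_neg h0) s)]
  congr 1
  rw [add_smul, one_smul, smul_sub, smul_neg]; abel

theorem fderiv_d_ge (H : CW n k α S w) {x y : Euc n}
    (hd : DifferentiableAt ℝ (fun x => infDist x Sᶜ) x)
    (hy : y ∈ closure S) : 0 ≤ fderiv ℝ (fun x => infDist x Sᶜ) x y := by
  have h1 := (hasDerivAt_line hd y).sub_const (infDist x Sᶜ)
  refine deriv_nonneg_of_right h1 (by simp) fun s hs => ?_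
  rw [sub_nonneg]
  exact H.d_add (H.smul_mem_cl hy hs)

theorem fderiv_d_eq (H : CW n k α S w) {x x0 : Euc n}
    (hd : DifferentiableAt ℝ (fun x => infDist x Sᶜ) x)
    (h0 : x0 ∈ linSpan n k) : fderiv ℝ (fun x => infDist x Sᶜ) x (x - x0) = infDist x Sᶜ := by
  have h1 := hasDerivAt_line hd (x - x0)
  have h2 : HasDerivAt (fun s : ℝ => (1 + s) * infDist x Sᶜ) (infDist x Sᶜ) 0 := by
    have h3 : HasDerivAt (fun s : ℝ => 1 + s) 1 0 := by
      simpa using (hasDerivAt_id (0:ℝ)).const_add 1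
    simpa using h3.mul_const (infDist x Sᶜ)
  refine h1.unique (h2.congr_of_eventuallyEq ?_)
  filter_upwards [Ioi_mem_nhds (show (-1:ℝ) < 0 by norm_num)] with s hs
  have hs : 0 < 1 + s := by have : -1 < s := hs; linarith
  rw [← H.d_smul hs, ← H.d_add_lin (x := (1 + s) • x) (lin_smul (lin_neg h0) s)]
  congr 1
  rw [add_smul, one_smul, smul_sub, smul_neg]; abel

theorem d_lip : LipschitzWith 1 (fun x : Euc n => infDist x Sᶜ) := lipschitz_infDist_pt _

/-- On a compact subset of the cone the weight agrees with a bounded Lipschitz function. -/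
theorem w_ext (H : CW n k α S w) {C : Set (Euc n)} (hC : IsCompact C) (hCS : C ⊆ S) :
    ∃ g : Euc n → ℝ, BL g ∧ EqOn w g C := by
  have hconc : ConcaveOn ℝ S (hh α w) := H.hw.2.2.2.2
  obtain ⟨K, hK⟩ := ((hconc.locallyLipschitzOn H.isOpen).mono hCS).exists_lipschitzOnWith_of_compact
    hC
  obtain ⟨g, hg, hgC⟩ := hK.extend_real
  rcases C.eq_empty_or_nonempty with rfl | hne
  · exact ⟨fun _ => 0, BL.const 0, by simp⟩
  have hhc : ContinuousOn (hh α w) C := H.hh_cont.mono (hCS.trans subset_closure)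
  obtain ⟨a, haC, ha⟩ := hC.exists_isMinOn hne hhc
  obtain ⟨b, hbC, hb⟩ := hC.exists_isMaxOn hne hhc
  have hapos := H.hh_pos (hCS haC)
  have hab : hh α w a ≤ hh α w b := ha hbC
  have hcd : ContDiffOn ℝ 1 (fun t : ℝ => t ^ α) (Icc (hh α w a) (hh α w b)) := by
    intro t ht
    exact (Real.contDiffAt_rpow_const (Or.inl (by have := ht.1; linarith))).contDiffWithinAt
  obtain ⟨K', hK'⟩ := hcd.exists_lipschitzOnWith (by norm_num) (convex_Icc _ _) isCompact_Icc
  refine ⟨fun x => (projIcc _ _ hab (g x) : ℝ) ^ α, ?_, ?_⟩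
  · have hL : LipschitzWith (K' * (1 * K)) fun x => (projIcc _ _ hab (g x) : ℝ) ^ α := by
      have h1 : LipschitzWith (1 * K) fun x => (projIcc _ _ hab (g x) : ℝ) := by
        have := (LipschitzWith.projIcc hab).comp hg
        exact this
      intro x y
      refine (hK' (Subtype.prop _) (Subtype.prop _)).trans ?_
      rw [ENNReal.coe_mul, mul_assoc]
      gcongr
      exact h1 x y
    refine ⟨⟨_, hL⟩, hh α w b ^ α, fun x => ?_⟩
    have h2 := (projIcc _ _ hab (g x)).2
    have h3 : 0 < ((projIcc _ _ hab (g x) : ℝ)) := hapos.trans_le h2.1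
    rw [Real.norm_of_nonneg (by positivity)]
    exact Real.rpow_le_rpow h3.le h2.2 H.hα.le
  · intro x hx
    have h1 : g x ∈ Icc (hh α w a) (hh α w b) := by
      rw [← hgC hx]; exact ⟨ha hx, hb hx⟩
    simp only
    rw [projIcc_of_mem hab h1]
    simp only [← hgC hx]
    rw [H.hh_pow (subset_closure (hCS hx))]

theorem compact_K (_H : CW n k α S w) {t : ℝ} (_ht : 0 < t) (R : ℝ) :
    IsCompact ({x | t ≤ infDist x Sᶜ} ∩ closedBall (0 : Euc n) R) :=
  (isCompact_closedBall _ _).inter_left (isClosed_le continuous_const (continuous_infDist_pt _))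

theorem compact_sub (H : CW n k α S w) {t : ℝ} (ht : 0 < t) (R : ℝ) :
    {x | t ≤ infDist x Sᶜ} ∩ closedBall (0 : Euc n) R ⊆ S :=
  fun _ hx => H.d_pos.1 (ht.trans_le hx.1)

theorem w_diff (H : CW n k α S w) : ∀ᵐ x : Euc n, x ∈ S → DifferentiableAt ℝ w x := by
  have h1 : ∀ j : ℕ, ∀ᵐ x : Euc n, 1 / ((j:ℝ) + 1) < infDist x Sᶜ → ‖x‖ < j + 1 →
      DifferentiableAt ℝ w x := by
    intro j
    have hj : 0 < 1 / ((j:ℝ) + 1) := by positivity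
    obtain ⟨g, ⟨⟨K, hK⟩, -⟩, hg⟩ := H.w_ext (H.compact_K hj (j + 1)) (H.compact_sub hj (j + 1))
    filter_upwards [hK.ae_differentiableAt] with x hx h1 h2
    refine hx.congr_of_eventuallyEq ?_
    have ho : IsOpen ({x | 1 / ((j:ℝ) + 1) < infDist x Sᶜ} ∩ ball (0 : Euc n) (j + 1)) :=
      (isOpen_lt continuous_const (continuous_infDist_pt _)).inter isOpen_ball
    filter_upwards [ho.mem_nhds ⟨h1, by simpa using h2⟩] with y hy
    have h3 : 1 / ((j:ℝ) + 1) < infDist y Sᶜ := hy.1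
    exact hg ⟨h3.le, ball_subset_closedBall hy.2⟩
  filter_upwards [ae_all_iff.2 h1] with x hx hxS
  obtain ⟨j, hj⟩ := exists_nat_one_div_lt (H.d_pos.2 hxS)
  obtain ⟨j', hj'⟩ := exists_nat_gt ‖x‖
  refine hx (max j j') (lt_of_le_of_lt ?_ hj) (hj'.trans ?_)
  · gcongr; exact le_max_left j j'
  · have : (j' : ℝ) ≤ (max j j' : ℕ) := by exact_mod_cast le_max_right j j'
    linarith

theorem d_diff : ∀ᵐ x : Euc n, DifferentiableAt ℝ (fun x => infDist x Sᶜ) x :=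
  d_lip.ae_differentiableAt

end CW
end PartB

section PartC
theorem muHE_lip {X Y : Type*} [EMetricSpace X] [MeasurableSpace X] [BorelSpace X]
    [EMetricSpace Y] [MeasurableSpace Y] [BorelSpace Y] (d : ℕ) {f : X → Y} {s : Set X}
    (hf : LipschitzOnWith 1 f s) : (μHE[d] : Measure Y) (f '' s) ≤ μHE[d] s := by
  rw [Measure.euclideanHausdorffMeasure_def, Measure.euclideanHausdorffMeasure_def,
    Measure.smul_apply, Measure.smul_apply]
  gcongr
  have := hf.hausdorffMeasure_image_le (d := (d:ℝ)) (by positivity)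
  simpa using this

theorem vol_eq_muHE (n : ℕ) : (volume : Measure (Euc n)) = μHE[Module.finrank ℝ (Euc n)] :=
  InnerProductSpace.euclideanHausdorffMeasure_eq_volume.symm

/-- tube lemma for a small piece -/
theorem tube1 {n : ℕ} {e : Euc n} (he : ‖e‖ = 1) {A : Set (Euc n)} {ρ t : ℝ} (ht : 0 ≤ t)
    (hA : ∀ x ∈ A, ∀ y ∈ A, dist x y ≤ ρ) :
    volume {z : Euc n | ∃ x ∈ A, ∃ s ∈ Icc 0 t, z = x + s • e} ≤
      ENNReal.ofReal (t + ρ) * μHE[n - 1] A := by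
  rcases A.eq_empty_or_nonempty with rfl | ⟨a, ha⟩
  · simp
  have hne : e ≠ 0 := by intro h; rw [h] at he; simp at he
  set s : Submodule ℝ (Euc n) := ℝ ∙ e with hs
  have hΦ := s.measurePreserving_measurableEquivProd (0 : Euc n)
  rw [← vol_eq_muHE] at hΦ
  set b : ℝ := sInf ((fun x => ⟪e, x⟫) '' A) with hb
  have hinner : ∀ x ∈ A, ∀ y ∈ A, ⟪e, x⟫ ≤ ⟪e, y⟫ + ρ := by
    intro x hx y hy
    have h1 : ⟪e, x - y⟫ ≤ ρ := by
      calc _ ≤ ‖e‖ * ‖x - y‖ := real_inner_le_norm _ _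
        _ ≤ ρ := by rw [he, one_mul, ← dist_eq_norm]; exact hA x hx y hy
    rw [inner_sub_right] at h1; linarith
  have hbdd : BddBelow ((fun x => ⟪e, x⟫) '' A) := by
    refine ⟨⟪e, a⟫ - ρ, ?_⟩
    rintro _ ⟨x, hx, rfl⟩
    have := hinner a ha x hx
    simp only; linarith
  have hb1 : ∀ x ∈ A, b ≤ ⟪e, x⟫ := fun x hx => csInf_le hbdd ⟨x, hx, rfl⟩
  have hb2 : ∀ x ∈ A, ⟪e, x⟫ ≤ b + ρ := by
    intro x hx
    have : ⟪e, x⟫ - ρ ≤ b := by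
      refine le_csInf ⟨_, a, ha, rfl⟩ ?_
      rintro _ ⟨y, hy, rfl⟩
      have := hinner x hx y hy
      simp only; linarith
    linarith
  set e' : s := ⟨e, Submodule.mem_span_singleton_self e⟩ with he'
  set U : Set s := (fun r : ℝ => r • e') '' Icc b (b + (t + ρ)) with hU
  set W : Set sᗮ := (fun x => sᗮ.orthogonalProjectionOnto x) '' A with hW
  have hsub : {z : Euc n | ∃ x ∈ A, ∃ s ∈ Icc 0 t, z = x + s • e} ⊆
      (s.measurableEquivProd (0 : Euc n)) ⁻¹' (U ×ˢ W) := by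
    rintro z ⟨x, hx, r, hr, rfl⟩
    simp only [mem_preimage, Submodule.measurableEquivProd_apply, vsub_eq_sub, sub_zero,
      mem_prod, map_add, map_smul]
    constructor
    · refine ⟨⟪e, x⟫ + r, ⟨?_, ?_⟩, ?_⟩
      · have := hb1 x hx; have := hr.1; linarith
      · have := hb2 x hx; have := hr.2; linarith
      · apply Subtype.ext
        have h1 : s.orthogonalProjectionOnto e = e' :=
          Submodule.orthogonalProjectionOnto_mem_subspace_eq_self e'
        rw [h1]
        simp only [Submodule.coe_smul, Submodule.coe_add, he']
        have h2 : (s.orthogonalProjectionOnto x : Euc n) = ⟪e, x⟫ • e := by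
          have := Submodule.starProjection_unit_singleton ℝ he x
          exact this
        rw [h2, add_smul]
    · refine ⟨x, hx, ?_⟩
      have h3 : sᗮ.orthogonalProjectionOnto e = 0 := by
        rw [Submodule.orthogonalProjectionOnto_eq_zero_iff]
        exact s.le_orthogonal_orthogonal (Submodule.mem_span_singleton_self e)
      rw [h3]; simp
  have hvol : volume ((s.measurableEquivProd (0 : Euc n)) ⁻¹' (U ×ˢ W)) = volume U * volume W := by
    rw [hΦ.measure_preimage_equiv, Measure.volume_eq_prod, Measure.prod_prod]
  refine (measure_mono hsub).trans ?_
  rw [hvol]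
  have hf1 : Module.finrank ℝ s = 1 := finrank_span_singleton hne
  have hf2 : Module.finrank ℝ sᗮ = n - 1 := by
    have := s.finrank_add_finrank_orthogonal
    rw [hf1, finrank_euclideanSpace_fin] at this
    omega
  gcongr
  · rw [← InnerProductSpace.euclideanHausdorffMeasure_eq_volume, hf1]
    have hiso : Isometry (fun r : ℝ => r • e') := by
      refine Isometry.of_dist_eq fun x y => ?_
      rw [dist_eq_norm, ← sub_smul, norm_smul, dist_eq_norm]
      have : ‖e'‖ = 1 := he
      rw [this, mul_one]
    rw [hU, hiso.euclideanHausdorffMeasure_image]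
    have h4 : (μHE[1] : Measure ℝ) = volume := by
      have := InnerProductSpace.euclideanHausdorffMeasure_eq_volume (V := ℝ)
      rwa [Module.finrank_self] at this
    rw [h4, Real.volume_Icc]
    simp
  · rw [← InnerProductSpace.euclideanHausdorffMeasure_eq_volume, hf2]
    apply muHE_lip
    refine LipschitzWith.lipschitzOnWith ?_
    refine LipschitzWith.of_dist_le_mul fun x y => ?_
    rw [dist_eq_norm, ← map_sub, NNReal.coe_one, one_mul, dist_eq_norm]
    exact Submodule.norm_orthogonalProjectionOnto_apply_le _ _

/-- countable Borel partition into pieces of small diameter -/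
theorem small_partition (n : ℕ) {ρ : ℝ} (hρ : 0 < ρ) :
    ∃ B : ℕ → Set (Euc n), (∀ i, MeasurableSet (B i)) ∧ Pairwise (Function.onFun Disjoint B) ∧
      (⋃ i, B i) = univ ∧ ∀ i, ∀ x ∈ B i, ∀ y ∈ B i, dist x y ≤ ρ := by
  set q := TopologicalSpace.denseSeq (Euc n)
  refine ⟨disjointed fun i => closedBall (q i) (ρ / 2), ?_, disjoint_disjointed _, ?_, ?_⟩
  · exact fun i => MeasurableSet.disjointed (fun i => measurableSet_closedBall) i
  · rw [iUnion_disjointed, eq_univ_iff_forall]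
    intro x
    obtain ⟨i, hi⟩ := (TopologicalSpace.denseRange_denseSeq (Euc n)).exists_dist_lt x (half_pos hρ)
    exact mem_iUnion.2 ⟨i, hi.le⟩
  · intro i x hx y hy
    have h1 := disjointed_subset _ _ hx
    have h2 := disjointed_subset _ _ hy
    rw [mem_closedBall] at h1 h2
    have := dist_triangle_right x y (q i)
    linarith

/-- weighted tube lemma -/
theorem tube2 {n : ℕ} {e : Euc n} (he : ‖e‖ = 1) {A : Set (Euc n)} (hA : MeasurableSet A)
    {ρ t : ℝ} (ht : 0 ≤ t) (hρ : 0 < ρ) {ψ : Euc n → ℝ} {L : ℝ} (hL : 0 ≤ L)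
    (hψ : ∀ x y, |ψ x - ψ y| ≤ L * dist x y) :
    ∫⁻ z in {z : Euc n | ∃ x ∈ A, ∃ s ∈ Icc 0 t, z = x + s • e}, ENNReal.ofReal |ψ z| ≤
      ENNReal.ofReal (t + ρ) *
        ∫⁻ x in A, (ENNReal.ofReal |ψ x| + ENNReal.ofReal (L * (t + ρ))) ∂μHE[n - 1] := by
  obtain ⟨B, hBm, hBd, hBu, hBs⟩ := small_partition n hρ
  have hsub : {z : Euc n | ∃ x ∈ A, ∃ s ∈ Icc 0 t, z = x + s • e} ⊆
      ⋃ i, {z : Euc n | ∃ x ∈ A ∩ B i, ∃ s ∈ Icc 0 t, z = x + s • e} := by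
    rintro z ⟨x, hx, s, hs, rfl⟩
    obtain ⟨i, hi⟩ := mem_iUnion.1 (hBu ▸ mem_univ x)
    exact mem_iUnion.2 ⟨i, x, ⟨hx, hi⟩, s, hs, rfl⟩
  refine (lintegral_mono_set hsub).trans ((lintegral_iUnion_le _ _).trans ?_)
  have hAU : A = ⋃ i, A ∩ B i := by rw [← inter_iUnion, hBu, inter_univ]
  conv_rhs => rw [hAU]
  rw [lintegral_iUnion (fun i => hA.inter (hBm i)) (fun i j hij =>
    (hBd hij).mono inter_subset_right inter_subset_right), ← ENNReal.tsum_mul_left]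
  refine ENNReal.tsum_le_tsum fun i => ?_
  set T := {z : Euc n | ∃ x ∈ A ∩ B i, ∃ s ∈ Icc 0 t, z = x + s • e} with hT
  have h1 : ∀ z ∈ T, ∀ x ∈ A ∩ B i,
      ENNReal.ofReal |ψ z| ≤ ENNReal.ofReal |ψ x| + ENNReal.ofReal (L * (t + ρ)) := by
    rintro z ⟨y, hy, s, hs, rfl⟩ x hx
    rw [← ENNReal.ofReal_add (abs_nonneg _) (by positivity)]
    apply ENNReal.ofReal_le_ofReal
    have h2 := hψ (y + s • e) x
    have h3 : dist (y + s • e) x ≤ t + ρ := by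
      have := dist_triangle (y + s • e) y x
      have h4 : dist (y + s • e) y = s := by
        rw [dist_eq_norm, add_sub_cancel_left, norm_smul, he, mul_one, Real.norm_of_nonneg hs.1]
      have := hBs i y hy.2 x hx.2
      linarith [hs.2]
    have h5 : L * dist (y + s • e) x ≤ L * (t + ρ) := by gcongr
    have h6 := abs_sub_abs_le_abs_sub (ψ (y + s • e)) (ψ x)
    linarith
  set c := ⨆ z ∈ T, ENNReal.ofReal |ψ z| with hc
  calc ∫⁻ z in T, ENNReal.ofReal |ψ z| ≤ ∫⁻ z in T, c := by
        refine setLIntegral_mono measurable_const fun z hz => ?_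
        exact le_iSup₂ (f := fun z (_ : z ∈ T) => ENNReal.ofReal |ψ z|) z hz
    _ = c * volume T := by rw [setLIntegral_const]
    _ ≤ c * (ENNReal.ofReal (t + ρ) * μHE[n - 1] (A ∩ B i)) := by
        gcongr
        exact tube1 he ht fun x hx y hy => hBs i x hx.2 y hy.2
    _ = ENNReal.ofReal (t + ρ) * (∫⁻ x in A ∩ B i, c ∂μHE[n - 1]) := by
        rw [setLIntegral_const]; ring
    _ ≤ _ := by
        gcongr ENNReal.ofReal (t + ρ) * ?_
        refine setLIntegral_mono' (hA.inter (hBm i)) fun x hx => ?_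
        exact iSup₂_le fun z hz => h1 z hz x hx
end PartC

section PartD
theorem segment_frontier {n : ℕ} {E : Set (Euc n)} {x e : Euc n} {t : ℝ} (ht : 0 ≤ t)
    (h : ¬ (x - t • e ∈ E ↔ x ∈ E)) : ∃ s ∈ Icc 0 t, x - s • e ∈ frontier E := by
  have hpc : IsPreconnected ((fun s : ℝ => x - s • e) '' Icc 0 t) :=
    isPreconnected_Icc.image _ (by fun_prop)
  have h0 : x ∈ (fun s : ℝ => x - s • e) '' Icc 0 t := ⟨0, ⟨le_rfl, ht⟩, by simp⟩
  have h1 : x - t • e ∈ (fun s : ℝ => x - s • e) '' Icc 0 t := ⟨t, ⟨ht, le_rfl⟩, rfl⟩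
  by_contra hcon
  push Not at hcon
  have hav : ∀ y ∈ (fun s : ℝ => x - s • e) '' Icc 0 t, (y ∈ E → y ∈ interior E) ∧
      (y ∉ E → y ∈ interior Eᶜ) := by
    rintro _ ⟨s, hs, rfl⟩
    have := hcon s hs
    rw [frontier_eq_closure_inter_closure, mem_inter_iff, not_and_or] at this
    constructor
    · intro hE
      rcases this with h | h
      · exact absurd (subset_closure hE) h
      · rwa [closure_compl, notMem_compl_iff] at h
    · intro hE
      rcases this with h | h
      · rw [interior_compl]; exact h
      · exact absurd (subset_closure hE) h
  have := hpc (interior E) (interior Eᶜ) isOpen_interior isOpen_interior (by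
    intro y hy
    by_cases hyE : y ∈ E
    · exact Or.inl ((hav y hy).1 hyE)
    · exact Or.inr ((hav y hy).2 hyE))
  by_cases hx : x ∈ E
  · have h2 : x - t • e ∉ E := by tauto
    obtain ⟨y, -, hy1, hy2⟩ := this ⟨x, h0, (hav _ h0).1 hx⟩ ⟨_, h1, (hav _ h1).2 h2⟩
    exact interior_subset hy2 (interior_subset hy1)
  · have h2 : x - t • e ∈ E := by tauto
    obtain ⟨y, -, hy1, hy2⟩ := this ⟨_, h1, (hav _ h1).1 h2⟩ ⟨x, h0, (hav _ h0).2 hx⟩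
    exact interior_subset hy2 (interior_subset hy1)

theorem di_scalar {n : ℕ} {E C : Set (Euc n)} (hE : IsOpen E) (hC : IsCompact C)
    (hfin : μHE[n - 1] (frontier E ∩ C) < ⊤) {e : Euc n} (he : ‖e‖ = 1) {ψ : Euc n → ℝ}
    {K : ℝ≥0} (hψ : LipschitzWith K ψ) (hcs : HasCompactSupport ψ) {δ : ℝ} (hδ : 0 < δ)
    (hsub : cthickening δ (tsupport ψ) ⊆ C) :
    |∫ x in E, lineDeriv ℝ ψ x e| ≤ ∫ x in frontier E ∩ C, |ψ x| ∂μHE[n - 1] := by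
  set A := frontier E ∩ C with hAdef
  have hAm : MeasurableSet A := isClosed_frontier.measurableSet.inter hC.measurableSet
  set μ := (μHE[n - 1] : Measure (Euc n)).restrict A with hμ
  haveI : IsFiniteMeasure μ := ⟨by rw [hμ, Measure.restrict_apply_univ]; exact hfin⟩
  have htsub : tsupport ψ ⊆ C := (self_subset_cthickening _).trans hsub
  have hψint : Integrable ψ := hψ.continuous.integrable_of_hasCompactSupport hcs
  obtain ⟨M, hM⟩ := hψ.continuous.bounded_above_of_compact_support hcs
  have hψμ : Integrable (fun x => |ψ x|) μ := by
    refine Integrable.of_bound (hψ.continuous.abs.aestronglyMeasurable) M (ae_of_all _ fun x => ?_)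
    rw [Real.norm_eq_abs, abs_abs]; exact hM x
  set g : Euc n → ℝ := (E ∩ C).indicator 1 with hg
  have hgi : Integrable g :=
    (integrable_indicator_iff (hE.measurableSet.inter hC.measurableSet)).2
      (integrableOn_const (hs := ne_of_lt (lt_of_le_of_lt (measure_mono inter_subset_right) hC.measure_lt_top)))
  have hlim := hψ.integral_inv_smul_sub_mul_tendsto_integral_lineDeriv_mul (μ := volume) hgi e
  have heq : ∫ x, lineDeriv ℝ ψ x e * g x = ∫ x in E, lineDeriv ℝ ψ x e := by
    rw [← integral_indicator hE.measurableSet]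
    refine integral_congr_ae (ae_of_all _ fun x => ?_)
    simp only [hg, indicator, mem_inter_iff, Pi.one_apply]
    by_cases hxE : x ∈ E
    · by_cases hxC : x ∈ C
      · simp [hxE, hxC]
      · have : lineDeriv ℝ ψ x e = 0 := by
          have h0 : ψ =ᶠ[𝓝 x] fun _ => 0 :=
            notMem_tsupport_iff_eventuallyEq.1 fun h => hxC (htsub h)
          rw [h0.lineDeriv_eq]
          simp [lineDeriv]
        simp [this, hxC]
    · simp [hxE]
  rw [heq] at hlim
  have hlim2 : Filter.Tendsto (fun t : ℝ => (1 + t) * (∫ x, |ψ x| ∂μ + K * (t + t ^ 2) * μ.real univ))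
      (𝓝[>] 0) (𝓝 (∫ x, |ψ x| ∂μ)) := by
    have : Filter.Tendsto (fun t : ℝ => (1 + t) * (∫ x, |ψ x| ∂μ + K * (t + t ^ 2) * μ.real univ))
      (𝓝 0) (𝓝 ((1 + 0) * (∫ x, |ψ x| ∂μ + K * (0 + 0 ^ 2) * μ.real univ))) := by
      apply Continuous.tendsto; fun_prop
    have h2 := this.mono_left (nhdsWithin_le_nhds (s := Ioi 0))
    simpa using h2
  refine le_of_tendsto_of_tendsto hlim.abs hlim2 ?_
  filter_upwards [Ioo_mem_nhdsGT hδ] with t ht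
  have ht0 : 0 < t := ht.1
  set T := {z : Euc n | ∃ x ∈ A, ∃ s ∈ Icc 0 t, z = x + s • e} with hT
  -- rewrite the integral
  have hI : ∫ x, (t⁻¹ • (ψ (x + t • e) - ψ x)) * g x =
      t⁻¹ * ∫ x, ψ x * (E.indicator 1 (x - t • e) - E.indicator 1 x) := by
    have i1 : Integrable (fun x => ψ x * E.indicator (1 : Euc n → ℝ) (x - t • e)) := by
      refine hψint.mul_bdd (c := 1) ?_ (ae_of_all _ fun x => ?_)
      · exact ((measurable_one.indicator hE.measurableSet).comp
          (measurable_id.sub_const _)).aestronglyMeasurable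
      · simp only [indicator, Pi.one_apply]; split_ifs <;> simp
    have i2 : Integrable (fun x => ψ x * E.indicator (1 : Euc n → ℝ) x) := by
      refine hψint.mul_bdd (c := 1) ?_ (ae_of_all _ fun x => ?_)
      · exact (measurable_one.indicator hE.measurableSet).aestronglyMeasurable
      · simp only [indicator, Pi.one_apply]; split_ifs <;> simp
    simp_rw [mul_sub]
    rw [integral_sub i1 i2, ← integral_add_right_eq_self (fun x => ψ x * E.indicator (1 : Euc n → ℝ) (x - t • e)) (t • e),
      ← integral_sub (i1.comp_add_right _) i2, ← integral_const_mul]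
    refine integral_congr_ae (ae_of_all _ fun x => ?_)
    simp only [add_sub_cancel_right, smul_eq_mul]
    by_cases hxC : x ∈ C
    · by_cases hxE : x ∈ E
      · simp [hg, hxE, hxC]
      · simp [hg, hxE]
    · have h1 : ψ x = 0 := by
        by_contra h; exact hxC (htsub (subset_tsupport _ h))
      have h2 : ψ (x + t • e) = 0 := by
        by_contra h
        refine hxC (hsub ?_)
        refine mem_cthickening_of_dist_le x (x + t • e) δ _ (subset_tsupport _ h) ?_
        rw [dist_eq_norm, sub_add_cancel_left, norm_neg, norm_smul, he, mul_one,
          Real.norm_of_nonneg ht0.le]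
        exact ht.2.le
      simp [h1, h2]
  rw [hI, abs_mul, abs_of_pos (inv_pos.2 ht0), inv_mul_le_iff₀ ht0]
  have hb : |∫ x, ψ x * (E.indicator 1 (x - t • e) - E.indicator 1 x)| ≤
      (∫⁻ z in T, ENNReal.ofReal |ψ z|).toReal := by
    have hfinT : ∫⁻ z in T, ENNReal.ofReal |ψ z| ≠ ⊤ := by
      refine ne_top_of_le_ne_top ?_ (setLIntegral_le_lintegral _ _)
      have := hψint.2
      simpa [HasFiniteIntegral, Real.enorm_eq_ofReal_abs, lt_top_iff_ne_top] using this
    have h1 := enorm_integral_le_lintegral_enorm (μ := (volume : Measure (Euc n)))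
      (fun x => ψ x * (E.indicator 1 (x - t • e) - E.indicator 1 x))
    have h2 : ∫⁻ x, ‖ψ x * (E.indicator 1 (x - t • e) - E.indicator 1 x)‖ₑ ≤
        ∫⁻ z in T, ENNReal.ofReal |ψ z| := by
      have hTm : MeasurableSet T := by
        have hcomp : IsCompact T := by
          have : T = (fun p : Euc n × ℝ => p.1 + p.2 • e) '' (A ×ˢ Icc 0 t) := by
            ext z; constructor
            · rintro ⟨x, hx, s, hs, rfl⟩; exact ⟨(x, s), ⟨hx, hs⟩, rfl⟩
            · rintro ⟨⟨x, s⟩, ⟨hx, hs⟩, rfl⟩; exact ⟨x, hx, s, hs, rfl⟩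
          rw [this]
          exact ((hC.inter_left isClosed_frontier).prod isCompact_Icc).image (by fun_prop)
        exact hcomp.measurableSet
      rw [← lintegral_indicator hTm]
      refine lintegral_mono fun x => ?_
      by_cases hxT : x ∈ T
      · rw [indicator_of_mem hxT, enorm_mul, Real.enorm_eq_ofReal_abs]
        calc _ ≤ ENNReal.ofReal |ψ x| * 1 := by
              gcongr
              simp only [indicator, Pi.one_apply]; split_ifs <;> simp
          _ = _ := mul_one _
      · rw [indicator_of_notMem hxT]
        simp only [nonpos_iff_eq_zero, enorm_eq_zero, mul_eq_zero]
        by_contra hcon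
        push Not at hcon
        obtain ⟨h3, h4⟩ := hcon
        have h5 : ¬ (x - t • e ∈ E ↔ x ∈ E) := by
          intro h; apply h4
          by_cases hxE : x ∈ E
          · simp [hxE, h.2 hxE]
          · have hxE2 : x - t • e ∉ E := fun h5 => hxE (h.1 h5)
            simp [hxE, hxE2]
        obtain ⟨s, hs, hf⟩ := segment_frontier ht0.le h5
        refine hxT ⟨x - s • e, ⟨hf, hsub ?_⟩, s, hs, by simp⟩
        refine mem_cthickening_of_dist_le _ x δ _ (subset_tsupport _ h3) ?_
        rw [dist_eq_norm, sub_sub_cancel_left, norm_neg, norm_smul, he, mul_one,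
          Real.norm_of_nonneg hs.1]
        exact hs.2.trans ht.2.le
    have h3 := h1.trans h2
    rw [Real.enorm_eq_ofReal_abs] at h3
    exact (ENNReal.ofReal_le_iff_le_toReal hfinT).1 h3
  refine hb.trans ?_
  have ht2 : 0 < t ^ 2 := by positivity
  have hlip : ∀ x y, |ψ x - ψ y| ≤ K * dist x y := fun x y => by
    simpa [Real.dist_eq] using hψ.dist_le_mul x y
  have htube := tube2 he hAm ht0.le ht2 K.2 hlip
  have hrhs : ∫⁻ x in A, (ENNReal.ofReal |ψ x| + ENNReal.ofReal (K * (t + t ^ 2))) ∂μHE[n - 1] =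
      ENNReal.ofReal (∫ x, |ψ x| ∂μ + K * (t + t ^ 2) * μ.real univ) := by
    rw [lintegral_add_right _ measurable_const, lintegral_const,
      ← ofReal_integral_eq_lintegral_ofReal hψμ (ae_of_all _ fun x => abs_nonneg _),
      ENNReal.ofReal_add (integral_nonneg fun x => abs_nonneg _) (by positivity),
      ENNReal.ofReal_mul (by positivity : 0 ≤ (K : ℝ) * (t + t ^ 2)), ofReal_measureReal]
  rw [← hT] at htube
  change _ ≤ ENNReal.ofReal (t + t ^ 2) * ∫⁻ x in A, (ENNReal.ofReal |ψ x| + ENNReal.ofReal (K * (t + t ^ 2))) ∂μHE[n - 1] at htube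
  rw [hrhs, ← ENNReal.ofReal_mul (by positivity)] at htube
  refine (ENNReal.toReal_mono ENNReal.ofReal_ne_top htube).trans ?_
  have hnn : 0 ≤ ∫ x, |ψ x| ∂μ := integral_nonneg fun x => abs_nonneg _
  rw [ENNReal.toReal_ofReal (by positivity)]
  apply le_of_eq; ring
end PartD

section PartE
/-- trace of an operator -/
def tr {n : ℕ} (L : Euc n →L[ℝ] Euc n) : ℝ := ∑ i, (L (EuclideanSpace.single i 1)) i

/-- divergence -/
def dv {n : ℕ} (X : Euc n → Euc n) (x : Euc n) : ℝ := tr (fderiv ℝ X x)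

theorem tr_add {n : ℕ} (L M : Euc n →L[ℝ] Euc n) : tr (L + M) = tr L + tr M := by
  simp [tr, Finset.sum_add_distrib]

theorem tr_smul {n : ℕ} (c : ℝ) (L : Euc n →L[ℝ] Euc n) : tr (c • L) = c * tr L := by
  simp [tr, Finset.mul_sum]

theorem tr_sub {n : ℕ} (L M : Euc n →L[ℝ] Euc n) : tr (L - M) = tr L - tr M := by
  simp [tr, Finset.sum_sub_distrib]

theorem abs_coord_le {n : ℕ} (v : Euc n) (i : Fin n) : |v i| ≤ ‖v‖ := by
  simpa using PiLp.norm_apply_le (p := 2) v i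

theorem abs_tr_le {n : ℕ} (L : Euc n →L[ℝ] Euc n) : |tr L| ≤ n * ‖L‖ := by
  refine (Finset.abs_sum_le_sum_abs _ _).trans ?_
  refine (Finset.sum_le_card_nsmul _ _ ‖L‖ fun i _ => ?_).trans (by simp)
  refine (abs_coord_le _ i).trans ((L.le_opNorm _).trans (by simp))

theorem sum_single {n : ℕ} (v : Euc n) : ∑ i, v i • (EuclideanSpace.single i (1:ℝ) : Euc n) = v := by
  ext j
  simp [Finset.sum_apply, Pi.single_apply]

theorem tr_smulRight {n : ℕ} (l : Euc n →L[ℝ] ℝ) (v : Euc n) :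
    tr (l.smulRight v) = l v := by
  conv_rhs => rw [← sum_single v, map_sum]
  simp [tr, mul_comm]

theorem tr_one {n : ℕ} : tr (ContinuousLinearMap.id ℝ (Euc n)) = n := by
  simp [tr]

theorem continuous_tr {n : ℕ} : Continuous (tr : (Euc n →L[ℝ] Euc n) → ℝ) := by
  unfold tr
  refine continuous_finset_sum _ fun i _ => ?_
  have h1 : Continuous fun L : Euc n →L[ℝ] Euc n => L (EuclideanSpace.single i 1) := by fun_prop
  exact (EuclideanSpace.proj (𝕜 := ℝ) i).continuous.comp h1

theorem measurable_dv {n : ℕ} (X : Euc n → Euc n) : Measurable (dv X) :=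
  continuous_tr.measurable.comp (measurable_fderiv ℝ X)

theorem dv_smul {n : ℕ} {f : Euc n → ℝ} {X : Euc n → Euc n} {x : Euc n}
    (hf : DifferentiableAt ℝ f x) (hX : DifferentiableAt ℝ X x) :
    dv (fun x => f x • X x) x = f x * dv X x + fderiv ℝ f x (X x) := by
  have : fderiv ℝ (fun x => f x • X x) x = f x • fderiv ℝ X x + (fderiv ℝ f x).smulRight (X x) :=
    fderiv_fun_smul hf hX
  rw [dv, this, tr_add, tr_smul, tr_smulRight, dv]

theorem dv_add {n : ℕ} {X Y : Euc n → Euc n} {x : Euc n}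
    (hX : DifferentiableAt ℝ X x) (hY : DifferentiableAt ℝ Y x) :
    dv (fun x => X x + Y x) x = dv X x + dv Y x := by
  rw [dv, fderiv_fun_add hX hY, tr_add, dv, dv]

theorem BL.ae_diff {n : ℕ} {Y : Type*} [NormedAddCommGroup Y] [NormedSpace ℝ Y]
    [FiniteDimensional ℝ Y] {f : Euc n → Y} (hf : BL f) : ∀ᵐ x, DifferentiableAt ℝ f x :=
  hf.1.choose_spec.ae_differentiableAt

theorem BL.norm_fderiv {n : ℕ} {Y : Type*} [NormedAddCommGroup Y] [NormedSpace ℝ Y]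
    {f : Euc n → Y} (hf : BL f) : ∃ K : ℝ, 0 ≤ K ∧ ∀ x, ‖fderiv ℝ f x‖ ≤ K :=
  ⟨hf.1.choose, hf.1.choose.2, fun _ => norm_fderiv_le_of_lipschitz ℝ hf.1.choose_spec⟩

section DI
variable {n : ℕ} {E C T : Set (Euc n)} {δ : ℝ}

theorem fderiv_eq_zero_off {Y : Type*} [NormedAddCommGroup Y] [NormedSpace ℝ Y]
    {f : Euc n → Y} {x : Euc n} (h : x ∉ tsupport f) : fderiv ℝ f x = 0 := by
  by_contra h'
  exact h (tsupport_fderiv_subset ℝ (subset_tsupport _ h'))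

theorem int_fderiv (hT : IsCompact T) {ψ : Euc n → ℝ} (hψ : BL ψ) (hs : tsupport ψ ⊆ T)
    (a : Euc n) : Integrable (fun x => fderiv ℝ ψ x a) := by
  obtain ⟨K, hK, hb⟩ := hψ.norm_fderiv
  have h1 : IntegrableOn (fun x => fderiv ℝ ψ x a) T := by
    refine Measure.integrableOn_of_bounded (M := K * ‖a‖) hT.measure_lt_top.ne
      (measurable_fderiv_apply_const ℝ ψ a).aestronglyMeasurable (ae_of_all _ fun x => ?_)
    exact ((fderiv ℝ ψ x).le_opNorm a).trans (by gcongr; exact hb x)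
  refine (integrableOn_iff_integrable_of_support_subset ?_).1 h1
  intro x hx
  by_contra h
  exact hx (by simp [fderiv_eq_zero_off (fun h' => h (hs h'))])

theorem int_dv (hT : IsCompact T) {X : Euc n → Euc n} (hX : BL X) (hs : tsupport X ⊆ T) :
    Integrable (dv X) := by
  obtain ⟨K, hK, hb⟩ := hX.norm_fderiv
  have h1 : IntegrableOn (dv X) T := by
    refine Measure.integrableOn_of_bounded (M := n * K) hT.measure_lt_top.ne
      (measurable_dv X).aestronglyMeasurable (ae_of_all _ fun x => ?_)
    exact (abs_tr_le _).trans (by gcongr; exact hb x)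
  refine (integrableOn_iff_integrable_of_support_subset ?_).1 h1
  intro x hx
  by_contra h
  exact hx (by simp [dv, fderiv_eq_zero_off (fun h' => h (hs h')), tr])

theorem di_a (hE : IsOpen E) (hC : IsCompact C) (hfin : μHE[n - 1] (frontier E ∩ C) < ⊤)
    (hδ : 0 < δ) (hTC : cthickening δ T ⊆ C) {ψ : Euc n → ℝ} (hψ : BL ψ)
    (hs : tsupport ψ ⊆ T) (a : Euc n) :
    |∫ x in E, fderiv ℝ ψ x a| ≤ ‖a‖ * ∫ x in frontier E ∩ C, |ψ x| ∂μHE[n - 1] := by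
  rcases eq_or_ne a 0 with rfl | ha
  · simp
  have hna : 0 < ‖a‖ := norm_pos_iff.2 ha
  have hTC' : T ⊆ C := (self_subset_cthickening T).trans hTC
  have hcs : HasCompactSupport ψ := hC.of_isClosed_subset (isClosed_tsupport _) (hs.trans hTC')
  have h := di_scalar hE hC hfin (e := ‖a‖⁻¹ • a) (by rw [norm_smul, norm_inv, norm_norm, inv_mul_cancel₀ hna.ne'])
    hψ.1.choose_spec hcs hδ ((cthickening_subset_of_subset _ hs).trans hTC)
  have e : ∫ x in E, fderiv ℝ ψ x a = ‖a‖ * ∫ x in E, lineDeriv ℝ ψ x (‖a‖⁻¹ • a) := by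
    rw [← integral_const_mul]
    refine integral_congr_ae (ae_restrict_of_ae ?_)
    filter_upwards [hψ.ae_diff] with x hx
    rw [hx.lineDeriv_eq_fderiv, map_smul, smul_eq_mul, mul_inv_cancel_left₀ hna.ne']
  rw [e, abs_mul, abs_norm]
  gcongr

theorem intg_bdd (hfin : μHE[n - 1] (frontier E ∩ C) < ⊤) {Y : Type*} [NormedAddCommGroup Y]
    [SecondCountableTopology Y]
    [NormedSpace ℝ Y] [MeasurableSpace Y] [BorelSpace Y] {f : Euc n → Y} (hf : BL f) :
    Integrable f (μHE[n - 1].restrict (frontier E ∩ C)) := by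
  haveI : IsFiniteMeasure ((μHE[n - 1] : Measure (Euc n)).restrict (frontier E ∩ C)) := ⟨by simpa using hfin⟩
  exact Integrable.of_bound hf.cont.measurable.aestronglyMeasurable hf.2.choose (ae_of_all _ hf.2.choose_spec)

theorem coord_BL {Y : Euc n → Euc n} (hY : BL Y) (i : Fin n) : BL (fun x => Y x i) :=
  hY.clm (EuclideanSpace.proj (𝕜 := ℝ) i)

theorem di_b (hE : IsOpen E) (hC : IsCompact C) (hfin : μHE[n - 1] (frontier E ∩ C) < ⊤)
    (hδ : 0 < δ) (hT : IsCompact T) (hTC : cthickening δ T ⊆ C) {Y : Euc n → Euc n} (hY : BL Y)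
    (hs : tsupport Y ⊆ T) :
    ∫ x in E, dv Y x ≤ n * ∫ x in frontier E ∩ C, ‖Y x‖ ∂μHE[n - 1] := by
  have hsi : ∀ i, tsupport (fun x => Y x i) ⊆ T := fun i => by
    refine (closure_mono fun x hx => ?_).trans hs
    intro h; exact hx (by simp [h])
  have e : ∫ x in E, dv Y x = ∑ i, ∫ x in E, fderiv ℝ (fun x => Y x i) x (EuclideanSpace.single i 1) := by
    rw [← integral_finset_sum]
    · refine integral_congr_ae (ae_restrict_of_ae ?_)
      filter_upwards [hY.ae_diff] with x hx
      rw [dv, tr]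
      refine Finset.sum_congr rfl fun i _ => ?_
      have : HasFDerivAt (fun x => Y x i) ((EuclideanSpace.proj (𝕜 := ℝ) i : Euc n →L[ℝ] ℝ).comp (fderiv ℝ Y x)) x :=
        (EuclideanSpace.proj (𝕜 := ℝ) i : Euc n →L[ℝ] ℝ).hasFDerivAt.comp x hx.hasFDerivAt
      rw [this.fderiv]; rfl
    · exact fun i _ => (int_fderiv hT (coord_BL hY i) (hsi i) _).integrableOn
  rw [e]
  refine (Finset.sum_le_card_nsmul _ _ (∫ x in frontier E ∩ C, ‖Y x‖ ∂μHE[n - 1]) fun i _ => ?_).trans (by simp)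
  refine (le_abs_self _).trans ((di_a hE hC hfin hδ hTC (coord_BL hY i) (hsi i) _).trans ?_)
  simp only [PiLp.norm_single, norm_one, one_mul]
  refine integral_mono ?_ (intg_bdd hfin hY.norm) fun x => abs_coord_le _ i
  exact intg_bdd hfin (coord_BL hY i).norm

theorem di_list (hE : IsOpen E) (hC : IsCompact C) (hfin : μHE[n - 1] (frontier E ∩ C) < ⊤)
    (hδ : 0 < δ) (hT : IsCompact T) (hTC : cthickening δ T ⊆ C) {X : Euc n → Euc n} (hX : BL X)
    {ρ ε : ℝ} (hρ : 0 < ρ) (hε : 0 < ε) (hXε : ∀ x p, dist x p ≤ 2 * ρ → ‖X x - X p‖ ≤ ε)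
    (l : List (Euc n)) : ∀ g : Euc n → ℝ, BL g → (∀ x, 0 ≤ g x) → tsupport g ⊆ T →
    (∀ x, g x ≠ 0 → ∃ p ∈ l, dist x p < ρ) →
    ∫ x in E, dv (fun x => g x • X x) x ≤
      ∫ x in frontier E ∩ C, g x * (‖X x‖ + (n + 1) * ε) ∂μHE[n - 1] := by
  induction l with
  | nil =>
    intro g _ _ _ hl
    have : g = 0 := by ext x; by_contra h; obtain ⟨p, hp, _⟩ := hl x h; simp at hp
    subst this
    simp [dv, tr]
  | cons p l ih =>
    intro g hg hg0 hgs hl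
    set θ : Euc n → ℝ := fun x => max 0 (min 1 (2 - dist x p / ρ)) with hθ
    have hθBL : BL θ := by
      refine ⟨⟨_, (LipschitzWith.const_min (Kf := Real.toNNReal (1/ρ)) ?_ 1).const_max 0⟩, 1, fun x => ?_⟩
      · refine LipschitzWith.of_dist_le_mul fun x y => ?_
        rw [Real.dist_eq, Real.coe_toNNReal _ (by positivity)]
        rw [show 2 - dist x p / ρ - (2 - dist y p / ρ) = - (1/ρ * (dist x p - dist y p)) by field_simp; ring,
          abs_neg, abs_mul, abs_of_pos (by positivity : 0 < 1 / ρ)]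
        gcongr
        exact abs_dist_sub_le x y p
      · rw [Real.norm_of_nonneg (le_max_left _ _)]
        exact max_le zero_le_one (min_le_left _ _)
    have hθ0 : ∀ x, 0 ≤ θ x := fun x => le_max_left _ _
    have hθ1 : ∀ x, θ x ≤ 1 := fun x => max_le zero_le_one (min_le_left _ _)
    have hθsupp : ∀ x, θ x ≠ 0 → dist x p ≤ 2 * ρ := by
      intro x hx
      by_contra h
      push Not at h
      refine hx (max_eq_left ((min_le_right _ _).trans ?_))
      have : 2 < dist x p / ρ := by rwa [lt_div_iff₀ hρ]
      linarith
    have hθone : ∀ x, dist x p < ρ → θ x = 1 := by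
      intro x hx
      have : dist x p / ρ < 1 := by rwa [div_lt_one hρ]
      simp only [hθ]
      rw [min_eq_left (by linarith), max_eq_right zero_le_one]
    have hgθ : BL (fun x => g x * θ x) := hg.mul hθBL
    have hgθ' : BL (fun x => g x * (1 - θ x)) := hg.mul ((BL.const 1).sub hθBL)
    have hs1 : tsupport (fun x => g x * θ x) ⊆ T :=
      (closure_mono fun x hx => left_ne_zero_of_mul hx).trans hgs
    have hs2 : tsupport (fun x => g x * (1 - θ x)) ⊆ T :=
      (closure_mono fun x hx => left_ne_zero_of_mul hx).trans hgs
    have hA := ih _ hgθ' (fun x => mul_nonneg (hg0 x) (sub_nonneg.2 (hθ1 x))) hs2 (by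
      intro x hx
      obtain ⟨q, hq, hd⟩ := hl x (left_ne_zero_of_mul hx)
      rcases List.mem_cons.1 hq with rfl | hq
      · exact absurd (by rw [hθone x hd, sub_self, mul_zero]) hx
      · exact ⟨q, hq, hd⟩)
    have hB := (le_abs_self _).trans (di_a hE hC hfin hδ hTC hgθ hs1 (X p))
    have hXp : BL (fun x => X x - X p) := hX.sub (BL.const _)
    have hs3 : tsupport (fun x => (g x * θ x) • (X x - X p)) ⊆ T :=
      (closure_mono fun x hx => left_ne_zero_of_smul hx).trans hs1
    have hCc := di_b hE hC hfin hδ hT hTC (hgθ.smul hXp) hs3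
    have hs4 : tsupport (fun x => (g x * (1 - θ x)) • X x) ⊆ T :=
      (closure_mono fun x hx => left_ne_zero_of_smul hx).trans hs2
    have e : ∫ x in E, dv (fun x => g x • X x) x = (∫ x in E, dv (fun x => (g x * (1 - θ x)) • X x) x)
        + (∫ x in E, fderiv ℝ (fun x => g x * θ x) x (X p))
        + ∫ x in E, dv (fun x => (g x * θ x) • (X x - X p)) x := by
      have j1 := (int_dv hT (hgθ'.smul hX) hs4).integrableOn (s := E)
      have j2 := (int_fderiv hT hgθ hs1 (X p)).integrableOn (s := E)
      have j3 := (int_dv hT (hgθ.smul hXp) hs3).integrableOn (s := E)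
      have j12 : IntegrableOn (fun x => dv (fun x => (g x * (1 - θ x)) • X x) x +
        fderiv ℝ (fun x => g x * θ x) x (X p)) E := j1.add j2
      rw [← integral_add j1 j2, ← integral_add j12 j3]
      refine integral_congr_ae (ae_restrict_of_ae ?_)
      filter_upwards [hg.ae_diff, hgθ.ae_diff, hgθ'.ae_diff, hX.ae_diff] with x h1 h2 h3 h4
      have h5 : DifferentiableAt ℝ (fun x => X x - X p) x := h4.sub_const _
      have h6 : DifferentiableAt ℝ (fun _ : Euc n => X p) x := differentiableAt_const _
      have eq : (fun x => g x • X x) = fun x => ((g x * (1 - θ x)) • X x + (g x * θ x) • X p) +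
          (g x * θ x) • (X x - X p) := by
        ext1 x; module
      rw [eq, dv_add ((h3.fun_smul h4).fun_add (h2.fun_smul h6)) (h2.fun_smul h5),
        dv_add (h3.fun_smul h4) (h2.fun_smul h6), dv_smul h2 h6]
      have : dv (fun _ : Euc n => X p) x = 0 := by simp [dv, tr]
      rw [this, mul_zero, zero_add]
    rw [e]
    refine (add_le_add (add_le_add hA hB) hCc).trans ?_
    rw [← integral_const_mul, ← integral_const_mul]
    have iK : BL (fun x => ‖X x‖ + (n + 1) * ε) := hX.norm.add (BL.const _)
    have i1 := intg_bdd (E := E) (C := C) hfin (hgθ'.mul iK)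
    have i2 := intg_bdd (E := E) (C := C) hfin ((BL.const ‖X p‖).mul hgθ.norm)
    have i3 := intg_bdd (E := E) (C := C) hfin ((BL.const (n:ℝ)).mul (hgθ.smul hXp).norm)
    have i4 := intg_bdd (E := E) (C := C) hfin (hg.mul iK)
    simp only [Real.norm_eq_abs] at i2
    have i12 : Integrable (fun x => g x * (1 - θ x) * (‖X x‖ + (n + 1) * ε) + ‖X p‖ * |g x * θ x|)
      (μHE[n - 1].restrict (frontier E ∩ C)) := i1.add i2
    rw [← integral_add i1 i2, ← integral_add i12 i3]
    refine integral_mono (i12.add i3) i4 fun x => ?_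
    have hgp : 0 ≤ g x * θ x := mul_nonneg (hg0 x) (hθ0 x)
    simp only [Pi.add_apply]
    rw [abs_of_nonneg hgp, norm_smul, Real.norm_of_nonneg hgp]
    by_cases hz : θ x = 0
    · simp [hz]
    · have h1 := hXε x p (hθsupp x hz)
      have h2 : ‖X p‖ ≤ ‖X x‖ + ε := by
        have := norm_sub_norm_le (X p) (X x); rw [norm_sub_rev] at this; linarith
      have h3 : ‖X p‖ * (g x * θ x) ≤ (‖X x‖ + ε) * (g x * θ x) := by gcongr
      have h4 : (n:ℝ) * (g x * θ x * ‖X x - X p‖) ≤ n * (g x * θ x * ε) := by gcongr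
      linarith

/-- Unweighted divergence inequality. -/
theorem di0 (hE : IsOpen E) (hC : IsCompact C) (hfin : μHE[n - 1] (frontier E ∩ C) < ⊤)
    (hδ : 0 < δ) {X : Euc n → Euc n} (hX : BL X)
    (hXC : cthickening δ (tsupport X) ⊆ C) :
    ∫ x in E, dv X x ≤ ∫ x in frontier E ∩ C, ‖X x‖ ∂μHE[n - 1] := by
  rcases (tsupport X).eq_empty_or_nonempty with h0 | hne
  · have : X = 0 := tsupport_eq_empty_iff.1 h0
    subst this; simp [dv, tr]
  set χ : Euc n → ℝ := fun x => max 0 (1 - infDist x (tsupport X) / (δ/2)) with hχ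
  have hχBL : BL χ := by
    refine ⟨⟨_, LipschitzWith.const_max (Kf := Real.toNNReal (1/(δ/2))) ?_ 0⟩, 1, fun x => ?_⟩
    · refine LipschitzWith.of_dist_le_mul fun x y => ?_
      rw [Real.dist_eq, Real.coe_toNNReal _ (by positivity)]
      rw [show 1 - infDist x (tsupport X) / (δ/2) - (1 - infDist y (tsupport X) / (δ/2)) =
        - (1/(δ/2) * (infDist x (tsupport X) - infDist y (tsupport X))) by field_simp; ring,
        abs_neg, abs_mul, abs_of_pos (by positivity : 0 < 1 / (δ/2))]
      gcongr
      simpa [Real.dist_eq] using (lipschitz_infDist_pt (tsupport X)).dist_le_mul x y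
    · rw [Real.norm_of_nonneg (le_max_left _ _)]
      refine max_le zero_le_one (sub_le_self _ (div_nonneg infDist_nonneg (by positivity)))
  set T := cthickening (δ/2) (tsupport X) with hTdef
  have hTC : cthickening (δ/2) T ⊆ C := by
    refine (cthickening_cthickening_subset (by positivity) (by positivity) _).trans ?_
    rwa [add_halves]
  have hT : IsCompact T := hC.of_isClosed_subset isClosed_cthickening ((self_subset_cthickening T).trans hTC)
  have hs : tsupport χ ⊆ T := by
    refine closure_minimal (fun x hx => ?_) isClosed_cthickening
    rw [hTdef, cthickening_eq_preimage_infEDist]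
    have h1 : infDist x (tsupport X) ≤ δ/2 := by
      by_contra h
      push Not at h
      refine hx (max_eq_left ?_)
      have : 1 < infDist x (tsupport X) / (δ/2) := by rwa [one_lt_div (by positivity)]
      linarith
    show infEDist x _ ≤ _
    rw [← ENNReal.ofReal_toReal (infEDist_ne_top hne)]
    exact ENNReal.ofReal_le_ofReal h1
  have eqX : (fun x => χ x • X x) = X := by
    ext1 x
    by_cases h : X x = 0
    · simp [h]
    · have : infDist x (tsupport X) = 0 := infDist_zero_of_mem (subset_tsupport _ h)
      simp [hχ, this]
  have hχ0 : ∀ x, 0 ≤ χ x := fun x => le_max_left _ _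
  have hχ1 : ∀ x, χ x ≤ 1 := fun x =>
    max_le zero_le_one (sub_le_self _ (div_nonneg infDist_nonneg (by positivity)))
  have key : ∀ ε > 0, ∫ x in E, dv X x ≤ ∫ x in frontier E ∩ C, (‖X x‖ + (n + 1) * ε) ∂μHE[n - 1] := by
    intro ε hε
    obtain ⟨K, M, hK, hM, h1, h2⟩ := hX.bd
    obtain ⟨ρ, hρ, hKρ⟩ : ∃ ρ > 0, K * (2 * ρ) ≤ ε := by
      refine ⟨ε / (2 * (K + 1)), by positivity, ?_⟩
      rw [show K * (2 * (ε / (2 * (K + 1)))) = ε * (K / (K+1)) by field_simp]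
      have : K / (K+1) ≤ 1 := by rw [div_le_one (by positivity)]; linarith
      nlinarith
    obtain ⟨t, htf, ht⟩ := (totallyBounded_iff.1 hT.totallyBounded) ρ hρ
    have := di_list hE hC hfin (half_pos hδ) hT hTC hX hρ hε (fun x p hxp => by
      rw [← dist_eq_norm]
      exact (h1 x p).trans (by refine le_trans ?_ hKρ; gcongr)) htf.toFinset.toList χ hχBL hχ0 hs (by
        intro x hx
        have := ht (hs (subset_tsupport _ hx))
        simp only [mem_iUnion] at this
        obtain ⟨p, hp, hd⟩ := this
        exact ⟨p, by simpa using hp, hd⟩)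
    rw [eqX] at this
    refine this.trans ?_
    have iK : BL (fun x => ‖X x‖ + (n + 1) * ε) := hX.norm.add (BL.const _)
    refine integral_mono (intg_bdd hfin (hχBL.mul iK)) (intg_bdd hfin iK) fun x => ?_
    have : 0 ≤ ‖X x‖ + (n + 1) * ε := by positivity
    exact mul_le_of_le_one_left this (hχ1 x)
  haveI : IsFiniteMeasure ((μHE[n - 1] : Measure (Euc n)).restrict (frontier E ∩ C)) := ⟨by simpa using hfin⟩
  have key2 : ∀ ε > 0, ∫ x in E, dv X x ≤ (∫ x in frontier E ∩ C, ‖X x‖ ∂μHE[n - 1]) +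
      ε * ((n + 1) * ((μHE[n - 1] : Measure (Euc n)).restrict (frontier E ∩ C)).real univ) := by
    intro ε hε
    refine (key ε hε).trans (le_of_eq ?_)
    rw [integral_add (intg_bdd hfin hX.norm) (integrable_const _), integral_const, smul_eq_mul]
    ring
  refine ge_of_tendsto (f := fun ε : ℝ => (∫ x in frontier E ∩ C, ‖X x‖ ∂μHE[n - 1]) +
      ε * ((n + 1) * ((μHE[n - 1] : Measure (Euc n)).restrict (frontier E ∩ C)).real univ)) (x := 𝓝[>] 0) ?_ ?_
  · refine tendsto_nhdsWithin_of_tendsto_nhds ?_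
    refine Continuous.tendsto' (by fun_prop) _ _ (by simp)
  · filter_upwards [self_mem_nhdsWithin] with ε hε using key2 ε hε

end DI
end PartE

section PartF
/-- weight extended by zero -/
def wS {n : ℕ} (S : Set (Euc n)) (w : Euc n → ℝ) : Euc n → ℝ := S.indicator w

/-- weighted volume measure -/
def mw {n : ℕ} (S : Set (Euc n)) (w : Euc n → ℝ) : Measure (Euc n) :=
  volume.withDensity (fun x => ENNReal.ofReal (wS S w x))

/-- weighted boundary measure -/
def mb {n : ℕ} (S : Set (Euc n)) (w : Euc n → ℝ) (E : Set (Euc n)) : Measure (Euc n) :=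
  ((μHE[n - 1] : Measure (Euc n)).restrict (frontier E)).withDensity (fun x => ENNReal.ofReal (wS S w x))

/-- piecewise linear ramp -/
def ramp (s : ℝ) : ℝ := max 0 (min 1 s)

theorem ramp_nonneg (s : ℝ) : 0 ≤ ramp s := le_max_left _ _
theorem ramp_le (s : ℝ) : ramp s ≤ 1 := max_le zero_le_one (min_le_left _ _)
theorem ramp_zero {s : ℝ} (h : s ≤ 0) : ramp s = 0 := max_eq_left ((min_le_right _ _).trans h)
theorem ramp_one {s : ℝ} (h : 1 ≤ s) : ramp s = 1 := by
  rw [ramp, min_eq_left h, max_eq_right zero_le_one]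
theorem ramp_eq {s : ℝ} (h0 : 0 ≤ s) (h : s ≤ 1) : ramp s = s := by
  rw [ramp, min_eq_right h, max_eq_right h0]
theorem ramp_lip : LipschitzWith 1 ramp := by
  have := (LipschitzWith.id (α := ℝ)).const_min 1
  exact this.const_max 0

theorem ramp_BL {X : Type*} [PseudoMetricSpace X] {f : X → ℝ} (hf : ∃ K, LipschitzWith K f) :
    BL (fun x => ramp (f x)) := by
  obtain ⟨K, hK⟩ := hf
  exact ⟨⟨_, ramp_lip.comp hK⟩, 1, fun x => by
    rw [Real.norm_of_nonneg (ramp_nonneg _)]; exact ramp_le _⟩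

theorem ramp_fderiv {n : ℕ} {f : Euc n → ℝ} {x : Euc n} (hf : DifferentiableAt ℝ f x) :
    ∃ c : ℝ, 0 ≤ c ∧ c ≤ 1 ∧ (c ≠ 0 → 0 < f x ∧ f x < 1) ∧
      fderiv ℝ (fun x => ramp (f x)) x = c • fderiv ℝ f x := by
  rcases le_or_gt (f x) 0 with h | h
  · refine ⟨0, le_rfl, zero_le_one, by simp, ?_⟩
    rw [zero_smul]
    refine IsLocalMin.fderiv_eq_zero (Filter.Eventually.of_forall fun y => ?_)
    simp only [ramp_zero h]; exact ramp_nonneg _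
  rcases le_or_gt 1 (f x) with h' | h'
  · refine ⟨0, le_rfl, zero_le_one, by simp, ?_⟩
    rw [zero_smul]
    refine IsLocalMax.fderiv_eq_zero (Filter.Eventually.of_forall fun y => ?_)
    simp only [ramp_one h']; exact ramp_le _
  refine ⟨1, zero_le_one, le_rfl, fun _ => ⟨h, h'⟩, ?_⟩
  rw [one_smul]
  refine Filter.EventuallyEq.fderiv_eq ?_
  filter_upwards [hf.continuousAt.eventually (Ioo_mem_nhds h h')] with y hy
  exact ramp_eq hy.1.le hy.2.le

namespace CW
variable {n k : ℕ} {α : ℝ} {S : Set (Euc n)} {w : Euc n → ℝ}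

theorem wS_meas (H : CW n k α S w) : Measurable (wS S w) := by
  classical
  rw [wS, ← Set.piecewise_eq_indicator]
  exact ContinuousOn.measurable_piecewise (H.w_cont.mono subset_closure) continuousOn_const
    H.isOpen.measurableSet

theorem wS_nonneg (H : CW n k α S w) (x : Euc n) : 0 ≤ wS S w x :=
  indicator_nonneg (fun x hx => H.w_nonneg (subset_closure hx)) x

theorem wS_eq {x : Euc n} (hx : x ∈ S) : wS S w x = w x := indicator_of_mem hx _

theorem int_mw (H : CW n k α S w) (E : Set (Euc n)) (hE : MeasurableSet E) (f : Euc n → ℝ) :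
    ∫ x in E, f x ∂(mw S w) = ∫ x in E, wS S w x * f x := by
  rw [mw, restrict_withDensity hE, integral_withDensity_eq_integral_toReal_smul
    H.wS_meas.ennreal_ofReal (by simp)]
  simp [ENNReal.toReal_ofReal (H.wS_nonneg _)]

theorem intble_mw (H : CW n k α S w) (E : Set (Euc n)) (hE : MeasurableSet E) (f : Euc n → ℝ) :
    IntegrableOn f E (mw S w) ↔ IntegrableOn (fun x => wS S w x * f x) E := by
  rw [IntegrableOn, mw, restrict_withDensity hE, integrable_withDensity_iff_integrable_smul'
    H.wS_meas.ennreal_ofReal (by simp)]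
  simp [ENNReal.toReal_ofReal (H.wS_nonneg _), IntegrableOn]

theorem int_mb (H : CW n k α S w) (E : Set (Euc n)) (f : Euc n → ℝ) :
    ∫ x, f x ∂(mb S w E) = ∫ x in frontier E, wS S w x * f x ∂μHE[n - 1] := by
  rw [mb, integral_withDensity_eq_integral_toReal_smul H.wS_meas.ennreal_ofReal (by simp)]
  simp [ENNReal.toReal_ofReal (H.wS_nonneg _)]

theorem intble_mb (H : CW n k α S w) (E : Set (Euc n)) (f : Euc n → ℝ) :
    Integrable f (mb S w E) ↔ IntegrableOn (fun x => wS S w x * f x) (frontier E) μHE[n - 1] := by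
  rw [mb, integrable_withDensity_iff_integrable_smul' H.wS_meas.ennreal_ofReal (by simp)]
  simp [ENNReal.toReal_ofReal (H.wS_nonneg _), IntegrableOn]

theorem mw_ac : mw S w ≪ volume := withDensity_absolutelyContinuous _ _

theorem ae_mw_S (H : CW n k α S w) : ∀ᵐ x ∂(mw S w), x ∈ S := by
  rw [mw, ae_withDensity_iff H.wS_meas.ennreal_ofReal]
  refine ae_of_all _ fun x hx => ?_
  by_contra h
  exact hx (by simp [wS, h])

theorem ae_mb_S (H : CW n k α S w) (E : Set (Euc n)) : ∀ᵐ x ∂(mb S w E), x ∈ S := by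
  rw [mb, ae_withDensity_iff H.wS_meas.ennreal_ofReal]
  refine ae_of_all _ fun x hx => ?_
  by_contra h
  exact hx (by simp [wS, h])

theorem mu_fin (H : CW n k α S w) {E C : Set (Euc n)} (hC : IsCompact C) (hCS : C ⊆ S)
    (hb : mb S w E univ < ⊤) : μHE[n - 1] (frontier E ∩ C) < ⊤ := by
  rcases C.eq_empty_or_nonempty with rfl | hne
  · simp
  obtain ⟨x0, hx0, hmin⟩ := hC.exists_isMinOn hne ((H.w_cont.mono subset_closure).mono hCS)
  have hpos : 0 < w x0 := H.w_pos (hCS hx0)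
  have h1 : ENNReal.ofReal (w x0) * μHE[n - 1] (frontier E ∩ C) ≤ mb S w E univ := by
    calc _ = ∫⁻ x in frontier E ∩ C, ENNReal.ofReal (w x0) ∂μHE[n-1] := by
          rw [setLIntegral_const]
      _ ≤ ∫⁻ x in frontier E ∩ C, ENNReal.ofReal (wS S w x) ∂μHE[n-1] := by
          refine setLIntegral_mono' (isClosed_frontier.measurableSet.inter hC.measurableSet) fun x hx => ?_
          rw [wS_eq (hCS hx.2)]
          exact ENNReal.ofReal_le_ofReal (hmin hx.2)
      _ ≤ ∫⁻ x in frontier E, ENNReal.ofReal (wS S w x) ∂μHE[n-1] :=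
          lintegral_mono_set inter_subset_left
      _ = mb S w E univ := by rw [mb, withDensity_apply _ MeasurableSet.univ, Measure.restrict_univ]
  have h2 := h1.trans_lt hb
  by_contra h
  rw [not_lt, top_le_iff] at h
  rw [h, ENNReal.mul_top (by simpa using hpos)] at h2
  exact lt_irrefl _ h2

theorem norm_intble_mb {E : Set (Euc n)} (hb : mb S w E univ < ⊤) {Y : Type*} [NormedAddCommGroup Y]
    [NormedSpace ℝ Y] [SecondCountableTopology Y] [MeasurableSpace Y] [BorelSpace Y]
    {f : Euc n → Y} (hf : BL f) : Integrable f (mb S w E) := by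
  haveI : IsFiniteMeasure (mb S w E) := ⟨hb⟩
  exact Integrable.of_bound hf.cont.measurable.aestronglyMeasurable hf.2.choose (ae_of_all _ hf.2.choose_spec)

/-- Cut-off version of the weighted divergence inequality -/
theorem wdi_cut (H : CW n k α S w) {E : Set (Euc n)} (hE : IsOpen E) (hES : E ⊆ S)
    (hv : mw S w E < ⊤) (hb : mb S w E univ < ⊤) {X : Euc n → Euc n} (hX : BL X) {M : ℝ}
    (hM : ∀ x, ‖X x‖ ≤ M) {F : Euc n → ℝ}
    (hF : Measurable F) {MF : ℝ} (hFb : ∀ x, |F x| ≤ MF) {c : ℝ} (hc : 0 ≤ c)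
    (h1 : ∀ᵐ x, x ∈ E → - c * infDist x Sᶜ ≤ fderiv ℝ (fun x => infDist x Sᶜ) x (X x))
    (h2 : ∀ᵐ x, x ∈ E → F x * w x ≤ w x * dv X x + fderiv ℝ w x (X x)) {t R : ℝ} (ht : 0 < t)
    (hR : 0 < R) :
    ∫ x in E, (ramp (infDist x Sᶜ / t - 1) * ramp (2 - ‖x‖ / R) * F x
      - (if infDist x Sᶜ < 2 * t then 2 * c else 0) - M / R) ∂(mw S w) ≤ ∫ x, ‖X x‖ ∂(mb S w E) := by
  set d : Euc n → ℝ := fun x => infDist x Sᶜ with hd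
  have hM0 : 0 ≤ M := (norm_nonneg _).trans (hM 0)
  set η : Euc n → ℝ := fun x => ramp (d x / t - 1) with hη
  set χ : Euc n → ℝ := fun x => ramp (2 - ‖x‖ / R) with hχ
  have ld : ∃ K, LipschitzWith K (fun x => d x / t - 1) := by
    refine ⟨Real.toNNReal (1/t), LipschitzWith.of_dist_le_mul fun x y => ?_⟩
    rw [Real.coe_toNNReal _ (by positivity), Real.dist_eq,
      show d x / t - 1 - (d y / t - 1) = 1 / t * (d x - d y) by field_simp; ring, abs_mul,
      abs_of_pos (by positivity : 0 < 1 / t)]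
    gcongr
    simpa [Real.dist_eq] using (d_lip (S := S)).dist_le_mul x y
  have lc : LipschitzWith (Real.toNNReal (1/R)) (fun x : Euc n => 2 - ‖x‖ / R) := by
    refine LipschitzWith.of_dist_le_mul fun x y => ?_
    rw [Real.coe_toNNReal _ (by positivity), Real.dist_eq,
      show 2 - ‖x‖ / R - (2 - ‖y‖ / R) = - (1 / R * (‖x‖ - ‖y‖)) by field_simp; ring, abs_neg, abs_mul,
      abs_of_pos (by positivity : 0 < 1 / R)]
    gcongr
    rw [dist_eq_norm]
    exact abs_norm_sub_norm_le x y
  have bη : BL η := ramp_BL ld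
  have bχ : BL χ := ramp_BL ⟨_, lc⟩
  have hχ' : ∀ x, ‖fderiv ℝ χ x‖ ≤ 1 / R := by
    intro x
    have := norm_fderiv_le_of_lipschitz ℝ (ramp_lip.comp lc) (x₀ := x)
    rwa [one_mul, Real.coe_toNNReal _ (by positivity)] at this
  set T0 := {x | t ≤ infDist x Sᶜ} ∩ closedBall (0 : Euc n) (2 * R) with hT0
  set C := {x | t/2 ≤ infDist x Sᶜ} ∩ closedBall (0 : Euc n) (2 * R + t/2) with hC0
  have hC : IsCompact C := H.compact_K (half_pos ht) _
  have hCS : C ⊆ S := H.compact_sub (half_pos ht) _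
  have hT0c : IsCompact T0 := H.compact_K ht _
  have hTC : ∀ x ∈ T0, closedBall x (t/2) ⊆ C := by
    intro x hx y hy
    rw [mem_closedBall] at hy
    refine ⟨?_, ?_⟩
    · have := (d_lip (S := S)).dist_le_mul x y
      rw [dist_comm x y] at this
      simp only [NNReal.coe_one, one_mul, Real.dist_eq] at this
      have h3 := (le_abs_self _).trans this
      have h4 : t ≤ infDist x Sᶜ := hx.1
      show t/2 ≤ infDist y Sᶜ
      linarith
    · have h4 := hx.2
      rw [mem_closedBall] at h4 ⊢
      linarith [dist_triangle y x 0]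
  have hthick : cthickening (t/2) T0 ⊆ C := by
    rw [hT0c.cthickening_eq_biUnion_closedBall (by positivity)]
    exact iUnion₂_subset hTC
  obtain ⟨g, bg, hg⟩ := H.w_ext hC hCS
  have hgC : ∀ x ∈ T0, x ∈ C := fun x hx => hTC x hx (mem_closedBall_self (by positivity))
  have hsup : ∀ x, η x * χ x ≠ 0 → x ∈ T0 := by
    intro x hx
    refine ⟨?_, ?_⟩
    · by_contra h
      refine (left_ne_zero_of_mul hx) (ramp_zero ?_)
      have h5 : d x < t := not_le.1 h
      have : d x / t < 1 := by rwa [div_lt_one ht]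
      linarith
    · by_contra h
      refine (right_ne_zero_of_mul hx) (ramp_zero ?_)
      rw [mem_closedBall, dist_zero_right, not_le] at h
      have : 2 < ‖x‖ / R := by rwa [lt_div_iff₀ hR]
      linarith
  have bf : BL (fun x => η x * χ x * g x) := (bη.mul bχ).mul bg
  have bY : BL (fun x => (η x * χ x * g x) • X x) := bf.smul hX
  have hts : tsupport (fun x => (η x * χ x * g x) • X x) ⊆ T0 :=
    closure_minimal (fun x hx => hsup x (left_ne_zero_of_mul (left_ne_zero_of_smul hx))) hT0c.isClosed
  have main := di0 hE hC (H.mu_fin hC hCS hb) (half_pos ht) bY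
    ((cthickening_subset_of_subset _ hts).trans hthick)
  have up : ∫ x in frontier E ∩ C, ‖(η x * χ x * g x) • X x‖ ∂μHE[n - 1] ≤ ∫ x, ‖X x‖ ∂(mb S w E) := by
    rw [H.int_mb]
    have hi := (H.intble_mb E (fun x => ‖X x‖)).1 (norm_intble_mb hb hX.norm)
    refine le_trans (b := ∫ x in frontier E ∩ C, wS S w x * ‖X x‖ ∂μHE[n - 1]) ?_ ?_
    · refine setIntegral_mono_on (intg_bdd (H.mu_fin hC hCS hb) bY.norm) (hi.mono_set inter_subset_left)
        (isClosed_frontier.measurableSet.inter hC.measurableSet) fun x hx => ?_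
      have hw0 := H.w_nonneg (subset_closure (hCS hx.2))
      rw [norm_smul, wS_eq (hCS hx.2), ← hg hx.2, norm_mul, norm_mul, Real.norm_of_nonneg (ramp_nonneg _),
        Real.norm_of_nonneg (ramp_nonneg _), Real.norm_of_nonneg hw0]
      gcongr
      have := mul_le_one₀ (ramp_le (d x / t - 1)) (ramp_nonneg _) (ramp_le (2 - ‖x‖ / R))
      exact mul_le_of_le_one_left hw0 this
    · exact setIntegral_mono_set hi (ae_of_all _ fun x => mul_nonneg (H.wS_nonneg x) (norm_nonneg _))
        (ae_of_all _ inter_subset_left)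
  refine le_trans ?_ (main.trans up)
  rw [H.int_mw E hE.measurableSet]
  have hmeasF : Measurable (fun x => η x * χ x * F x - (if infDist x Sᶜ < 2 * t then 2 * c else 0) - M / R) := by
    refine Measurable.sub_const (((bη.cont.measurable.mul bχ.cont.measurable).mul hF).sub ?_) _
    exact Measurable.ite (measurableSet_lt (continuous_infDist_pt _).measurable measurable_const)
      measurable_const measurable_const
  have hi : IntegrableOn (fun x => η x * χ x * F x - (if infDist x Sᶜ < 2 * t then 2 * c else 0) - M / R)
      E (mw S w) := by
    refine Measure.integrableOn_of_bounded (M := MF + 2 * c + M / R) hv.ne hmeasF.aestronglyMeasurable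
      (ae_of_all _ fun x => ?_)
    have h3 : ‖η x * χ x * F x‖ ≤ MF := by
      rw [norm_mul, norm_mul, Real.norm_of_nonneg (ramp_nonneg _),
        Real.norm_of_nonneg (ramp_nonneg _)]
      exact (mul_le_of_le_one_left (norm_nonneg _) (mul_le_one₀ (ramp_le (d x / t - 1)) (ramp_nonneg _) (ramp_le (2 - ‖x‖ / R)))).trans (hFb x)
    have h4 : ‖(if infDist x Sᶜ < 2 * t then 2 * c else 0)‖ ≤ 2 * c := by
      split_ifs
      · rw [Real.norm_of_nonneg (by positivity)]
      · simpa using hc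
    have h5 : ‖M / R‖ = M / R := Real.norm_of_nonneg (by positivity)
    calc _ ≤ ‖η x * χ x * F x - (if infDist x Sᶜ < 2 * t then 2 * c else 0)‖ + ‖M / R‖ := norm_sub_le _ _
      _ ≤ ‖η x * χ x * F x‖ + ‖(if infDist x Sᶜ < 2 * t then 2 * c else 0)‖ + ‖M / R‖ := by
        gcongr; exact norm_sub_le _ _
      _ ≤ _ := by linarith
  refine setIntegral_mono_ae_restrict ((H.intble_mw E hE.measurableSet _).1 hi)
    (int_dv hT0c bY hts).integrableOn ?_
  rw [Filter.EventuallyLE, ae_restrict_iff' hE.measurableSet]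
  filter_upwards [h1, h2, bη.ae_diff, bχ.ae_diff, hX.ae_diff, H.w_diff, d_diff (S := S), bg.ae_diff]
    with x q1 q2 q3 q4 q5 q6 q7 q8 hxE
  have hxS := hES hxE
  have hw0 := H.w_nonneg (subset_closure hxS)
  rw [wS_eq hxS]
  have hite : 0 ≤ (if infDist x Sᶜ < 2 * t then 2 * c else 0) := by split_ifs <;> positivity
  have hMR : 0 ≤ M / R := by positivity
  by_cases hxT : x ∈ T0
  · have hgw : g =ᶠ[𝓝 x] w := by
      filter_upwards [closedBall_mem_nhds x (half_pos ht)] with y hy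
      exact (hg (hTC x hxT hy)).symm
    have hgx : g x = w x := hgw.eq_of_nhds
    obtain ⟨a, a0, a1, a2, a3⟩ := ramp_fderiv (f := fun x => d x / t - 1) (x := x)
      (by simpa only [div_eq_mul_inv] using (q7.mul_const t⁻¹).sub_const 1)
    have e1 : fderiv ℝ (fun x => d x / t - 1) x = (1/t) • fderiv ℝ d x := by
      rw [fderiv_sub_const]
      have : (fun x => d x / t) = fun x => (1/t) * d x := by ext1 y; ring
      rw [this, fderiv_const_mul q7]
    have e2 : fderiv ℝ η x (X x) = a * (1/t * fderiv ℝ d x (X x)) := by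
      show fderiv ℝ (fun x => ramp (d x / t - 1)) x (X x) = _
      rw [a3, e1]; simp
    have e3 : -(if infDist x Sᶜ < 2 * t then 2 * c else 0) ≤ fderiv ℝ η x (X x) := by
      rw [e2]
      by_cases ha : a = 0
      · rw [ha, zero_mul]; linarith
      · have hlt : d x < 2 * t := by
          have := (a2 ha).2
          have : d x / t < 2 := by linarith
          rwa [div_lt_iff₀ ht] at this
        rw [if_pos hlt]
        have h3 := q1 hxE
        have hd0 : 0 ≤ d x := infDist_nonneg
        have h4 : -(2 * c) ≤ 1/t * fderiv ℝ d x (X x) := by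
          rw [one_div, ← div_eq_inv_mul, le_div_iff₀ ht]
          have : c * d x ≤ c * (2 * t) := by gcongr
          have h3' : -c * d x ≤ fderiv ℝ d x (X x) := h3
          linarith
        have h5 : a * (1/t * fderiv ℝ d x (X x)) ≥ a * (-(2 * c)) := by gcongr
        nlinarith
    have e4 : -(M/R) ≤ fderiv ℝ χ x (X x) := by
      have h3 : ‖fderiv ℝ χ x (X x)‖ ≤ 1 / R * M :=
        ((fderiv ℝ χ x).le_opNorm _).trans (mul_le_mul (hχ' x) (hM x) (norm_nonneg _) (by positivity))
      rw [Real.norm_eq_abs] at h3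
      have := (abs_le.1 h3).1
      rw [show M / R = 1 / R * M by ring]; exact this
    have e5 : fderiv ℝ (fun x => η x * χ x * g x) x (X x) = η x * χ x * fderiv ℝ w x (X x)
        + g x * (η x * fderiv ℝ χ x (X x) + χ x * fderiv ℝ η x (X x)) := by
      rw [fderiv_fun_mul (q3.fun_mul q4) q8, fderiv_fun_mul q3 q4, hgw.fderiv_eq]
      simp
      ring
    rw [dv_smul ((q3.fun_mul q4).fun_mul q8) q5, e5, hgx]
    have hη0 : 0 ≤ η x := ramp_nonneg _
    have hη1 : η x ≤ 1 := ramp_le _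
    have hχ0 : 0 ≤ χ x := ramp_nonneg _
    have hχ1 : χ x ≤ 1 := ramp_le _
    have f1 : η x * χ x * (F x * w x) ≤ η x * χ x * (w x * dv X x + fderiv ℝ w x (X x)) :=
      mul_le_mul_of_nonneg_left (q2 hxE) (mul_nonneg hη0 hχ0)
    have f2 : -(M/R) ≤ η x * fderiv ℝ χ x (X x) := by nlinarith
    have f3 : -(if infDist x Sᶜ < 2 * t then 2 * c else 0) ≤ χ x * fderiv ℝ η x (X x) := by nlinarith
    have f4 := mul_le_mul_of_nonneg_left (add_le_add f2 f3) hw0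
    linarith
  · have z1 : η x * χ x = 0 := by by_contra h; exact hxT (hsup x h)
    have z2 : dv (fun x => (η x * χ x * g x) • X x) x = 0 := by
      rw [dv, fderiv_eq_zero_off (fun h => hxT (hts h))]; simp [tr]
    rw [z2, z1]
    nlinarith

/-- Weighted divergence inequality. -/
theorem wdi (H : CW n k α S w) {E : Set (Euc n)} (hE : IsOpen E) (hES : E ⊆ S)
    (hv : mw S w E < ⊤) (hb : mb S w E univ < ⊤) {X : Euc n → Euc n} (hX : BL X) {F : Euc n → ℝ}
    (hF : Measurable F) {MF : ℝ} (hFb : ∀ x, |F x| ≤ MF) {c : ℝ} (hc : 0 ≤ c)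
    (h1 : ∀ᵐ x, x ∈ E → - c * infDist x Sᶜ ≤ fderiv ℝ (fun x => infDist x Sᶜ) x (X x))
    (h2 : ∀ᵐ x, x ∈ E → F x * w x ≤ w x * dv X x + fderiv ℝ w x (X x)) :
    ∫ x in E, F x ∂(mw S w) ≤ ∫ x, ‖X x‖ ∂(mb S w E) := by
  obtain ⟨M, hM⟩ := hX.2
  have hM0 : 0 ≤ M := (norm_nonneg _).trans (hM 0)
  refine le_of_tendsto' (f := fun j : ℕ => ∫ x in E, (ramp (infDist x Sᶜ / (1/((j:ℝ)+1)) - 1) * ramp (2 - ‖x‖ / ((j:ℝ)+1)) * F x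
      - (if infDist x Sᶜ < 2 * (1/((j:ℝ)+1)) then 2 * c else 0) - M / ((j:ℝ)+1)) ∂(mw S w)) (x := Filter.atTop) ?_
    (fun j => H.wdi_cut hE hES hv hb hX hM hF hFb hc h1 h2 (by positivity) (by positivity))
  have hr := ramp_lip.continuous.measurable
  refine tendsto_integral_of_dominated_convergence (fun _ => MF + 2 * c + M) (fun j => ?_) ?_ (fun j => ?_) ?_
  · refine Measurable.aestronglyMeasurable (Measurable.sub_const (Measurable.sub (Measurable.mul (Measurable.mul ?_ ?_) hF) ?_) _)
    · exact hr.comp ((((continuous_infDist_pt _).measurable).div_const _).sub_const _)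
    · exact hr.comp ((measurable_norm.div_const _).const_sub _)
    · exact Measurable.ite (measurableSet_lt (continuous_infDist_pt _).measurable measurable_const)
        measurable_const measurable_const
  · haveI : IsFiniteMeasure ((mw S w).restrict E) := ⟨by simpa using hv⟩
    exact integrable_const _
  · refine ae_of_all _ fun x => ?_
    have h3 : ‖ramp (infDist x Sᶜ / (1/((j:ℝ)+1)) - 1) * ramp (2 - ‖x‖ / ((j:ℝ)+1)) * F x‖ ≤ MF := by
      rw [norm_mul, norm_mul, Real.norm_of_nonneg (ramp_nonneg _),
        Real.norm_of_nonneg (ramp_nonneg _)]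
      exact (mul_le_of_le_one_left (norm_nonneg _) (mul_le_one₀ (ramp_le _) (ramp_nonneg _) (ramp_le _))).trans (hFb x)
    have h4 : ‖(if infDist x Sᶜ < 2 * (1/((j:ℝ)+1)) then 2 * c else 0)‖ ≤ 2 * c := by
      split_ifs
      · rw [Real.norm_of_nonneg (by positivity)]
      · simpa using hc
    have h5 : ‖M / ((j:ℝ)+1)‖ ≤ M := by
      rw [Real.norm_of_nonneg (by positivity)]
      exact div_le_self hM0 (by linarith [(Nat.cast_nonneg j : (0:ℝ) ≤ j)])
    refine (norm_sub_le _ _).trans ?_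
    refine (add_le_add_left (norm_sub_le _ _) _).trans ?_
    linarith
  · rw [ae_restrict_iff' hE.measurableSet]
    refine ae_of_all _ fun x hx => ?_
    have hd : 0 < infDist x Sᶜ := H.d_pos.2 (hES hx)
    have l1 : Filter.Tendsto (fun j : ℕ => M / ((j:ℝ)+1)) Filter.atTop (𝓝 0) := by
      have := (tendsto_one_div_add_atTop_nhds_zero_nat (𝕜 := ℝ)).const_mul M
      simpa [div_eq_mul_inv] using this
    have l2 : Filter.Tendsto (fun j : ℕ => F x - M / ((j:ℝ)+1)) Filter.atTop (𝓝 (F x)) := by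
      simpa using l1.const_sub (F x)
    refine l2.congr' ?_
    obtain ⟨N, hN⟩ := exists_nat_gt (max (2 / infDist x Sᶜ) ‖x‖)
    filter_upwards [Filter.eventually_ge_atTop N] with j hj
    have hj' : (N:ℝ) ≤ j := by exact_mod_cast hj
    have g1 : 2 / infDist x Sᶜ < j + 1 := by linarith [le_max_left (2 / infDist x Sᶜ) ‖x‖]
    have g2 : ‖x‖ ≤ j + 1 := by linarith [le_max_right (2 / infDist x Sᶜ) ‖x‖]
    have hjp : (0:ℝ) < j + 1 := by positivity
    rw [div_lt_iff₀ hd] at g1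
    rw [ramp_one, ramp_one, if_neg]
    · ring
    · rw [not_lt, mul_one_div, div_le_iff₀ hjp]; linarith
    · have : ‖x‖ / (j+1) ≤ 1 := by rw [div_le_one hjp]; exact g2
      linarith
    · rw [div_div_eq_mul_div, div_one]; linarith

end CW
end PartF

section PartG
theorem normalize_lip {n : ℕ} {u v : Euc n} (hu : 1 ≤ ‖u‖) (hv : 1 ≤ ‖v‖) :
    ‖‖u‖⁻¹ • u - ‖v‖⁻¹ • v‖ ≤ ‖u - v‖ := by
  have hu0 : 0 < ‖u‖ := by linarith
  have hv0 : 0 < ‖v‖ := by linarith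
  refine le_of_sq_le_sq ?_ (norm_nonneg _)
  rw [norm_sub_sq_real, norm_sub_sq_real, norm_smul, norm_smul, norm_inv, norm_inv, norm_norm, norm_norm,
    inv_mul_cancel₀ hu0.ne', inv_mul_cancel₀ hv0.ne', inner_smul_left, inner_smul_right]
  simp only [conj_trivial]
  set a := ‖u‖
  set b := ‖v‖
  set t := a⁻¹ * (b⁻¹ * (inner ℝ (u) (v))) with ht
  have e : (inner ℝ (u) (v)) = a * b * t := by rw [ht]; field_simp
  have t1 : t ≤ 1 := by
    have := real_inner_le_norm u v
    rw [e] at this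
    by_contra h
    push Not at h
    have : a * b * 1 < a * b * t := by gcongr
    linarith
  rw [e]
  nlinarith [sq_nonneg (a - b), mul_nonneg (by nlinarith : 0 ≤ a * b - 1) (sub_nonneg.2 t1)]

open scoped Pointwise in
theorem sphere_local {n : ℕ} (hn : 0 < n) {A : Set (Euc n)} (hA : MeasurableSet A)
    (hAs : A ⊆ sphere 0 1) {p : Euc n} (hp : ‖p‖ = 1) {c : ℝ} (hc : 0 < c)
    (hAc : ∀ x ∈ A, c ≤ (inner ℝ (p) (x))) :
    ENNReal.ofReal (c ^ n) * μHE[n - 1] A ≤ n * volume (Ioo (0:ℝ) 1 • A) := by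
  set C' : Set (Euc n) := {y | (0 < (inner ℝ (p) (y)) ∧ (inner ℝ (p) (y)) < 1) ∧ ‖y‖⁻¹ • y ∈ A} with hC'
  have hfr : Module.finrank ℝ (Euc n) = n := by simp
  have hcont : Continuous fun y : Euc n => (inner ℝ (p) (y)) := by fun_prop
  have hm : MeasurableSet C' := by
    refine MeasurableSet.inter (MeasurableSet.inter ?_ ?_) ?_
    · exact measurableSet_lt measurable_const hcont.measurable
    · exact measurableSet_lt hcont.measurable measurable_const
    · exact (measurable_norm.inv.smul measurable_id) hA
  set B : Set (Euc n) := {y | (inner ℝ (p) (y)) = 1 ∧ ‖y‖⁻¹ • y ∈ A} with hB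
  have hAB : μHE[n - 1] A ≤ μHE[n - 1] B := by
    have hl : LipschitzOnWith 1 (fun y : Euc n => ‖y‖⁻¹ • y) B := by
      refine LipschitzOnWith.of_dist_le_mul fun u hu v hv => ?_
      have key : ∀ u ∈ B, 1 ≤ ‖u‖ := fun u hu => by
        have := real_inner_le_norm p u
        rw [hu.1, hp, one_mul] at this; exact this
      rw [NNReal.coe_one, one_mul, dist_eq_norm, dist_eq_norm]
      exact normalize_lip (key u hu) (key v hv)
    refine le_trans (measure_mono fun x hx => ?_) (muHE_lip (n-1) hl)
    have hx1 : ‖x‖ = 1 := by simpa using hAs hx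
    have hi : 0 < (inner ℝ (p) (x)) := hc.trans_le (hAc x hx)
    have hy : ‖(inner ℝ (p) (x))⁻¹ • x‖⁻¹ • (inner ℝ (p) (x))⁻¹ • x = x := by
      rw [norm_smul, hx1, mul_one, norm_inv, Real.norm_of_nonneg hi.le, inv_inv, smul_smul,
        mul_inv_cancel₀ hi.ne', one_smul]
    refine ⟨(inner ℝ (p) (x))⁻¹ • x, ⟨?_, ?_⟩, hy⟩
    · rw [inner_smul_right, inv_mul_cancel₀ hi.ne']
    · rw [hy]; exact hx
  have hp0 : p ≠ 0 := by rw [← norm_pos_iff, hp]; exact one_pos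
  have hvol : volume C' = ∫⁻ x : ℝ, μHE[n - 1] (C' ∩ AffineSubspace.mk' (x • p +ᵥ (0 : Euc n)) (ℝ ∙ p)ᗮ) := by
    have := EuclideanGeometry.euclideanHausdorffMeasure_eq_lintegral (0 : Euc n) hp0 hm
    rw [← vol_eq_muHE] at this
    rw [this, hfr, ← ofReal_norm, hp]; simp
  have hlow : ∀ r ∈ Ioo (0:ℝ) 1, ENNReal.ofReal (r ^ (n-1)) * μHE[n - 1] A ≤
      μHE[n - 1] (C' ∩ AffineSubspace.mk' (r • p +ᵥ (0 : Euc n)) (ℝ ∙ p)ᗮ) := by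
    intro r hr
    refine le_trans (b := μHE[n-1] (r • B)) ?_ (measure_mono ?_)
    · rw [Measure.euclideanHausdorffMeasure_smul₀ _ hr.1.ne']
      rw [ENNReal.smul_def, smul_eq_mul]
      have : ENNReal.ofReal (r ^ (n-1)) = ((‖r‖₊ ^ (n-1) : ℝ≥0) : ℝ≥0∞) := by
        rw [ENNReal.ofReal_pow hr.1.le, ENNReal.coe_pow, ← Real.enorm_of_nonneg hr.1.le]; rfl
      rw [this]; gcongr
    · rintro y ⟨b, hb, rfl⟩
      have h1 : (inner ℝ (p) (r • b)) = r := by rw [inner_smul_right, hb.1, mul_one]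
      refine ⟨⟨?_, ?_⟩, ?_⟩
      · simp only [h1]; exact hr
      · show ‖r • b‖⁻¹ • r • b ∈ A
        rw [norm_smul, Real.norm_of_nonneg hr.1.le, smul_smul, mul_inv, mul_comm r⁻¹, mul_assoc,
          inv_mul_cancel₀ hr.1.ne', mul_one]
        exact hb.2
      · show r • b ∈ AffineSubspace.mk' (r • p +ᵥ (0 : Euc n)) (ℝ ∙ p)ᗮ
        rw [AffineSubspace.mem_mk', Submodule.mem_orthogonal_singleton_iff_inner_right]
        simp only [vadd_eq_add, add_zero, vsub_eq_sub]
        rw [inner_sub_right, h1, inner_smul_right, real_inner_self_eq_norm_sq, hp]; simp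
  have hinteg : ∫⁻ r in Ioo (0:ℝ) 1, ENNReal.ofReal (r ^ (n-1)) = ENNReal.ofReal (1 / n) := by
    rw [← ofReal_integral_eq_lintegral_ofReal]
    · rw [← integral_Ioc_eq_integral_Ioo, ← intervalIntegral.integral_of_le zero_le_one, integral_pow]
      congr 1
      have : ((n - 1 : ℕ) : ℝ) + 1 = n := by rw [Nat.cast_sub hn]; simp
      rw [this, one_pow, zero_pow (by omega)]; simp
    · exact ((continuous_pow (n-1)).integrableOn_Icc (a := 0) (b := 1)).mono_set Ioo_subset_Icc_self
    · rw [Filter.EventuallyLE, ae_restrict_iff' measurableSet_Ioo]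
      exact ae_of_all _ fun r hr => pow_nonneg hr.1.le _
  have hlow2 : ENNReal.ofReal (1 / n) * μHE[n - 1] A ≤ volume C' := by
    rw [hvol, ← hinteg, ← lintegral_mul_const'' _ (by fun_prop)]
    exact (setLIntegral_mono' measurableSet_Ioo hlow).trans (setLIntegral_le_lintegral _ _)
  have hsub : c • C' ⊆ Ioo (0:ℝ) 1 • A := by
    rintro y ⟨z, ⟨⟨hz1, hz2⟩, hz3⟩, rfl⟩
    have hz0 : 0 < ‖z‖ := by
      rw [norm_pos_iff]; rintro rfl; simp at hz1
    refine ⟨c * ‖z‖, ⟨by positivity, ?_⟩, ‖z‖⁻¹ • z, hz3, ?_⟩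
    · have := hAc _ hz3
      rw [inner_smul_right, ← div_eq_inv_mul, le_div_iff₀ hz0] at this
      linarith
    · show (c * ‖z‖) • ‖z‖⁻¹ • z = c • z
      rw [smul_smul, mul_assoc, mul_inv_cancel₀ hz0.ne', mul_one]
  have h3 : ENNReal.ofReal (c ^ n) * volume C' ≤ volume (Ioo (0:ℝ) 1 • A) := by
    refine le_trans (le_of_eq ?_) (measure_mono hsub)
    rw [Measure.addHaar_smul, hfr, abs_of_pos (by positivity)]
  have hn' : (n : ℝ≥0∞) * ENNReal.ofReal (1 / n) = 1 := by
    rw [← ENNReal.ofReal_natCast, ← ENNReal.ofReal_mul (by positivity), mul_one_div_cancel (by positivity)]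
    simp
  calc ENNReal.ofReal (c ^ n) * μHE[n - 1] A
      = n * (ENNReal.ofReal (c ^ n) * (ENNReal.ofReal (1 / n) * μHE[n - 1] A)) := by
        rw [mul_left_comm, ← mul_assoc (n : ℝ≥0∞), hn', one_mul]
    _ ≤ n * (ENNReal.ofReal (c ^ n) * volume C') := by gcongr
    _ ≤ _ := by gcongr

theorem sphere_meas_le {n : ℕ} (hn : 0 < n) {s : Set (sphere (0 : Euc n) 1)} (hs : MeasurableSet s) :
    μHE[n - 1] ((↑) '' s : Set (Euc n)) ≤ (volume : Measure (Euc n)).toSphere s := by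
  have hfr : Module.finrank ℝ (Euc n) = n := by simp
  have key : ∀ ρ : ℝ, 0 < ρ → ρ < 1 → ENNReal.ofReal ((1 - ρ ^ 2 / 2) ^ n) * μHE[n - 1] ((↑) '' s : Set (Euc n)) ≤
      (volume : Measure (Euc n)).toSphere s := by
    intro ρ h0 h1
    obtain ⟨B, hB1, hB2, hB3, hB4⟩ := small_partition n h0
    have hsm : ∀ i, MeasurableSet (s ∩ (↑) ⁻¹' B i) := fun i => hs.inter (measurable_subtype_coe (hB1 i))
    have hs_eq : s = ⋃ i, s ∩ (↑) ⁻¹' B i := by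
      rw [← inter_iUnion, ← preimage_iUnion, hB3, preimage_univ, inter_univ]
    have hc : 0 < 1 - ρ ^ 2 / 2 := by nlinarith
    calc ENNReal.ofReal ((1 - ρ ^ 2 / 2) ^ n) * μHE[n - 1] ((↑) '' s : Set (Euc n))
        ≤ ENNReal.ofReal ((1 - ρ ^ 2 / 2) ^ n) * ∑' i, μHE[n - 1] ((↑) '' (s ∩ (↑) ⁻¹' B i) : Set (Euc n)) := by
          gcongr
          conv_lhs => rw [hs_eq, image_iUnion]
          exact measure_iUnion_le _
      _ = ∑' i, ENNReal.ofReal ((1 - ρ ^ 2 / 2) ^ n) * μHE[n - 1] ((↑) '' (s ∩ (↑) ⁻¹' B i) : Set (Euc n)) :=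
          ENNReal.tsum_mul_left.symm
      _ ≤ ∑' i, (volume : Measure (Euc n)).toSphere (s ∩ (↑) ⁻¹' B i) := by
          refine ENNReal.tsum_le_tsum fun i => ?_
          rcases (s ∩ (↑) ⁻¹' B i).eq_empty_or_nonempty with he | ⟨p, hp⟩
          · rw [he]; simp
          rw [Measure.toSphere_apply' _ (hsm i), hfr]
          refine sphere_local hn ?_ ?_ (p := p) (by simp) hc ?_
          · exact (MeasurableEmbedding.subtype_coe isClosed_sphere.measurableSet).measurableSet_image.2 (hsm i)
          · rintro _ ⟨x, _, rfl⟩; exact x.2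
          · rintro _ ⟨x, hx, rfl⟩
            have hd := hB4 i _ hp.2 _ hx.2
            rw [dist_eq_norm] at hd
            have h5 := norm_sub_sq_real (p : Euc n) x
            have h6 : ‖(p:Euc n)‖ = 1 := by simp
            have h7 : ‖(x:Euc n)‖ = 1 := by simp
            rw [h6, h7] at h5
            have h8 : ‖(p:Euc n) - x‖ ^ 2 ≤ ρ ^ 2 := by gcongr
            linarith
      _ = _ := by
          rw [← measure_iUnion _ hsm, ← hs_eq]
          intro i j hij
          exact ((hB2 hij).preimage _).mono inter_subset_right inter_subset_right
  have hlim : Filter.Tendsto (fun ρ : ℝ => ENNReal.ofReal ((1 - ρ ^ 2 / 2) ^ n)) (𝓝[>] 0) (𝓝 1) := by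
    refine tendsto_nhdsWithin_of_tendsto_nhds ?_
    have : Filter.Tendsto (fun ρ : ℝ => (1 - ρ ^ 2 / 2) ^ n) (𝓝 0) (𝓝 1) :=
      Continuous.tendsto' (by fun_prop) _ _ (by simp)
    simpa using ENNReal.tendsto_ofReal this
  have hlim2 := ENNReal.Tendsto.mul_const (b := μHE[n - 1] ((↑) '' s : Set (Euc n))) hlim (Or.inl one_ne_zero)
  rw [one_mul] at hlim2
  refine le_of_tendsto hlim2 ?_
  filter_upwards [Ioo_mem_nhdsGT (zero_lt_one' ℝ)] with ρ hρ using key ρ hρ.1 hρ.2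

theorem sphere_lint_le {n : ℕ} (hn : 0 < n) (f : Euc n → ℝ≥0∞) :
    ∫⁻ x in sphere (0 : Euc n) 1, f x ∂μHE[n - 1] ≤
      ∫⁻ x, f x ∂((volume : Measure (Euc n)).toSphere) := by
  have hms : MeasurableSet (sphere (0 : Euc n) 1) := isClosed_sphere.measurableSet
  rw [← lintegral_subtype_comap hms]
  refine lintegral_mono' (Measure.le_iff.2 fun s hs => ?_) le_rfl
  rw [(MeasurableEmbedding.subtype_coe hms).comap_apply]
  exact sphere_meas_le hn hs

theorem polar {n : ℕ} (hn : 0 < n) (f : Euc n → ℝ≥0∞) (hf : Measurable f) :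
    ∫⁻ x, f x = ∫⁻ x : sphere (0 : Euc n) 1, ∫⁻ r : Ioi (0:ℝ), f ((r:ℝ) • (x : Euc n))
      ∂(Measure.volumeIoiPow (Module.finrank ℝ (Euc n) - 1)) ∂((volume : Measure (Euc n)).toSphere) := by
  haveI : Nontrivial (Euc n) := by
    haveI : Nonempty (Fin n) := ⟨⟨0, hn⟩⟩
    infer_instance
  have h1 : ∫⁻ x, f x = ∫⁻ x : ({(0)}ᶜ : Set (Euc n)), f (x : Euc n) ∂((volume : Measure (Euc n)).comap ((↑) : ({(0)}ᶜ : Set (Euc n)) → Euc n)) := by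
    rw [lintegral_subtype_comap (measurableSet_singleton _).compl, restrict_compl_singleton]
  rw [h1]
  have h2 := (volume : Measure (Euc n)).measurePreserving_homeomorphUnitSphereProd
  have hmeas : Measurable fun y : sphere (0 : Euc n) 1 × Ioi (0:ℝ) => f ((y.2:ℝ) • (y.1 : Euc n)) := by
    refine hf.comp ?_
    fun_prop
  have h3 := h2.lintegral_comp hmeas
  rw [lintegral_prod _ hmeas.aemeasurable] at h3
  rw [← h3]
  refine lintegral_congr fun x => ?_
  congr 1
  have := (homeomorphUnitSphereProd (Euc n)).symm_apply_apply x
  have h4 := congrArg Subtype.val this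
  rw [homeomorphUnitSphereProd_symm_apply_coe] at h4
  exact h4.symm
end PartG

section PartH
theorem radial_int {n : ℕ} (hn : 0 < n) {α : ℝ} (hα : 0 < α) :
    ∫⁻ r : Ioi (0:ℝ), (if (r:ℝ) < 1 then ENNReal.ofReal ((r:ℝ) ^ α) else 0)
      ∂(Measure.volumeIoiPow (n - 1)) = ENNReal.ofReal (1 / (n + α)) := by
  rw [Measure.volumeIoiPow, lintegral_withDensity_eq_lintegral_mul _
    (by fun_prop) (Measurable.ite (measurableSet_lt measurable_subtype_coe measurable_const)
      (by fun_prop) measurable_const)]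
  simp only [Pi.mul_apply]
  rw [lintegral_subtype_comap measurableSet_Ioi (fun r : ℝ => ENNReal.ofReal (r ^ (n-1)) *
    (if r < 1 then ENNReal.ofReal (r ^ α) else 0))]
  have e : ∫⁻ r in Ioi (0:ℝ), ENNReal.ofReal (r ^ (n-1)) * (if r < 1 then ENNReal.ofReal (r ^ α) else 0)
      = ∫⁻ r in Ioo (0:ℝ) 1, ENNReal.ofReal (r ^ ((n:ℝ) - 1 + α)) := by
    rw [← lintegral_indicator measurableSet_Ioi, ← lintegral_indicator measurableSet_Ioo]
    refine lintegral_congr fun r => ?_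
    by_cases h0 : 0 < r
    · by_cases h1 : r < 1
      · rw [indicator_of_mem (show r ∈ Ioi 0 from h0), indicator_of_mem (show r ∈ Ioo 0 1 from ⟨h0, h1⟩), if_pos h1, ← ENNReal.ofReal_mul (by positivity),
          Real.rpow_add h0]
        congr 2
        rw [← Real.rpow_natCast, Nat.cast_sub hn, Nat.cast_one]
      · rw [indicator_of_mem (show r ∈ Ioi 0 from h0), indicator_of_notMem (show r ∉ Ioo 0 1 from fun h => h1 h.2), if_neg h1, mul_zero]
    · rw [indicator_of_notMem (show r ∉ Ioi 0 from h0), indicator_of_notMem (show r ∉ Ioo 0 1 from fun h => h0 h.1)]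
  rw [e]
  have hn' : (1:ℝ) ≤ n := by exact_mod_cast hn
  have hexp : -1 < (n:ℝ) - 1 + α := by linarith
  rw [← ofReal_integral_eq_lintegral_ofReal]
  · rw [← integral_Ioc_eq_integral_Ioo, ← intervalIntegral.integral_of_le zero_le_one,
      integral_rpow (Or.inl hexp), show (n:ℝ) - 1 + α + 1 = n + α by ring, Real.one_rpow,
      Real.zero_rpow (by positivity), sub_zero]
  · have := (intervalIntegral.intervalIntegrable_rpow' (a := 0) (b := 1) hexp).1
    exact this.mono_set Ioo_subset_Ioc_self
  · rw [Filter.EventuallyLE, ae_restrict_iff' measurableSet_Ioo]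
    exact ae_of_all _ fun r hr => Real.rpow_nonneg hr.1.le _

namespace CW
variable {n k : ℕ} {α : ℝ} {S : Set (Euc n)} {w : Euc n → ℝ}

theorem npos (H : CW n k α S w) : 0 < n := (Nat.zero_le k).trans_lt H.hk

theorem smul_mem_iff (H : CW n k α S w) {x : Euc n} {t : ℝ} (ht : 0 < t) : t • x ∈ S ↔ x ∈ S := by
  refine ⟨fun h => ?_, fun h => H.smul_mem h ht⟩
  have := H.smul_mem h (inv_pos.2 ht)
  rwa [smul_smul, inv_mul_cancel₀ ht.ne', one_smul] at this

theorem wS_smul (H : CW n k α S w) (x : Euc n) {t : ℝ} (ht : 0 < t) :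
    wS S w (t • x) = t ^ α * wS S w x := by
  by_cases h : x ∈ S
  · rw [wS_eq h, wS_eq ((H.smul_mem_iff ht).2 h), H.w_smul (subset_closure h) ht]
  · rw [wS, indicator_of_notMem h, indicator_of_notMem (fun h' => h ((H.smul_mem_iff ht).1 h')), mul_zero]

theorem mw_apply {E : Set (Euc n)} (hE : MeasurableSet E) :
    mw S w E = ∫⁻ x in E, ENNReal.ofReal (wS S w x) := withDensity_apply _ hE

theorem mb_univ {E : Set (Euc n)} :
    mb S w E univ = ∫⁻ x in frontier E, ENNReal.ofReal (wS S w x) ∂μHE[n - 1] := by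
  rw [mb, withDensity_apply _ MeasurableSet.univ, Measure.restrict_univ]

theorem mw_ball_polar (H : CW n k α S w) : mw S w (ball 0 1) = ENNReal.ofReal (1 / (n + α)) *
    ∫⁻ x : sphere (0 : Euc n) 1, ENNReal.ofReal (wS S w x) ∂((volume : Measure (Euc n)).toSphere) := by
  have hfr : Module.finrank ℝ (Euc n) = n := by simp
  rw [mw_apply measurableSet_ball, ← lintegral_indicator measurableSet_ball, polar H.npos _
    (H.wS_meas.ennreal_ofReal.indicator measurableSet_ball), hfr, ← lintegral_const_mul' _ _ (by simp)]
  refine lintegral_congr fun x => ?_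
  rw [← radial_int H.npos H.hα, ← lintegral_mul_const' _ _ (by simp)]
  refine lintegral_congr fun r => ?_
  have hr : (0:ℝ) < r := r.2
  have hn : ‖(r:ℝ) • (x : Euc n)‖ = r := by
    rw [norm_smul, Real.norm_of_nonneg hr.le]; simp
  by_cases h1 : (r:ℝ) < 1
  · rw [indicator_of_mem (by simpa [hn] using h1), if_pos h1, H.wS_smul _ hr, ENNReal.ofReal_mul (by positivity)]
  · rw [indicator_of_notMem (by simpa [hn] using h1), if_neg h1, zero_mul]

theorem frontier_ball_sub (H : CW n k α S w) {x : Euc n} (hx : x ∈ frontier (ball 0 1 ∩ S)) (hS : x ∈ S) :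
    x ∈ sphere (0 : Euc n) 1 := by
  rw [(isOpen_ball.inter H.isOpen).frontier_eq] at hx
  have h1 : x ∈ closedBall (0 : Euc n) 1 :=
    closure_ball_subset_closedBall (closure_mono inter_subset_left hx.1)
  have h2 : x ∉ ball (0 : Euc n) 1 := fun h => hx.2 ⟨h, hS⟩
  rw [mem_sphere]
  rw [mem_closedBall] at h1
  rw [mem_ball, not_lt] at h2
  exact le_antisymm h1 h2

theorem per_ball_le (H : CW n k α S w) :
    mb S w (ball 0 1 ∩ S) univ ≤ ENNReal.ofReal (n + α) * mw S w (ball 0 1) := by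
  have hα := H.hα
  have hD : (0:ℝ) < n + α := by positivity
  rw [H.mw_ball_polar, ← mul_assoc, ← ENNReal.ofReal_mul hD.le, mul_one_div_cancel hD.ne', ENNReal.ofReal_one,
    one_mul, mb_univ]
  refine le_trans ?_ (sphere_lint_le H.npos (fun x => ENNReal.ofReal (wS S w x)))
  rw [← lintegral_indicator isClosed_frontier.measurableSet, ← lintegral_indicator isClosed_sphere.measurableSet]
  refine lintegral_mono fun x => ?_
  by_cases hS : x ∈ S
  · by_cases hx : x ∈ frontier (ball 0 1 ∩ S)
    · rw [indicator_of_mem hx, indicator_of_mem (H.frontier_ball_sub hx hS)]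
    · rw [indicator_of_notMem hx]; exact zero_le
  · have : ENNReal.ofReal (wS S w x) = 0 := by simp [wS, hS]
    simp only [indicator, this]; split_ifs <;> simp
end CW
end PartH

section PartI
open scoped BoundedContinuousFunction

/-- Legendre transform restricted to a compact set. -/
def lgt {n : ℕ} {K : Set (Euc n)} (ψ : K →ᵇ ℝ) (x : Euc n) : ℝ := ⨆ y : K, (inner ℝ x (y : Euc n) - ψ y)

section lgt
variable {n : ℕ} {K : Set (Euc n)} [CompactSpace K] [Nonempty K]

theorem lgt_cont (ψ : K →ᵇ ℝ) (x : Euc n) : Continuous (fun y : K => inner ℝ x (y : Euc n) - ψ y) :=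
  (continuous_const.inner continuous_subtype_val).sub ψ.continuous

theorem le_lgt (ψ : K →ᵇ ℝ) (x : Euc n) (y : K) : inner ℝ x (y : Euc n) - ψ y ≤ lgt ψ x :=
  le_ciSup (f := fun y : K => inner ℝ x (y : Euc n) - ψ y) (isCompact_range (lgt_cont ψ x)).bddAbove y

theorem lgt_max (ψ : K →ᵇ ℝ) (x : Euc n) : ∃ y : K, lgt ψ x = inner ℝ x (y : Euc n) - ψ y := by
  obtain ⟨y, -, hy⟩ := isCompact_univ.exists_isMaxOn univ_nonempty (lgt_cont ψ x).continuousOn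
  exact ⟨y, le_antisymm (ciSup_le fun z => hy (mem_univ z)) (le_lgt ψ x y)⟩

theorem lgt_le_add {ψ χ : K →ᵇ ℝ} {x : Euc n} {a : ℝ} (h : ∀ y, ψ y ≤ χ y + a) : lgt χ x ≤ lgt ψ x + a := by
  obtain ⟨y, hy⟩ := lgt_max χ x
  have := le_lgt ψ x y
  linarith [h y]

theorem lgt_lip (hK : K ⊆ closedBall 0 1) (ψ : K →ᵇ ℝ) : LipschitzWith 1 (lgt ψ) := by
  refine LipschitzWith.of_le_add_mul 1 fun x z => ?_
  obtain ⟨y, hy⟩ := lgt_max ψ x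
  have h1 := le_lgt ψ z y
  have h2 : inner ℝ (x - z) (y : Euc n) ≤ dist x z := by
    refine (real_inner_le_norm _ _).trans ?_
    rw [dist_eq_norm]
    exact mul_le_of_le_one_right (norm_nonneg _) (by simpa using hK y.2)
  rw [inner_sub_left] at h2
  simp only [NNReal.coe_one, one_mul]
  linarith

theorem lgt_intble (hK : K ⊆ closedBall 0 1) (ψ : K →ᵇ ℝ) {μ : Measure (Euc n)} [IsFiniteMeasure μ] {R : ℝ}
    (hμ : ∀ᵐ x ∂μ, x ∈ closedBall (0 : Euc n) R) : Integrable (lgt ψ) μ := by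
  refine Integrable.of_bound (C := ‖lgt ψ 0‖ + R) (lgt_lip hK ψ).continuous.aestronglyMeasurable ?_
  filter_upwards [hμ] with x hx
  have := (lgt_lip hK ψ).dist_le_mul x 0
  rw [Real.dist_eq] at this
  have h2 : dist x 0 ≤ R := hx
  simp only [NNReal.coe_one, one_mul] at this
  have h3 := abs_sub_abs_le_abs_sub (lgt ψ x) (lgt ψ 0)
  simp only [Real.norm_eq_abs]; linarith

/-- Kantorovich dual functional. -/
def JK (μ : Measure (Euc n)) (ν : Measure K) (ψ : K →ᵇ ℝ) : ℝ := ∫ x, lgt ψ x ∂μ + ∫ y, ψ y ∂ν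

theorem bcf_intble (ψ : K →ᵇ ℝ) (ν : Measure K) [IsFiniteMeasure ν] : Integrable (fun y => ψ y) ν :=
  ψ.integrable ν

theorem JK_cont (hK : K ⊆ closedBall 0 1) {μ : Measure (Euc n)} [IsFiniteMeasure μ] {R : ℝ}
    (hμ : ∀ᵐ x ∂μ, x ∈ closedBall (0 : Euc n) R) (ν : Measure K) [IsFiniteMeasure ν] : Continuous (JK μ ν) := by
  have : LipschitzWith (Real.toNNReal (μ.real univ + ν.real univ)) (JK μ ν) := by
    refine LipschitzWith.of_le_add_mul _ fun ψ χ => ?_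
    rw [Real.coe_toNNReal _ (by positivity)]
    have h1 : ∫ x, lgt ψ x ∂μ ≤ ∫ x, (lgt χ x + dist ψ χ) ∂μ := by
      refine integral_mono (lgt_intble hK ψ hμ) ((lgt_intble hK χ hμ).add (integrable_const _)) fun x => ?_
      refine lgt_le_add fun y => ?_
      have := BoundedContinuousFunction.dist_coe_le_dist (f := ψ) (g := χ) y
      rw [Real.dist_eq] at this
      linarith [(abs_le.1 this).1]
    have h2 : ∫ y, ψ y ∂ν ≤ ∫ y, (χ y + dist ψ χ) ∂ν := by
      refine integral_mono (bcf_intble _ _) ((bcf_intble _ _).add (integrable_const _)) fun y => ?_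
      have := BoundedContinuousFunction.dist_coe_le_dist (f := ψ) (g := χ) y
      rw [Real.dist_eq] at this
      linarith [(abs_le.1 this).2]
    rw [integral_add (lgt_intble hK χ hμ) (integrable_const _), integral_const] at h1
    rw [integral_add (bcf_intble χ ν) (integrable_const _), integral_const] at h2
    simp only [smul_eq_mul] at h1 h2
    unfold JK
    linarith
  exact this.continuous

theorem lgt_add_const (ψ : K →ᵇ ℝ) (c : ℝ) (x : Euc n) :
    lgt (ψ + BoundedContinuousFunction.const K c) x = lgt ψ x - c := by
  refine le_antisymm ?_ ?_
  · have := lgt_le_add (ψ := ψ) (χ := ψ + BoundedContinuousFunction.const K c) (x := x) (a := -c)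
      fun y => by simp
    linarith
  · have := lgt_le_add (χ := ψ) (ψ := ψ + BoundedContinuousFunction.const K c) (x := x) (a := c)
      fun y => by simp
    linarith

theorem JK_add_const (hK : K ⊆ closedBall 0 1) {μ : Measure (Euc n)} [IsFiniteMeasure μ] {R : ℝ}
    (hμ : ∀ᵐ x ∂μ, x ∈ closedBall (0 : Euc n) R) (ν : Measure K) [IsFiniteMeasure ν]
    (hm : μ.real univ = ν.real univ) (ψ : K →ᵇ ℝ) (c : ℝ) :
    JK μ ν (ψ + BoundedContinuousFunction.const K c) = JK μ ν ψ := by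
  unfold JK
  simp_rw [lgt_add_const]
  have h2 : ∫ y, (ψ + BoundedContinuousFunction.const K c) y ∂ν = ∫ y, ψ y ∂ν + ν.real univ * c := by
    simp only [BoundedContinuousFunction.coe_add, Pi.add_apply, BoundedContinuousFunction.const_apply]
    rw [integral_add (bcf_intble ψ ν) (integrable_const _), integral_const, smul_eq_mul]
  rw [h2, integral_sub (lgt_intble hK ψ hμ) (integrable_const _), integral_const, smul_eq_mul, hm]
  ring

/-- double transform -/
theorem lgt_double (hK : K ⊆ closedBall 0 1) {R : ℝ≥0} (ψ : K →ᵇ ℝ) : ∃ χ : K →ᵇ ℝ, LipschitzWith R χ ∧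
    (∀ y, χ y ≤ ψ y) ∧ ∀ x ∈ closedBall (0 : Euc n) R, lgt χ x ≤ lgt ψ x := by
  have hcpt : IsCompact (closedBall (0 : Euc n) R) := isCompact_closedBall _ _
  have hne : Nonempty (closedBall (0 : Euc n) R) := ⟨0, by simp⟩
  set f : K → ℝ := fun y => ⨆ x : closedBall (0 : Euc n) R, (inner ℝ (x : Euc n) (y : Euc n) - lgt ψ x) with hf
  have hc : ∀ y : K, Continuous (fun x : closedBall (0 : Euc n) R => inner ℝ (x : Euc n) (y : Euc n) - lgt ψ x) :=
    fun y => (continuous_subtype_val.inner continuous_const).sub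
      ((lgt_lip hK ψ).continuous.comp continuous_subtype_val)
  haveI : CompactSpace (closedBall (0 : Euc n) R) := isCompact_iff_compactSpace.1 hcpt
  have hle : ∀ (y : K) (x : closedBall (0 : Euc n) R), inner ℝ (x : Euc n) (y : Euc n) - lgt ψ x ≤ f y :=
    fun y x => le_ciSup (f := fun x : closedBall (0 : Euc n) R => inner ℝ (x : Euc n) (y : Euc n) - lgt ψ x)
      (isCompact_range (hc y)).bddAbove x
  have hl : LipschitzWith R f := by
    refine LipschitzWith.of_le_add_mul R fun y z => ?_
    refine ciSup_le fun x => ?_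
    have h1 := hle z x
    have h2 : inner ℝ (x : Euc n) ((y : Euc n) - z) ≤ R * dist y z := by
      refine (real_inner_le_norm _ _).trans ?_
      rw [Subtype.dist_eq, dist_eq_norm]
      exact mul_le_mul_of_nonneg_right (mem_closedBall_zero_iff.1 x.2) (norm_nonneg _)
    rw [inner_sub_right] at h2
    linarith
  refine ⟨BoundedContinuousFunction.mkOfCompact ⟨f, hl.continuous⟩, hl, fun y => ?_, fun x hx => ?_⟩
  · refine ciSup_le fun x => ?_
    linarith [le_lgt ψ x y]
  · refine ciSup_le fun y => ?_
    have := hle y ⟨x, hx⟩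
    simp only [BoundedContinuousFunction.mkOfCompact_apply, ContinuousMap.coe_mk]
    linarith

theorem JK_min (hK : K ⊆ closedBall 0 1) {μ : Measure (Euc n)} [IsFiniteMeasure μ] {R : ℝ≥0}
    (hμ : ∀ᵐ x ∂μ, x ∈ closedBall (0 : Euc n) R) (ν : Measure K) [IsFiniteMeasure ν]
    (hm : μ.real univ = ν.real univ) : ∃ ψ : K →ᵇ ℝ, ∀ χ, JK μ ν ψ ≤ JK μ ν χ := by
  obtain ⟨y0⟩ := (inferInstance : Nonempty K)
  set A : Set (K →ᵇ ℝ) := {ψ | LipschitzWith R ψ ∧ ψ y0 = 0} with hA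
  have hcl : IsClosed A := by
    have h2 : A = (⋂ x : K, ⋂ y : K, {ψ : K →ᵇ ℝ | dist (ψ x) (ψ y) ≤ R * dist x y}) ∩ {ψ | ψ y0 = 0} := by
      ext ψ
      simp only [hA, mem_setOf_eq, mem_inter_iff, mem_iInter, lipschitzWith_iff_dist_le_mul]
    rw [h2]
    refine IsClosed.inter (isClosed_iInter fun x => isClosed_iInter fun y => isClosed_le ?_ continuous_const) ?_
    · exact (continuous_eval_const _).dist (continuous_eval_const _)
    · exact isClosed_eq (continuous_eval_const _) continuous_const
  have hcomp : IsCompact A := by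
    refine BoundedContinuousFunction.arzela_ascoli₂ (Icc (-((R:ℝ) * 2)) (R * 2)) isCompact_Icc A hcl ?_ ?_
    · intro f x hf
      have h1 := hf.1.dist_le_mul x y0
      rw [hf.2, Real.dist_eq, sub_zero] at h1
      have h2 : dist x y0 ≤ 2 := by
        rw [Subtype.dist_eq]
        have a := hK x.2
        have b := hK y0.2
        rw [mem_closedBall] at a b
        have := dist_triangle_right (x : Euc n) y0 0
        linarith
      have h3 : |f x| ≤ R * 2 := h1.trans (mul_le_mul_of_nonneg_left h2 R.2)
      exact abs_le.1 h3
    · exact LipschitzWith.uniformEquicontinuous _ R (fun f => f.2.1) |>.equicontinuous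
  have hne : A.Nonempty := ⟨0, LipschitzWith.of_dist_le_mul fun x y => by simp; positivity, rfl⟩
  obtain ⟨ψ, hψA, hψ⟩ := hcomp.exists_isMinOn hne (JK_cont hK hμ ν).continuousOn
  refine ⟨ψ, fun χ => ?_⟩
  obtain ⟨χ', h1, h2, h3⟩ := lgt_double hK (R := R) χ
  have h4 : JK μ ν ψ ≤ JK μ ν (χ' + BoundedContinuousFunction.const K (-(χ' y0))) := by
    refine hψ ⟨?_, by simp⟩
    refine LipschitzWith.of_dist_le_mul fun x y => ?_
    simpa using h1.dist_le_mul x y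
  rw [JK_add_const hK hμ ν hm] at h4
  refine h4.trans ?_
  unfold JK
  refine add_le_add (integral_mono_ae (lgt_intble hK _ hμ) (lgt_intble hK _ hμ) ?_)
    (integral_mono (bcf_intble _ _) (bcf_intble _ _) h2)
  filter_upwards [hμ] with x hx using h3 x hx

end lgt
end PartI

section PartJ
open scoped BoundedContinuousFunction

section brenier
variable {n : ℕ} {K : Set (Euc n)} [CompactSpace K] [Nonempty K]

theorem lgt_fderiv {φ : Euc n → ℝ} {x y : Euc n} (hd : DifferentiableAt ℝ φ x)
    (h : ∀ z, φ x + inner ℝ (z - x) y ≤ φ z) : fderiv ℝ φ x = innerSL ℝ y := by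
  have hmin : IsLocalMin (fun z => φ z - innerSL ℝ y z) x := by
    refine Filter.Eventually.of_forall fun z => ?_
    have := h z
    rw [inner_sub_left, real_inner_comm, real_inner_comm y x] at this
    simp only [innerSL_apply_apply]; linarith
  have h0 := hmin.hasFDerivAt_eq_zero (hd.hasFDerivAt.sub (innerSL ℝ y).hasFDerivAt)
  exact sub_eq_zero.1 h0

theorem innerSL_inj0 {a b : Euc n} (h : innerSL ℝ a = innerSL ℝ b) : a = b := by
  refine ext_inner_right ℝ fun v => ?_
  simpa using congrArg (fun L => L v) h

theorem lgt_sub (ψ : K →ᵇ ℝ) {x : Euc n} {y : K} (h : lgt ψ x = inner ℝ x (y : Euc n) - ψ y) (z : Euc n) :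
    lgt ψ x + inner ℝ (z - x) (y : Euc n) ≤ lgt ψ z := by
  have := le_lgt ψ z y
  rw [inner_sub_left]; linarith

theorem lgt_unique (ψ : K →ᵇ ℝ) {x : Euc n} {y z : K} (hd : DifferentiableAt ℝ (lgt ψ) x)
    (h : lgt ψ x = inner ℝ x (y : Euc n) - ψ y) (h' : lgt ψ x = inner ℝ x (z : Euc n) - ψ z) : y = z := by
  refine Subtype.ext (innerSL_inj0 ?_)
  rw [← lgt_fderiv hd (lgt_sub ψ h), ← lgt_fderiv hd (lgt_sub ψ h')]

/-- Stability of maximizers. -/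
theorem lgt_stab {ι : Type*} {l : Filter ι} (hK : K ⊆ closedBall 0 1) (ψ : K →ᵇ ℝ) {x : Euc n} {y : K}
    (hd : DifferentiableAt ℝ (lgt ψ) x)
    (h : lgt ψ x = inner ℝ x (y : Euc n) - ψ y) (xs : ι → Euc n) (hxs : Filter.Tendsto xs l (𝓝 x))
    (ys : ι → K) (es : ι → ℝ) (hes : Filter.Tendsto es l (𝓝 0))
    (hy : ∀ i, lgt ψ (xs i) ≤ inner ℝ (xs i) (ys i : Euc n) - ψ (ys i) + es i) : Filter.Tendsto ys l (𝓝 y) := by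
  refine isCompact_univ.tendsto_nhds_of_unique_mapClusterPt (Filter.Eventually.of_forall fun i => mem_univ _) ?_
  intro z _ hz
  obtain ⟨U, hU, hUz⟩ := mapClusterPt_iff_ultrafilter.1 hz
  have t1 : Filter.Tendsto (fun i => lgt ψ (xs i)) U (𝓝 (lgt ψ x)) :=
    ((lgt_lip hK ψ).continuous.tendsto x).comp (hxs.mono_left hU)
  have t2 : Filter.Tendsto (fun i => inner ℝ (xs i) (ys i : Euc n) - ψ (ys i) + es i) U
      (𝓝 (inner ℝ x (z : Euc n) - ψ z + 0)) := by
    refine Filter.Tendsto.add (Filter.Tendsto.sub ?_ ?_) (hes.mono_left hU)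
    · exact (hxs.mono_left hU).inner ((continuous_subtype_val.tendsto z).comp hUz)
    · exact (ψ.continuous.tendsto z).comp hUz
  have h3 := le_of_tendsto_of_tendsto' t1 t2 hy
  rw [add_zero] at h3
  exact lgt_unique ψ hd (le_antisymm h3 (le_lgt ψ x z)) h

theorem first_var (hK : K ⊆ closedBall 0 1) {μ : Measure (Euc n)} [IsFiniteMeasure μ] {R : ℝ≥0}
    (hμ : ∀ᵐ x ∂μ, x ∈ closedBall (0 : Euc n) R) (hac : μ ≪ volume) (ν : Measure K) [IsFiniteMeasure ν]
    (ψ : K →ᵇ ℝ) (hψ : ∀ χ, JK μ ν ψ ≤ JK μ ν χ) (T : Euc n → K)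
    (hT : ∀ x, lgt ψ x = inner ℝ x (T x : Euc n) - ψ (T x)) (g : K →ᵇ ℝ) :
    ∫ x, g (T x) ∂μ ≤ ∫ y, g y ∂ν := by
  have hdiff : ∀ᵐ x ∂μ, DifferentiableAt ℝ (lgt ψ) x :=
    hac.ae_le (lgt_lip hK ψ).ae_differentiableAt
  set e : ℕ → ℝ := fun j => 1 / ((j:ℝ) + 1) with he
  have hepos : ∀ j, 0 < e j := fun j => by positivity
  have he0 : Filter.Tendsto e Filter.atTop (𝓝 0) := tendsto_one_div_add_atTop_nhds_zero_nat
  set q : ℕ → Euc n → ℝ := fun j x => (lgt (ψ + e j • g) x - lgt ψ x) / e j with hq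
  have hlow : ∀ j x, - g (T x) ≤ q j x := fun j x => by
    rw [hq, le_div_iff₀ (hepos j)]
    have := le_lgt (ψ + e j • g) x (T x)
    simp only [BoundedContinuousFunction.coe_add, Pi.add_apply, BoundedContinuousFunction.coe_smul, smul_eq_mul] at this
    linarith [hT x]
  choose Y hY using fun j x => lgt_max (ψ + e j • g) x
  have hup : ∀ j x, q j x ≤ - g (Y j x) := fun j x => by
    rw [hq, div_le_iff₀ (hepos j)]
    have h1 := hY j x
    have := le_lgt ψ x (Y j x)
    simp only [BoundedContinuousFunction.coe_add, Pi.add_apply, BoundedContinuousFunction.coe_smul, smul_eq_mul] at h1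
    linarith
  have hg : ∀ y, |g y| ≤ ‖g‖ := fun y => by simpa using g.norm_coe_le_norm y
  have hlim : ∀ᵐ x ∂μ, Filter.Tendsto (fun j => q j x) Filter.atTop (𝓝 (- g (T x))) := by
    filter_upwards [hdiff] with x hx
    have ht : Filter.Tendsto (fun j => Y j x) Filter.atTop (𝓝 (T x)) := by
      refine lgt_stab hK ψ hx (hT x) (fun _ => x) tendsto_const_nhds _ (fun j => e j * (2 * ‖g‖)) ?_ fun j => ?_
      · simpa using he0.mul_const (2 * ‖g‖)
      · have h1 := hY j x
        have h2 := hlow j x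
        rw [hq, le_div_iff₀ (hepos j)] at h2
        simp only [BoundedContinuousFunction.coe_add, Pi.add_apply, BoundedContinuousFunction.coe_smul, smul_eq_mul] at h1
        have h3 := (abs_le.1 (hg (T x))).2
        have h4 := (abs_le.1 (hg (Y j x))).1
        have := hepos j
        nlinarith
    exact tendsto_of_tendsto_of_tendsto_of_le_of_le tendsto_const_nhds
      (((g.continuous.tendsto _).comp ht).neg) (fun j => hlow j x) (fun j => hup j x)
  have hinteg : ∀ j, Integrable (q j) μ := fun j =>
    ((lgt_intble hK _ hμ).sub (lgt_intble hK _ hμ)).div_const _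
  have hDCT : Filter.Tendsto (fun j => ∫ x, q j x ∂μ) Filter.atTop (𝓝 (∫ x, - g (T x) ∂μ)) := by
    refine tendsto_integral_of_dominated_convergence (fun _ => ‖g‖) (fun j => (hinteg j).aestronglyMeasurable)
      (integrable_const _) (fun j => Filter.Eventually.of_forall fun x => ?_) hlim
    rw [Real.norm_eq_abs, abs_le]
    exact ⟨by linarith [hlow j x, (abs_le.1 (hg (T x))).2], by linarith [hup j x, (abs_le.1 (hg (Y j x))).1]⟩
  have hpos : ∀ j, - ∫ y, g y ∂ν ≤ ∫ x, q j x ∂μ := fun j => by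
    have h1 := hψ (ψ + e j • g)
    unfold JK at h1
    have h2 : ∫ y, (ψ + e j • g) y ∂ν = ∫ y, ψ y ∂ν + e j * ∫ y, g y ∂ν := by
      simp only [BoundedContinuousFunction.coe_add, Pi.add_apply, BoundedContinuousFunction.coe_smul, smul_eq_mul]
      rw [integral_add (bcf_intble ψ ν) ((bcf_intble g ν).const_mul _), integral_const_mul]
    have h3 : ∫ x, q j x ∂μ = (∫ x, lgt (ψ + e j • g) x ∂μ - ∫ x, lgt ψ x ∂μ) / e j := by
      rw [hq, integral_div, integral_sub (lgt_intble hK _ hμ) (lgt_intble hK _ hμ)]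
    rw [h3, le_div_iff₀ (hepos j)]
    rw [h2] at h1; linarith
  have := ge_of_tendsto' hDCT hpos
  rw [integral_neg] at this
  linarith

theorem brenier (hK : K ⊆ closedBall 0 1) {μ : Measure (Euc n)} [IsFiniteMeasure μ] {R : ℝ≥0}
    (hμ : ∀ᵐ x ∂μ, x ∈ closedBall (0 : Euc n) R) (hac : μ ≪ volume) (ν : Measure (Euc n)) [IsFiniteMeasure ν]
    (hν : ∀ᵐ x ∂ν, x ∈ K)
    (hm : μ univ = ν univ) : ∃ (T : Euc n → Euc n) (φ : Euc n → ℝ), (∀ x, T x ∈ K) ∧ LipschitzWith 1 φ ∧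
      (∀ x z, φ x + inner ℝ (z - x) (T x) ≤ φ z) ∧ (∀ᵐ x, HasFDerivAt φ (innerSL ℝ (T x)) x ∧ ContinuousAt T x) ∧
      AEMeasurable T volume ∧ Measure.map T μ = ν := by
  have hKm : MeasurableSet K := (isCompact_iff_compactSpace.2 inferInstance).measurableSet
  set ν' : Measure K := ν.comap (fun y : K => (y : Euc n)) with hν'
  have hmap : Measure.map (fun y : K => (y : Euc n)) ν' = ν := by
    rw [hν', (MeasurableEmbedding.subtype_coe hKm).map_comap, Subtype.range_coe, Measure.restrict_eq_self_of_ae_mem hν]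
  have hm' : μ univ = ν' univ := by
    rw [hm, ← hmap, Measure.map_apply measurable_subtype_coe MeasurableSet.univ, preimage_univ]
  haveI : IsFiniteMeasure ν' := ⟨by rw [← hm']; exact measure_lt_top _ _⟩
  obtain ⟨ψ, hψ⟩ := JK_min hK hμ ν' (by simp [Measure.real, hm'])
  choose T hT using lgt_max ψ
  have hdiff := (lgt_lip hK ψ).ae_differentiableAt (μ := (volume : Measure (Euc n)))
  have hmeas : AEMeasurable (fun x => (T x : Euc n)) volume := by
    refine ⟨fun x => (InnerProductSpace.toDual ℝ (Euc n)).symm (fderiv ℝ (lgt ψ) x),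
      (InnerProductSpace.toDual ℝ (Euc n)).symm.continuous.measurable.comp (measurable_fderiv ℝ _), ?_⟩
    filter_upwards [hdiff] with x hx
    rw [lgt_fderiv hx (lgt_sub ψ (hT x))]
    symm
    rw [LinearIsometryEquiv.symm_apply_eq]
    rfl
  refine ⟨fun x => T x, lgt ψ, fun x => (T x).2, lgt_lip hK ψ, fun x z => lgt_sub ψ (hT x) z, ?_, hmeas, ?_⟩
  · filter_upwards [hdiff] with x hx
    refine ⟨?_, ?_⟩
    · have := hx.hasFDerivAt
      rwa [lgt_fderiv hx (lgt_sub ψ (hT x))] at this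
    · refine (continuous_subtype_val.tendsto (T x)).comp ?_
      exact lgt_stab hK ψ hx (hT x) (fun z => z) Filter.tendsto_id T (fun _ => 0) tendsto_const_nhds
        fun z => by rw [← hT z, add_zero]
  · have hmμ : AEMeasurable (fun x => (T x : Euc n)) μ := hmeas.mono_ac hac
    haveI : IsFiniteMeasure (Measure.map (fun x => (T x : Euc n)) μ) := Measure.isFiniteMeasure_map _ _
    refine ext_of_forall_integral_eq_of_IsFiniteMeasure fun f => ?_
    rw [integral_map hmμ f.continuous.aestronglyMeasurable, ← hmap,
      integral_map measurable_subtype_coe.aemeasurable f.continuous.aestronglyMeasurable]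
    set g : K →ᵇ ℝ := f.compContinuous ⟨fun y : K => (y : Euc n), continuous_subtype_val⟩ with hg
    refine le_antisymm (first_var hK hμ hac ν' ψ hψ T hT g) ?_
    have := first_var hK hμ hac ν' ψ hψ T hT (-g)
    simp only [BoundedContinuousFunction.coe_neg, Pi.neg_apply, integral_neg, neg_le_neg_iff] at this
    exact this

end brenier
end PartJ

section PartK
section mono
variable {n : ℕ}

theorem mono_ae_diff {T : Euc n → Euc n} (hT : ∀ x y, 0 ≤ inner ℝ (T x - T y) (x - y))
    (hc : ∀ᵐ x, ContinuousAt T x) : ∀ᵐ x, DifferentiableAt ℝ T x := by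
  set F : Euc n → Euc n := fun x => x + T x with hF
  have hexp : ∀ x y, ‖x - y‖ ≤ ‖F x - F y‖ := by
    intro x y
    have h1 : inner ℝ (F x - F y) (x - y) = ‖x - y‖ ^ 2 + inner ℝ (T x - T y) (x - y) := by
      rw [← real_inner_self_eq_norm_sq, ← inner_add_left]
      congr 1; simp only [hF]; abel
    have h2 := real_inner_le_norm (F x - F y) (x - y)
    have h3 := hT x y
    rcases (norm_nonneg (x - y)).eq_or_lt with h0 | h0
    · rw [← h0]; positivity
    · nlinarith
  have hinj : Function.Injective F := fun x y h => by
    have := hexp x y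
    rw [h, sub_self, norm_zero] at this
    exact sub_eq_zero.1 (norm_le_zero_iff.1 this)
  set g0 : Euc n → Euc n := Function.invFun F with hg0
  have hg0F : ∀ x, g0 (F x) = x := Function.leftInverse_invFun hinj
  have hlip : LipschitzOnWith 1 g0 (range F) := by
    refine LipschitzOnWith.of_dist_le_mul ?_
    rintro _ ⟨x, rfl⟩ _ ⟨y, rfl⟩
    rw [hg0F, hg0F, dist_eq_norm, dist_eq_norm, NNReal.coe_one, one_mul]
    exact hexp x y
  obtain ⟨g, hgl, hgeq⟩ := hlip.extend_finite_dimension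
  have hgF : ∀ x, g (F x) = x := fun x => by rw [← hgeq ⟨x, rfl⟩, hg0F]
  set N1 : Set (Euc n) := {y | ¬ DifferentiableAt ℝ g y} with hN1
  have hN1z : volume N1 = 0 := hgl.ae_differentiableAt
  set N2 : Set (Euc n) := {y | DifferentiableAt ℝ g y ∧ (fderiv ℝ g y).det = 0} with hN2
  have hN2z : volume (g '' N2) = 0 :=
    MeasureTheory.addHaar_image_eq_zero_of_det_fderivWithin_eq_zero volume (f' := fun y => fderiv ℝ g y)
      (fun y hy => hy.1.hasFDerivAt.hasFDerivWithinAt) (fun y hy => hy.2)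
  have hN1g : volume (g '' N1) = 0 := by
    have hC := hgl
    have hfr : Module.finrank ℝ (Euc n) = n := by simp
    have hv : (volume : Measure (Euc n)) = μHE[n] := by have := vol_eq_muHE n; rwa [hfr] at this
    have hle := hgl.hausdorffMeasure_image_le (s := N1) (d := n) (by positivity)
    rw [hv] at hN1z ⊢
    rw [Measure.euclideanHausdorffMeasure_def, Measure.smul_apply] at hN1z ⊢
    have hne := Measure.addHaarScalarFactor_volume_hausdorffMeasure_ne_zero (d := n)
    rw [smul_eq_zero] at hN1z ⊢
    rcases hN1z with h | h
    · exact Or.inl h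
    · rw [h, mul_zero] at hle; exact Or.inr (le_antisymm hle zero_le)
  have a1 : ∀ᵐ x, x ∉ g '' N1 := measure_eq_zero_iff_ae_notMem.1 hN1g
  have a2 : ∀ᵐ x, x ∉ g '' N2 := measure_eq_zero_iff_ae_notMem.1 hN2z
  filter_upwards [a1, a2, hc] with x h1 h2 hcx
  have hd : DifferentiableAt ℝ g (F x) := by
    by_contra h; exact h1 ⟨F x, h, hgF x⟩
  have hdet : (fderiv ℝ g (F x)).det ≠ 0 := fun h => h2 ⟨F x, ⟨hd, h⟩, hgF x⟩
  set e := (fderiv ℝ g (F x)).toContinuousLinearEquivOfDetNeZero hdet with he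
  have hFc : ContinuousAt F x := continuousAt_id.add hcx
  have hFd : HasFDerivAt F (e.symm : Euc n →L[ℝ] Euc n) x := by
    refine HasFDerivAt.of_local_left_inverse (f := g) (f' := e) hFc ?_ (Filter.Eventually.of_forall hgF) 
    rw [he, ContinuousLinearMap.coe_toContinuousLinearEquivOfDetNeZero]
    exact hd.hasFDerivAt
  have : T = fun z => F z - z := by funext z; simp [hF]
  rw [this]
  exact hFd.differentiableAt.sub differentiableAt_id

theorem MA {T : Euc n → Euc n} (hTm : AEMeasurable T volume) (hd : ∀ᵐ x, DifferentiableAt ℝ T x)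
    {f g : Euc n → ℝ≥0∞} (hf : Measurable f) (hg : Measurable g) (hgt : ∀ x, g x ≠ ⊤)
    (hmap : Measure.map T (volume.withDensity f) = volume.withDensity g) :
    ∀ᵐ x, f x ≤ ENNReal.ofReal |(fderiv ℝ T x).det| * g (T x) := by
  obtain ⟨T', hT'm, hTT'⟩ := hTm
  have hgood : ∀ᵐ x, DifferentiableAt ℝ T x ∧ T x = T' x := hd.and hTT'
  obtain ⟨N, hNsub, hNm, hN0⟩ := exists_measurable_superset_of_null (ae_iff.1 hgood)
  have hG : ∀ x ∈ Nᶜ, DifferentiableAt ℝ T x ∧ T x = T' x := fun x hx => by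
    by_contra h; exact hx (hNsub h)
  have hTae : AEMeasurable T (volume.withDensity f) :=
    ⟨T', hT'm, (withDensity_absolutelyContinuous _ _).ae_le hTT'⟩
  have hJm : Measurable (fun x => ENNReal.ofReal |(fderiv ℝ T x).det|) := by
    refine ENNReal.measurable_ofReal.comp (Measurable.abs ?_)
    exact ContinuousLinearMap.continuous_det.measurable.comp (measurable_fderiv ℝ T)
  have key : ∀ q : ℝ≥0, ∀ᵐ x, g (T x) < q → f x ≤ ENNReal.ofReal |(fderiv ℝ T x).det| * q := by
    intro q
    set P : Set (Euc n) := Nᶜ ∩ {x | g (T' x) < q} with hP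
    have hPm : MeasurableSet P := hNm.compl.inter (measurableSet_lt (hg.comp hT'm) measurable_const)
    have hle : ∀ᵐ x, P.indicator f x ≤ P.indicator (fun x => ENNReal.ofReal |(fderiv ℝ T x).det| * q) x := by
      refine ae_le_of_forall_setLIntegral_le_of_sigmaFinite₀ (hf.indicator hPm).aemeasurable fun s hs _ => ?_
      rw [setLIntegral_indicator hPm, setLIntegral_indicator hPm]
      set B := P ∩ s with hB
      have hBm : MeasurableSet B := hPm.inter hs
      have h1 : ∫⁻ x in B, f x = volume.withDensity f B := (withDensity_apply _ hBm).symm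
      have h2 : volume.withDensity f B ≤ volume.withDensity g (T '' B) := by
        have hb : volume.withDensity f B ≤ volume.withDensity f (T ⁻¹' (toMeasurable (volume.withDensity g) (T '' B))) :=
          measure_mono fun x hx => subset_toMeasurable _ _ ⟨x, hx, rfl⟩
        refine hb.trans ?_
        rw [← Measure.map_apply_of_aemeasurable hTae (measurableSet_toMeasurable _ _), hmap, measure_toMeasurable]
      have h3 : volume.withDensity g (T '' B) ≤ q * volume (T '' B) := by
        set Z : Set (Euc n) := {y | g y < q} with hZ
        have hZm : MeasurableSet Z := measurableSet_lt hg measurable_const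
        have hsub : T '' B ⊆ Z := by
          rintro _ ⟨x, hx, rfl⟩
          have := hx.1.2
          rw [mem_setOf_eq, ← (hG x hx.1.1).2] at this
          exact this
        set V := toMeasurable volume (T '' B) ∩ Z with hV
        have hVm : MeasurableSet V := (measurableSet_toMeasurable _ _).inter hZm
        calc volume.withDensity g (T '' B) ≤ volume.withDensity g V :=
              measure_mono (subset_inter (subset_toMeasurable _ _) hsub)
          _ = ∫⁻ x in V, g x := withDensity_apply _ hVm
          _ ≤ ∫⁻ x in V, q := setLIntegral_mono measurable_const fun x hx => le_of_lt hx.2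
          _ = q * volume V := setLIntegral_const _ _
          _ ≤ q * volume (toMeasurable volume (T '' B)) := by gcongr; exact inter_subset_left
          _ = q * volume (T '' B) := by rw [measure_toMeasurable]
      have h4 : volume (T '' B) ≤ ∫⁻ x in B, ENNReal.ofReal |(fderiv ℝ T x).det| :=
        addHaar_image_le_lintegral_abs_det_fderiv volume hBm
          fun x hx => (hG x hx.1.1).1.hasFDerivAt.hasFDerivWithinAt
      rw [lintegral_mul_const _ hJm, h1]
      refine (h2.trans h3).trans ?_
      rw [mul_comm]; gcongr
    have hNc : ∀ᵐ x, x ∈ Nᶜ := measure_eq_zero_iff_ae_notMem.1 hN0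
    filter_upwards [hle, hNc] with x hx hxN hq
    have hxP : x ∈ P := ⟨hxN, by rw [mem_setOf_eq, ← (hG x hxN).2]; exact hq⟩
    rwa [indicator_of_mem hxP, indicator_of_mem hxP] at hx
  have key2 := ae_all_iff.2 fun q : ℚ => key (Real.toNNReal q)
  filter_upwards [key2] with x hx
  set c := ENNReal.ofReal |(fderiv ℝ T x).det| with hc
  have hct : c ≠ ⊤ := ENNReal.ofReal_ne_top
  by_contra hlt
  push Not at hlt
  by_cases hc0 : c = 0
  · obtain ⟨q, -, h1, h2⟩ := ENNReal.lt_iff_exists_rat_btwn.1 (lt_top_iff_ne_top.2 (hgt (T x)))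
    have := hx q h1
    rw [hc0, zero_mul] at this hlt
    exact absurd this (not_le.2 hlt)
  · have h1 : g (T x) < f x / c := by
      rw [ENNReal.lt_div_iff_mul_lt (Or.inl hc0) (Or.inl hct), mul_comm]; exact hlt
    obtain ⟨q, -, h2, h3⟩ := ENNReal.lt_iff_exists_rat_btwn.1 h1
    have := hx q h2
    rw [ENNReal.lt_div_iff_mul_lt (Or.inl hc0) (Or.inl hct), mul_comm] at h3
    exact absurd this (not_le.2 h3)

end mono
end PartK

section PartL
section moll
variable {n : ℕ}

theorem ae_affine {p : Euc n → Prop} (h : ∀ᵐ y, p y) (x : Euc n) {e : ℝ} (he : e ≠ 0) : ∀ᵐ z, p (x - e • z) := by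
  have h1 : ∀ᵐ y : Euc n, p (x - y) :=
    (Measure.measurePreserving_sub_left (volume : Measure (Euc n)) x).quasiMeasurePreserving.ae h
  rw [ae_iff] at h1 ⊢
  have := Measure.addHaar_preimage_smul (volume : Measure (Euc n)) he {y : Euc n | ¬ p (x - y)}
  rw [h1, mul_zero] at this
  exact this

theorem aem_affine {T : Euc n → Euc n} (hT : AEMeasurable T volume) (x : Euc n) {e : ℝ} (he : e ≠ 0) :
    AEStronglyMeasurable (fun z => T (x - e • z)) volume := by
  obtain ⟨T', hm, hae⟩ := hT
  refine AEMeasurable.aestronglyMeasurable ⟨fun z => T' (x - e • z), hm.comp (by fun_prop), ae_affine hae x he⟩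

theorem moll_deriv {f : Euc n → ℝ} (hf : ContDiff ℝ 1 f) (hc : HasCompactSupport f) {g : Euc n → Euc n}
    (hg : LocallyIntegrable g volume) (x : Euc n) :
    HasFDerivAt (fun x => ∫ t, f t • g (x - t)) (∫ t, (fderiv ℝ f t).smulRight (g (x - t))) x := by
  have := hc.hasFDerivAt_convolution_left (ContinuousLinearMap.lsmul ℝ ℝ) hf hg x
  have e1 : (∫ t, (fderiv ℝ f t).smulRight (g (x - t))) =
      (convolution (fderiv ℝ f) g ((ContinuousLinearMap.lsmul ℝ ℝ).precompL (Euc n)) volume) x := by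
    rw [convolution]
    refine integral_congr_ae (Filter.Eventually.of_forall fun t => ?_)
    ext v i
    simp
  rw [e1]
  exact this

/-- fixed mollifier -/
theorem exists_rho (n : ℕ) : ∃ ρ : Euc n → ℝ, ContDiff ℝ 1 ρ ∧ HasCompactSupport ρ ∧ (∀ x, 0 ≤ ρ x) ∧
    ∫ x, ρ x = 1 := by
  let f : ContDiffBump (0 : Euc n) := ⟨1, 2, one_pos, one_lt_two⟩
  exact ⟨f.normed volume, f.contDiff_normed (n := 1), f.hasCompactSupport_normed, fun x => f.nonneg_normed x, f.integral_normed⟩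

variable {ρ : Euc n → ℝ}

theorem rho_fderiv_int (hρ : ContDiff ℝ 1 ρ) (hc : HasCompactSupport ρ) : Integrable (fderiv ℝ ρ) volume :=
  (hρ.continuous_fderiv one_ne_zero).integrable_of_hasCompactSupport (hc.fderiv ℝ)

theorem rho_int (hρ : ContDiff ℝ 1 ρ) (hc : HasCompactSupport ρ) : Integrable ρ volume :=
  hρ.continuous.integrable_of_hasCompactSupport hc

theorem smulR_cont (n : ℕ) : Continuous (fun p : (Euc n →L[ℝ] ℝ) × Euc n => p.1.smulRight p.2) := by
  have := isBoundedBilinearMap_smulRight (𝕜 := ℝ) (E := Euc n) (F := Euc n)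
  exact this.continuous

theorem smulR_meas {a : Euc n → (Euc n →L[ℝ] ℝ)} {b : Euc n → Euc n} (ha : AEStronglyMeasurable a volume)
    (hb : AEStronglyMeasurable b volume) : AEStronglyMeasurable (fun z => (a z).smulRight (b z)) volume :=
  (smulR_cont n).comp_aestronglyMeasurable (f := fun z => (a z, b z)) (ha.prodMk hb)

theorem locInt_of_bdd {T : Euc n → Euc n} (hT : AEStronglyMeasurable T volume) {M : ℝ} (hb : ∀ x, ‖T x‖ ≤ M) :
    LocallyIntegrable T volume :=
  (memLp_top_of_bound hT M (Filter.Eventually.of_forall hb)).locallyIntegrable le_top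

theorem rho_fderiv_zero (hρ : ContDiff ℝ 1 ρ) (hc : HasCompactSupport ρ) (c : Euc n) :
    ∫ t, (fderiv ℝ ρ t).smulRight c = 0 := by
  have h := moll_deriv hρ hc (g := fun _ => c) (locInt_of_bdd aestronglyMeasurable_const (M := ‖c‖) (fun _ => le_rfl)) 0
  exact h.unique (hasFDerivAt_const _ _)

theorem rho_fderiv_id (hρ : ContDiff ℝ 1 ρ) (hc : HasCompactSupport ρ) (h1 : ∫ x, ρ x = 1) :
    ∫ t, (fderiv ℝ ρ t).smulRight (-t) = ContinuousLinearMap.id ℝ (Euc n) := by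
  have h := moll_deriv hρ hc (g := fun x => x) continuous_id.locallyIntegrable 0
  have h2 : (fun x : Euc n => ∫ t, ρ t • (x - t)) = fun x => x - ∫ t, ρ t • t := by
    funext x
    simp_rw [smul_sub]
    rw [integral_sub, integral_smul_const, h1, one_smul]
    · exact (rho_int hρ hc).smul_const x
    · exact (hρ.continuous.smul continuous_id).integrable_of_hasCompactSupport hc.smul_right
  rw [h2] at h
  simp only [zero_sub] at h
  exact h.unique ((hasFDerivAt_id _).sub_const _)

variable {T : Euc n → Euc n}

/-- mollification at scale `e` -/
def Tm (ρ : Euc n → ℝ) (T : Euc n → Euc n) (e : ℝ) (x : Euc n) : Euc n := ∫ z, ρ z • T (x - e • z)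

theorem Tm_hasF (hρ : ContDiff ℝ 1 ρ) (hc : HasCompactSupport ρ) (hT : AEMeasurable T volume)
    (hb : ∀ x, ‖T x‖ ≤ 1) {e : ℝ} (he : 0 < e) (x : Euc n) :
    HasFDerivAt (Tm ρ T e) (∫ z, (fderiv ℝ ρ z).smulRight (e⁻¹ • T (x - e • z))) x := by
  have hg : LocallyIntegrable (fun y => T (e • y)) volume := by
    refine locInt_of_bdd ?_ (M := 1) fun y => hb _
    simpa using aem_affine hT 0 (neg_ne_zero.2 he.ne')
  have h := moll_deriv hρ hc hg (e⁻¹ • x)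
  have h2 := h.comp x ((hasFDerivAt_id x).const_smul e⁻¹)
  have e1 : ∀ y z : Euc n, e • (e⁻¹ • y - z) = y - e • z := fun y z => by
    rw [smul_sub, smul_smul, mul_inv_cancel₀ he.ne', one_smul]
  simp only [e1] at h2
  have e2 : ((fun x => ∫ t, ρ t • T (e • (x - t))) ∘ (HSMul.hSMul e⁻¹)) = Tm ρ T e := by
    funext y
    simp only [Function.comp, e1, Tm]
  rw [e2] at h2
  refine h2.congr_fderiv (Eq.symm ?_)
  have e3 : ∀ z, (fderiv ℝ ρ z).smulRight (e⁻¹ • T (x - e • z)) = e⁻¹ • (fderiv ℝ ρ z).smulRight (T (x - e • z)) := by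
    intro z; ext v i; simp; ring
  simp_rw [e3]
  rw [integral_smul]
  ext v i; simp

theorem Tm_intble (hρ : ContDiff ℝ 1 ρ) (hc : HasCompactSupport ρ) (hT : AEMeasurable T volume)
    (hb : ∀ x, ‖T x‖ ≤ 1) {e : ℝ} (he : 0 < e) (x : Euc n) : Integrable (fun z => ρ z • T (x - e • z)) volume := by
  refine ((rho_int hρ hc).norm).mono (hρ.continuous.aestronglyMeasurable.smul (aem_affine hT x he.ne')) 
    (Filter.Eventually.of_forall fun z => ?_)
  rw [norm_smul, norm_norm]
  exact mul_le_of_le_one_right (norm_nonneg _) (hb _)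

theorem Tm_mem {K : Set (Euc n)} (hKc : IsClosed K) (hKv : Convex ℝ K)
    (hρ : ContDiff ℝ 1 ρ) (hc : HasCompactSupport ρ) (h0 : ∀ x, 0 ≤ ρ x) (h1 : ∫ x, ρ x = 1)
    (hT : AEMeasurable T volume) (hK : ∀ x, T x ∈ K)
    (hb : ∀ x, ‖T x‖ ≤ 1) {e : ℝ} (he : 0 < e) (x : Euc n) : Tm ρ T e x ∈ K := by
  have hm : Measurable (fun z => Real.toNNReal (ρ z)) := hρ.continuous.measurable.real_toNNReal
  set P : Measure (Euc n) := volume.withDensity (fun z => ((Real.toNNReal (ρ z) : ℝ≥0) : ℝ≥0∞)) with hP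
  have hprob : IsProbabilityMeasure P := by
    refine ⟨?_⟩
    rw [hP, withDensity_apply _ MeasurableSet.univ, Measure.restrict_univ]
    have := ofReal_integral_eq_lintegral_ofReal (rho_int hρ hc) (Filter.Eventually.of_forall h0)
    rw [h1, ENNReal.ofReal_one] at this
    exact this.symm
  have e0 : ∀ z, Real.toNNReal (ρ z) • T (x - e • z) = ρ z • T (x - e • z) := fun z => by
    rw [NNReal.smul_def, Real.coe_toNNReal _ (h0 z)]
  have e1 : Tm ρ T e x = ∫ z, T (x - e • z) ∂P := by
    rw [hP, integral_withDensity_eq_integral_smul hm]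
    simp_rw [e0]; rfl
  rw [e1]
  refine hKv.integral_mem hKc (Filter.Eventually.of_forall fun z => hK _) ?_
  refine Integrable.of_bound (C := 1) ?_ (Filter.Eventually.of_forall fun z => hb _)
  exact (aem_affine hT x he.ne').mono_ac (withDensity_absolutelyContinuous _ _)

theorem Tm_tendsto (hρ : ContDiff ℝ 1 ρ) (hc : HasCompactSupport ρ) (h1 : ∫ x, ρ x = 1)
    (hT : AEMeasurable T volume) (hb : ∀ x, ‖T x‖ ≤ 1) {e : ℕ → ℝ} (he : ∀ j, 0 < e j)
    (he0 : Filter.Tendsto e Filter.atTop (𝓝 0)) {x : Euc n} (hx : ContinuousAt T x) :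
    Filter.Tendsto (fun j => Tm ρ T (e j) x) Filter.atTop (𝓝 (T x)) := by
  have e1 : T x = ∫ z, ρ z • T x := by rw [integral_smul_const, h1, one_smul]
  nth_rw 1 [e1]
  refine tendsto_integral_of_dominated_convergence (fun z => ‖ρ z‖)
    (fun j => (Tm_intble hρ hc hT hb (he j) x).aestronglyMeasurable) (rho_int hρ hc).norm
    (fun j => Filter.Eventually.of_forall fun z => ?_) (Filter.Eventually.of_forall fun z => ?_)
  · rw [norm_smul]; exact mul_le_of_le_one_right (norm_nonneg _) (hb _)
  · have ht : Filter.Tendsto (fun j => x - e j • z) Filter.atTop (𝓝 x) := by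
      simpa using tendsto_const_nhds.sub (he0.smul_const z)
    exact (hx.tendsto.comp ht).const_smul _

theorem Tm_fderiv_tendsto (hρ : ContDiff ℝ 1 ρ) (hc : HasCompactSupport ρ) (h1 : ∫ x, ρ x = 1)
    (hT : AEMeasurable T volume) (hb : ∀ x, ‖T x‖ ≤ 1) {e : ℕ → ℝ} (he : ∀ j, 0 < e j)
    (he0 : Filter.Tendsto e Filter.atTop (𝓝 0)) {x : Euc n} (hx : DifferentiableAt ℝ T x) :
    Filter.Tendsto (fun j => fderiv ℝ (Tm ρ T (e j)) x) Filter.atTop (𝓝 (fderiv ℝ T x)) := by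
  set A := fderiv ℝ T x with hA
  have hinteg : ∀ j, Integrable (fun z => (fderiv ℝ ρ z).smulRight ((e j)⁻¹ • T (x - e j • z))) volume := fun j => by
    refine ((rho_fderiv_int hρ hc).norm.const_mul (e j)⁻¹).mono ?_ (Filter.Eventually.of_forall fun z => ?_)
    · exact smulR_meas (rho_fderiv_int hρ hc).aestronglyMeasurable
        ((aem_affine hT x (he j).ne').const_smul (e j)⁻¹)
    · rw [ContinuousLinearMap.norm_smulRight_apply, norm_smul, norm_mul, norm_norm]
      have := mul_le_of_le_one_right (norm_nonneg (e j)⁻¹) (hb (x - e j • z))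
      rw [mul_comm]
      exact mul_le_mul_of_nonneg_right this (norm_nonneg _)
  have hinteg2 : ∀ (c : Euc n), Integrable (fun z => (fderiv ℝ ρ z).smulRight c) volume := fun c => by
    refine ((rho_fderiv_int hρ hc).norm.const_mul ‖c‖).mono (smulR_meas
      (rho_fderiv_int hρ hc).aestronglyMeasurable aestronglyMeasurable_const) (Filter.Eventually.of_forall fun z => ?_)
    rw [ContinuousLinearMap.norm_smulRight_apply, norm_mul, norm_norm, norm_norm, mul_comm]
  have e1 : ∀ j, fderiv ℝ (Tm ρ T (e j)) x = ∫ z, (fderiv ℝ ρ z).smulRight ((e j)⁻¹ • (T (x - e j • z) - T x)) := by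
    intro j
    rw [(Tm_hasF hρ hc hT hb (he j) x).fderiv]
    have h3 := rho_fderiv_zero hρ hc ((e j)⁻¹ • T x)
    have h4 := integral_sub (hinteg j) (hinteg2 ((e j)⁻¹ • T x))
    rw [h3, sub_zero] at h4
    rw [← h4]
    refine integral_congr_ae (Filter.Eventually.of_forall fun z => ?_)
    ext v i; simp; ring
  have e2 : A = ∫ z, (fderiv ℝ ρ z).smulRight (A (-z)) := by
    have h3 := rho_fderiv_id hρ hc h1
    have hi : Integrable (fun t => (fderiv ℝ ρ t).smulRight (-t)) volume := by
      refine Continuous.integrable_of_hasCompactSupport ?_ ?_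
      · exact (smulR_cont n).comp
          ((hρ.continuous_fderiv one_ne_zero).prodMk continuous_neg)
      · refine (hc.fderiv ℝ).mono fun t ht => ?_
        rw [Function.mem_support] at ht ⊢
        intro h; apply ht; rw [h]; ext; simp
    have h4 := (ContinuousLinearMap.compL ℝ (Euc n) (Euc n) (Euc n) A).integral_comp_comm hi
    rw [h3] at h4
    have h5 : (ContinuousLinearMap.compL ℝ (Euc n) (Euc n) (Euc n) A) (ContinuousLinearMap.id ℝ (Euc n)) = A := by
      ext; simp
    rw [h5] at h4
    nth_rw 1 [← h4]
    refine integral_congr_ae (Filter.Eventually.of_forall fun z => ?_)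
    ext v i; simp
  obtain ⟨C, hC⟩ : ∃ C : ℝ, ∀ y, ‖T y - T x‖ ≤ C * ‖y - x‖ := by
    have hO := hx.hasFDerivAt.isBigO_sub
    obtain ⟨c, hc'⟩ := hO.bound
    obtain ⟨r, hr, hball⟩ := Metric.eventually_nhds_iff.1 hc'
    refine ⟨max c (2 / r), fun y => ?_⟩
    by_cases hy : dist y x < r
    · exact (hball hy).trans (by gcongr; exact le_max_left _ _)
    · have h2 : ‖T y - T x‖ ≤ 2 := (norm_sub_le _ _).trans (by linarith [hb y, hb x])
      rw [dist_eq_norm] at hy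
      push Not at hy
      have h3 : 2 ≤ 2 / r * ‖y - x‖ := by
        rw [div_mul_eq_mul_div, le_div_iff₀ hr]; linarith
      exact (h2.trans h3).trans (by gcongr; exact le_max_right _ _)
  simp_rw [e1]
  nth_rw 1 [e2]
  have hC0 : ∀ j z, ‖(e j)⁻¹ • (T (x - e j • z) - T x)‖ ≤ C * ‖z‖ := fun j z => by
    have h3 := hC (x - e j • z)
    rw [sub_sub_cancel_left, norm_neg, norm_smul, Real.norm_of_nonneg (he j).le] at h3
    rw [norm_smul, norm_inv, Real.norm_of_nonneg (he j).le, inv_mul_le_iff₀ (he j)]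
    linarith
  refine tendsto_integral_of_dominated_convergence (fun z => ‖fderiv ℝ ρ z‖ * (C * ‖z‖))
    (fun j => ?_) ?_ (fun j => Filter.Eventually.of_forall fun z => ?_) (Filter.Eventually.of_forall fun z => ?_)
  · have := ((hinteg j).sub (hinteg2 ((e j)⁻¹ • T x))).aestronglyMeasurable
    refine this.congr (Filter.Eventually.of_forall fun z => ?_)
    ext v i; simp; ring
  · refine Continuous.integrable_of_hasCompactSupport ?_ ?_
    · exact (hρ.continuous_fderiv one_ne_zero).norm.mul (continuous_const.mul continuous_norm)
    · exact (hc.fderiv ℝ).norm.mul_right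
  · rw [ContinuousLinearMap.norm_smulRight_apply]
    exact mul_le_mul_of_nonneg_left (hC0 j z) (norm_nonneg _)
  · have hl : Filter.Tendsto (fun j => (e j)⁻¹ • (T (x - e j • z) - T x)) Filter.atTop (𝓝 (A (-z))) := by
      have hinv : Filter.Tendsto (fun j => (e j)⁻¹) Filter.atTop Filter.atTop :=
        (tendsto_nhdsWithin_iff.2 ⟨he0, Filter.Eventually.of_forall he⟩).inv_tendsto_nhdsGT_zero
      have := (hx.hasFDerivAt.lim_real (-z)).comp hinv
      refine this.congr fun j => ?_
      simp [Function.comp, sub_eq_add_neg]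
    exact ((smulR_cont n).tendsto (fderiv ℝ ρ z, A (-z))).comp (tendsto_const_nhds.prodMk_nhds hl)

end moll
end PartL

section PartM
section moll2
variable {n : ℕ} {ρ : Euc n → ℝ} {T : Euc n → Euc n}

theorem Tm_grad (hρ : ContDiff ℝ 1 ρ) (hc : HasCompactSupport ρ) (hT : AEMeasurable T volume)
    (hb : ∀ x, ‖T x‖ ≤ 1) {φ : Euc n → ℝ} (hφ : LipschitzWith 1 φ)
    (hae : ∀ᵐ x, HasFDerivAt φ (innerSL ℝ (T x)) x) {e : ℝ} (he : 0 < e) (x : Euc n) :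
    HasFDerivAt (fun x => ∫ z, ρ z * φ (x - e • z)) (innerSL ℝ (Tm ρ T e x)) x := by
  have hi := Tm_intble hρ hc hT hb he x
  have e1 : innerSL ℝ (Tm ρ T e x) = ∫ z, ρ z • innerSL ℝ (T (x - e • z)) := by
    have := (innerSL ℝ : Euc n →L[ℝ] Euc n →L[ℝ] ℝ).integral_comp_comm hi
    rw [Tm, ← this]
    refine integral_congr_ae (Filter.Eventually.of_forall fun z => ?_)
    exact (innerSL ℝ : Euc n →L[ℝ] Euc n →L[ℝ] ℝ).map_smul _ _
  rw [e1]
  refine (hasFDerivAt_integral_of_dominated_loc_of_lip (F := fun x z => ρ z * φ (x - e • z)) (s := univ)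
    (bound := fun z => ρ z) Filter.univ_mem
    (Filter.Eventually.of_forall fun y => ?_) ?_ ?_ ?_ (rho_int hρ hc) ?_).2
  · exact (hρ.continuous.mul (hφ.continuous.comp (by fun_prop))).aestronglyMeasurable
  · exact (hρ.continuous.mul (hφ.continuous.comp (by fun_prop))).integrable_of_hasCompactSupport hc.mul_right
  · refine hρ.continuous.aestronglyMeasurable.smul ?_
    exact (innerSL ℝ : Euc n →L[ℝ] Euc n →L[ℝ] ℝ).continuous.comp_aestronglyMeasurable (aem_affine hT x he.ne')
  · refine Filter.Eventually.of_forall fun z => LipschitzOnWith.of_dist_le_mul fun a _ b _ => ?_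
    rw [Real.dist_eq, ← mul_sub, abs_mul, Real.coe_nnabs]
    refine mul_le_mul_of_nonneg_left ?_ (abs_nonneg _)
    have := hφ.dist_le_mul (a - e • z) (b - e • z)
    rw [Real.dist_eq, dist_sub_right] at this
    simpa using this
  · filter_upwards [ae_affine hae x he.ne'] with z hz
    have h1 : HasFDerivAt (fun y : Euc n => y - e • z) (ContinuousLinearMap.id ℝ (Euc n)) x :=
      (hasFDerivAt_id x).sub_const _
    have h2 := (hz.comp x h1).const_mul (ρ z)
    exact h2.congr_fderiv (by ext v; simp)

theorem Tm_sym (hρ : ContDiff ℝ 1 ρ) (hc : HasCompactSupport ρ) (hT : AEMeasurable T volume)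
    (hb : ∀ x, ‖T x‖ ≤ 1) {φ : Euc n → ℝ} (hφ : LipschitzWith 1 φ)
    (hae : ∀ᵐ x, HasFDerivAt φ (innerSL ℝ (T x)) x) {e : ℝ} (he : 0 < e) (x u v : Euc n) :
    inner ℝ (fderiv ℝ (Tm ρ T e) x u) v = inner ℝ u (fderiv ℝ (Tm ρ T e) x v) := by
  have hd := (Tm_hasF hρ hc hT hb he x).differentiableAt.hasFDerivAt
  have h2 : HasFDerivAt (fun y => (innerSL ℝ : Euc n →L[ℝ] Euc n →L[ℝ] ℝ) (Tm ρ T e y))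
      ((innerSL ℝ : Euc n →L[ℝ] Euc n →L[ℝ] ℝ).comp (fderiv ℝ (Tm ρ T e) x)) x :=
    (innerSL ℝ : Euc n →L[ℝ] Euc n →L[ℝ] ℝ).hasFDerivAt.comp x hd
  have := second_derivative_symmetric (fun y => Tm_grad hρ hc hT hb hφ hae he y) h2 u v
  simp only [ContinuousLinearMap.comp_apply, innerSL_apply_apply] at this
  rw [this, real_inner_comm]

theorem Tm_psd (hρ : ContDiff ℝ 1 ρ) (hc : HasCompactSupport ρ) (h0 : ∀ x, 0 ≤ ρ x) (hT : AEMeasurable T volume)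
    (hb : ∀ x, ‖T x‖ ≤ 1) (hm : ∀ x y, 0 ≤ inner ℝ (T x - T y) (x - y)) {e : ℝ} (he : 0 < e) (x v : Euc n) :
    0 ≤ inner ℝ (fderiv ℝ (Tm ρ T e) x v) v := by
  have hmono : ∀ y, 0 ≤ inner ℝ (Tm ρ T e y - Tm ρ T e x) (y - x) := fun y => by
    unfold Tm
    have hi : Integrable (fun z => ρ z • T (y - e • z) - ρ z • T (x - e • z)) volume :=
      (Tm_intble hρ hc hT hb he y).sub (Tm_intble hρ hc hT hb he x)
    rw [← integral_sub (Tm_intble hρ hc hT hb he y) (Tm_intble hρ hc hT hb he x), real_inner_comm,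
      ← integral_inner hi]
    refine integral_nonneg fun z => ?_
    have := hm (y - e • z) (x - e • z)
    rw [sub_sub_sub_cancel_right, real_inner_comm] at this
    simp only [← smul_sub, inner_smul_right, Pi.zero_apply]
    exact mul_nonneg (h0 z) this
  have hd := (Tm_hasF hρ hc hT hb he x).differentiableAt.hasFDerivAt
  have hl := hd.lim_real v
  have hl2 : Filter.Tendsto (fun c : ℝ => inner ℝ (c • (Tm ρ T e (x + c⁻¹ • v) - Tm ρ T e x)) v) Filter.atTop
      (𝓝 (inner ℝ (fderiv ℝ (Tm ρ T e) x v) v)) := hl.inner tendsto_const_nhds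
  refine ge_of_tendsto hl2 ?_
  filter_upwards [Filter.eventually_gt_atTop 0] with c hc
  have := hmono (x + c⁻¹ • v)
  rw [add_sub_cancel_left, inner_smul_right] at this
  rw [inner_smul_left]
  have h3 : 0 ≤ inner ℝ (Tm ρ T e (x + c⁻¹ • v) - Tm ρ T e x) v := nonneg_of_mul_nonneg_right this (inv_pos.2 hc)
  exact mul_nonneg hc.le h3

theorem Tm_BL (hρ : ContDiff ℝ 1 ρ) (hc : HasCompactSupport ρ) (hT : AEMeasurable T volume)
    (hb : ∀ x, ‖T x‖ ≤ 1) {e : ℝ} (hK : ∀ x, ‖Tm ρ T e x‖ ≤ 1) (he : 0 < e) : BL (Tm ρ T e) := by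
  refine ⟨⟨Real.toNNReal (∫ z, ‖fderiv ℝ ρ z‖ * e⁻¹), ?_⟩, 1, hK⟩
  refine lipschitzWith_of_nnnorm_fderiv_le (𝕜 := ℝ) (fun x => (Tm_hasF hρ hc hT hb he x).differentiableAt) fun x => ?_
  rw [(Tm_hasF hρ hc hT hb he x).fderiv, ← NNReal.coe_le_coe, coe_nnnorm]
  refine le_trans ?_ (Real.le_coe_toNNReal _)
  refine norm_integral_le_of_norm_le ((rho_fderiv_int hρ hc).norm.mul_const _) (Filter.Eventually.of_forall fun z => ?_)
  rw [ContinuousLinearMap.norm_smulRight_apply, norm_smul, norm_inv, Real.norm_of_nonneg he.le]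
  gcongr
  exact mul_le_of_le_one_right (by positivity) (hb _)

end moll2
end PartM

section PartN
/-- symmetric positive semidefinite -/
def PSD {n : ℕ} (L : Euc n →L[ℝ] Euc n) : Prop :=
  (∀ u v, inner ℝ (L u) v = inner ℝ u (L v)) ∧ ∀ v, 0 ≤ inner ℝ (L v) v

/-- the target body -/
def KK {n : ℕ} (S : Set (Euc n)) : Set (Euc n) := closure (ball 0 1 ∩ S)

theorem PSD_lim {n : ℕ} {L : ℕ → Euc n →L[ℝ] Euc n} {A : Euc n →L[ℝ] Euc n} (hL : ∀ j, PSD (L j))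
    (h : Filter.Tendsto L Filter.atTop (𝓝 A)) : PSD A := by
  have hv : ∀ v, Filter.Tendsto (fun j => L j v) Filter.atTop (𝓝 (A v)) := fun v =>
    ((ContinuousLinearMap.apply ℝ (Euc n) v).continuous.tendsto A).comp h
  refine ⟨fun u v => ?_, fun v => ?_⟩
  · refine tendsto_nhds_unique ((hv u).inner tendsto_const_nhds) ?_
    simp only [(hL _).1 u v]
    exact tendsto_const_nhds.inner (hv v)
  · exact ge_of_tendsto' ((hv v).inner tendsto_const_nhds) fun j => (hL j).2 v

namespace CW
variable {n k : ℕ} {α : ℝ} {S : Set (Euc n)} {w : Euc n → ℝ}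

theorem wS_bdd (H : CW n k α S w) (R : ℝ) : ∃ M : ℝ, 0 ≤ M ∧ ∀ x ∈ closedBall (0 : Euc n) R, wS S w x ≤ M := by
  have hc : IsCompact (closedBall (0 : Euc n) R ∩ closure S) := (isCompact_closedBall 0 R).inter_right isClosed_closure
  obtain ⟨M, hM⟩ := (hc.image_of_continuousOn (H.w_cont.mono inter_subset_right)).bddAbove
  refine ⟨max M 0, le_max_right _ _, fun x hx => ?_⟩
  by_cases h : x ∈ S
  · rw [wS_eq h]; exact le_max_of_le_left (hM ⟨x, ⟨hx, subset_closure h⟩, rfl⟩)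
  · rw [wS, indicator_of_notMem h]; exact le_max_right _ _

theorem mw_ball_lt (H : CW n k α S w) (R : ℝ) : mw S w (closedBall 0 R) < ⊤ := by
  obtain ⟨M, hM0, hM⟩ := H.wS_bdd R
  rw [mw_apply measurableSet_closedBall]
  calc _ ≤ ∫⁻ x in closedBall (0 : Euc n) R, ENNReal.ofReal M :=
        setLIntegral_mono measurable_const fun x hx => ENNReal.ofReal_le_ofReal (hM x hx)
    _ < ⊤ := by
        rw [setLIntegral_const]
        exact ENNReal.mul_lt_top (by simp) measure_closedBall_lt_top

theorem mw_open_pos (H : CW n k α S w) {U : Set (Euc n)} (hU : IsOpen U) (h : (U ∩ S).Nonempty) : 0 < mw S w U := by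
  rw [pos_iff_ne_zero]
  intro h0
  have h1 : mw S w (U ∩ S) = 0 := measure_mono_null inter_subset_left h0
  rw [mw_apply (hU.inter H.isOpen).measurableSet, lintegral_eq_zero_iff H.wS_meas.ennreal_ofReal] at h1
  have h2 : ∀ᵐ x ∂(volume.restrict (U ∩ S)), False := by
    filter_upwards [h1, ae_restrict_mem (hU.inter H.isOpen).measurableSet] with x hx hxU
    rw [wS_eq hxU.2] at hx
    have := H.w_pos hxU.2
    simp at hx; linarith
  rw [Filter.eventually_false_iff_eq_bot, ae_eq_bot, Measure.restrict_eq_zero] at h2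
  exact ((hU.inter H.isOpen).measure_pos volume h).ne' h2

theorem ball_inter_nonempty (H : CW n k α S w) : (ball (0 : Euc n) 1 ∩ S).Nonempty := by
  obtain ⟨p, hp⟩ := H.nonempty
  refine ⟨(1 / (‖p‖ + 1)) • p, ?_, H.smul_mem hp (by positivity)⟩
  rw [mem_ball_zero_iff, norm_smul, Real.norm_of_nonneg (by positivity), one_div, inv_mul_lt_iff₀ (by positivity)]
  linarith

theorem kappa_pos (H : CW n k α S w) : 0 < (mw S w (ball 0 1)).toReal :=
  ENNReal.toReal_pos (H.mw_open_pos isOpen_ball H.ball_inter_nonempty).ne'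
    (((measure_mono ball_subset_closedBall).trans_lt (H.mw_ball_lt 1)).ne)

theorem KK_sub : KK S ⊆ closedBall (0 : Euc n) 1 :=
  (closure_mono inter_subset_left).trans closure_ball_subset_closedBall

theorem KK_cl : KK S ⊆ closure S := closure_mono inter_subset_right

theorem mw_restrict (H : CW n k α S w) {E : Set (Euc n)} (hE : MeasurableSet E) :
    (mw S w).restrict E = volume.withDensity (E.indicator fun x => ENNReal.ofReal (wS S w x)) := by
  rw [mw, restrict_withDensity hE, ← withDensity_indicator hE]

theorem transport (H : CW n k α S w) {Hs : Set (Euc n)} (hm : MeasurableSet Hs) {R : ℝ≥0} (hR : Hs ⊆ closedBall 0 R)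
    (hpos : 0 < mw S w Hs) :
    ∃ (T : Euc n → Euc n) (A : Euc n → (Euc n →L[ℝ] Euc n)) (Tj : ℕ → Euc n → Euc n),
      AEMeasurable T volume ∧ (∀ x, T x ∈ KK S) ∧ (∀ j x, Tj j x ∈ KK S) ∧ (∀ j, BL (Tj j)) ∧
      (∀ j x, DifferentiableAt ℝ (Tj j) x) ∧ (∀ j x, PSD (fderiv ℝ (Tj j) x)) ∧
      (∀ᵐ x, Filter.Tendsto (fun j => Tj j x) Filter.atTop (𝓝 (T x))) ∧
      (∀ᵐ x, Filter.Tendsto (fun j => fderiv ℝ (Tj j) x) Filter.atTop (𝓝 (A x)) ∧ PSD (A x)) ∧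
      (∀ᵐ x ∂((mw S w).restrict Hs), T x ∈ S ∧
        (mw S w (ball 0 1)).toReal / (mw S w Hs).toReal * w x ≤ |(A x).det| * w (T x)) ∧
      (∀ Ψ : Euc n → ℝ, Continuous Ψ → (mw S w (ball 0 1)).toReal / (mw S w Hs).toReal * ∫ x in Hs, Ψ (T x) ∂(mw S w)
        = ∫ x in ball 0 1, Ψ x ∂(mw S w)) := by
  have hk1 := H.mw_open_pos isOpen_ball H.ball_inter_nonempty
  have hk2 : mw S w (ball 0 1) < ⊤ := (measure_mono ball_subset_closedBall).trans_lt (H.mw_ball_lt 1)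
  have hH2 : mw S w Hs < ⊤ := (measure_mono hR).trans_lt (H.mw_ball_lt R)
  set s : ℝ≥0∞ := mw S w (ball 0 1) / mw S w Hs with hs
  have hs0 : s ≠ 0 := (ENNReal.div_pos hk1.ne' hH2.ne).ne'
  have hst : s ≠ ⊤ := (ENNReal.div_lt_top hk2.ne hpos.ne').ne
  have hsr : s.toReal = (mw S w (ball 0 1)).toReal / (mw S w Hs).toReal := ENNReal.toReal_div _ _
  set μ := s • (mw S w).restrict Hs with hμ
  set ν := (mw S w).restrict (ball 0 1) with hν
  haveI : IsFiniteMeasure ((mw S w).restrict Hs) := ⟨by simpa using hH2⟩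
  haveI : IsFiniteMeasure μ := ⟨by
    rw [hμ]; simp; exact ENNReal.mul_lt_top hst.lt_top hH2⟩
  haveI : IsFiniteMeasure ν := ⟨by simpa [hν] using hk2⟩
  haveI : CompactSpace (KK S) := isCompact_iff_compactSpace.1
    ((isCompact_closedBall (0 : Euc n) 1).of_isClosed_subset isClosed_closure KK_sub)
  haveI : Nonempty (KK S) := (H.ball_inter_nonempty.mono subset_closure).to_subtype
  have hμR : ∀ᵐ x ∂μ, x ∈ closedBall (0 : Euc n) R := by
    refine Measure.ae_smul_measure ?_ s
    filter_upwards [ae_restrict_mem hm] with x hx using hR hx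
  have hac : μ ≪ volume := (Measure.smul_absolutelyContinuous).trans
      ((Measure.restrict_le_self.absolutelyContinuous).trans mw_ac)
  have hνK : ∀ᵐ x ∂ν, x ∈ KK S := by
    filter_upwards [ae_restrict_mem measurableSet_ball, ae_restrict_of_ae H.ae_mw_S] with x h1 h2
    exact subset_closure ⟨h1, h2⟩
  obtain ⟨T, φ, hTK, hφ, hsub, hae, hTm, hmap⟩ := brenier KK_sub hμR hac ν hνK (by
    simp only [hμ, hν, Measure.smul_apply, Measure.restrict_apply_univ, smul_eq_mul, hs]
    exact ENNReal.div_mul_cancel hpos.ne' hH2.ne)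
  have hb : ∀ x, ‖T x‖ ≤ 1 := fun x => mem_closedBall_zero_iff.1 (KK_sub (hTK x))
  have hmono : ∀ x y, 0 ≤ inner ℝ (T x - T y) (x - y) := fun x y => by
    have h1 := hsub x y
    have h2 := hsub y x
    rw [inner_sub_left] at h1 h2
    rw [inner_sub_left, inner_sub_right, inner_sub_right, real_inner_comm x (T x), real_inner_comm y (T x), real_inner_comm x (T y),
      real_inner_comm y (T y)]
    linarith
  have hdiff := mono_ae_diff hmono (hae.mono fun x hx => hx.2)
  have hgrad : ∀ᵐ x, HasFDerivAt φ (innerSL ℝ (T x)) x := hae.mono fun x hx => hx.1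
  obtain ⟨ρ, hρ, hρc, hρ0, hρ1⟩ := exists_rho (n := n)
  set e : ℕ → ℝ := fun j => 1 / ((j : ℝ) + 1) with he
  have hep : ∀ j, 0 < e j := fun j => by positivity
  have he0 : Filter.Tendsto e Filter.atTop (𝓝 0) := tendsto_one_div_add_atTop_nhds_zero_nat
  have hconv : Convex ℝ (KK S) := ((convex_ball 0 1).inter H.convex).closure
  have hTjK : ∀ j x, Tm ρ T (e j) x ∈ KK S := fun j x =>
    Tm_mem isClosed_closure hconv hρ hρc hρ0 hρ1 hTm hTK hb (hep j) x
  have hpsd : ∀ j x, PSD (fderiv ℝ (Tm ρ T (e j)) x) := fun j x =>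
    ⟨Tm_sym hρ hρc hTm hb hφ hgrad (hep j) x, Tm_psd hρ hρc hρ0 hTm hb hmono (hep j) x⟩
  refine ⟨T, fderiv ℝ T, fun j => Tm ρ T (e j), hTm, hTK, hTjK, fun j =>
    Tm_BL hρ hρc hTm hb (fun x => mem_closedBall_zero_iff.1 (KK_sub (hTjK j x))) (hep j),
    fun j x => (Tm_hasF hρ hρc hTm hb (hep j) x).differentiableAt, hpsd, ?_, ?_, ?_, ?_⟩
  · filter_upwards [hae] with x hx using Tm_tendsto hρ hρc hρ1 hTm hb hep he0 hx.2
  · filter_upwards [hdiff] with x hx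
    have := Tm_fderiv_tendsto hρ hρc hρ1 hTm hb hep he0 hx
    exact ⟨this, PSD_lim (fun j => hpsd j x) this⟩
  · have hTμ : AEMeasurable T μ := hTm.mono_ac hac
    have h1 : ∀ᵐ x ∂((mw S w).restrict Hs), T x ∈ S := by
      have : ∀ᵐ y ∂(Measure.map T μ), y ∈ S := by
        rw [hmap]; exact ae_restrict_of_ae H.ae_mw_S
      have h2 := ae_of_ae_map hTμ this
      rw [hμ, Measure.ae_ennreal_smul_measure_eq hs0] at h2
      exact h2
    have hMA := MA hTm hdiff (f := fun x => s * Hs.indicator (fun x => ENNReal.ofReal (wS S w x)) x)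
      (g := (ball 0 1).indicator fun x => ENNReal.ofReal (wS S w x))
      ((H.wS_meas.ennreal_ofReal.indicator hm).const_mul s) (H.wS_meas.ennreal_ofReal.indicator measurableSet_ball)
      (fun x => by by_cases h : x ∈ ball (0 : Euc n) 1 <;> simp [h]) (by
        rw [← H.mw_restrict measurableSet_ball, ← hν, ← hmap]
        congr 1
        rw [hμ, H.mw_restrict hm]
        exact withDensity_smul s (H.wS_meas.ennreal_ofReal.indicator hm))
    have hMA' : ∀ᵐ x ∂((mw S w).restrict Hs), _ := ((Measure.restrict_le_self.absolutelyContinuous).trans mw_ac) hMA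
    filter_upwards [h1, hMA', ae_restrict_mem hm, ae_restrict_of_ae H.ae_mw_S] with x hx1 hx2 hx3 hx4
    refine ⟨hx1, ?_⟩
    rw [indicator_of_mem hx3, wS_eq hx4] at hx2
    have h3 : (ball (0 : Euc n) 1).indicator (fun x => ENNReal.ofReal (wS S w x)) (T x) ≤ ENNReal.ofReal (w (T x)) := by
      by_cases h : T x ∈ ball (0 : Euc n) 1
      · rw [indicator_of_mem h, wS_eq hx1]
      · rw [indicator_of_notMem h]; simp
    have h4 := hx2.trans (mul_le_mul_right h3 _)
    rw [← ENNReal.ofReal_toReal hst, ← ENNReal.ofReal_mul ENNReal.toReal_nonneg, ← ENNReal.ofReal_mul (abs_nonneg _),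
      ENNReal.ofReal_le_ofReal_iff (mul_nonneg (abs_nonneg _) (H.w_pos hx1).le), hsr] at h4
    exact h4
  · intro Ψ hΨ
    rw [← hmap, integral_map (hTm.mono_ac hac) hΨ.aestronglyMeasurable, hμ, integral_smul_measure, hsr, smul_eq_mul]

end CW
end PartN

section PartO
theorem PSD_eig {n : ℕ} {L : Euc n →L[ℝ] Euc n} (hL : PSD L) :
    ∃ lam : Fin n → ℝ, (∀ i, 0 ≤ lam i) ∧ tr L = ∑ i, lam i ∧ L.det = ∏ i, lam i ∧
      ∀ c : ℝ, ‖L - c • ContinuousLinearMap.id ℝ (Euc n)‖ ≤ ∑ i, |lam i - c| := by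
  have hs : (L : Euc n →ₗ[ℝ] Euc n).IsSymmetric := fun u v => hL.1 u v
  have hn : Module.finrank ℝ (Euc n) = n := by simp
  have happ := hs.apply_eigenvectorBasis hn
  set b := hs.eigenvectorBasis hn with hb
  set lam := hs.eigenvalues hn with hlam
  have happ' : ∀ i, L (b i) = lam i • b i := fun i => by simpa using happ i
  refine ⟨lam, fun i => ?_, ?_, ?_, fun c => ?_⟩
  · have := hL.2 (b i)
    rw [happ' i, inner_smul_left, real_inner_self_eq_norm_sq, b.norm_eq_one] at this
    simpa using this
  · have := hs.trace_eq_sum_eigenvalues hn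
    rw [LinearMap.trace_eq_sum_inner _ (EuclideanSpace.basisFun (Fin n) ℝ)] at this
    simp only [RCLike.ofReal_real_eq_id, id] at this
    rw [← this, tr]
    refine Finset.sum_congr rfl fun i _ => ?_
    simp [EuclideanSpace.basisFun_apply, EuclideanSpace.inner_single_left]
  · have := hs.det_eq_prod_eigenvalues hn
    simpa [ContinuousLinearMap.det] using this
  · refine ContinuousLinearMap.opNorm_le_bound _ (Finset.sum_nonneg fun i _ => abs_nonneg _) fun v => ?_
    have e1 : (L - c • ContinuousLinearMap.id ℝ (Euc n)) v = ∑ i, (lam i - c) • (inner ℝ (b i) v) • b i := by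
      conv_lhs => rw [← b.sum_repr' v]
      rw [map_sum]
      refine Finset.sum_congr rfl fun i _ => ?_
      rw [map_smul]
      simp only [ContinuousLinearMap.sub_apply, ContinuousLinearMap.smul_apply, ContinuousLinearMap.id_apply, happ' i]
      rw [← sub_smul, smul_comm]
    rw [e1, Finset.sum_mul]
    refine (norm_sum_le _ _).trans (Finset.sum_le_sum fun i _ => ?_)
    rw [norm_smul, norm_smul, b.norm_eq_one, mul_one, Real.norm_eq_abs]
    refine mul_le_mul_of_nonneg_left ?_ (abs_nonneg _)
    have := norm_inner_le_norm (𝕜 := ℝ) (b i) v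
    rwa [b.norm_eq_one, one_mul] at this

theorem PSD_tr_nonneg {n : ℕ} {L : Euc n →L[ℝ] Euc n} (hL : PSD L) : 0 ≤ tr L := by
  obtain ⟨lam, h0, h1, -⟩ := PSD_eig hL
  rw [h1]; exact Finset.sum_nonneg fun i _ => h0 i

theorem PSD_norm_le {n : ℕ} {L : Euc n →L[ℝ] Euc n} (hL : PSD L) : ‖L‖ ≤ tr L := by
  obtain ⟨lam, h0, h1, -, h2⟩ := PSD_eig hL
  have := h2 0
  rw [show (0:ℝ) • ContinuousLinearMap.id ℝ (Euc n) = 0 from by ext v; simp, sub_zero] at this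
  refine this.trans (h1.symm ▸ Finset.sum_le_sum fun i _ => ?_)
  rw [sub_zero, abs_of_nonneg (h0 i)]

theorem eig_sum_log {n : ℕ} {α s τ : ℝ} (hα : 0 < α) (hs : 0 < s) (hτ : 0 < τ) {lam : Fin n → ℝ}
    (h0 : ∀ i, 0 ≤ lam i) (h : s ≤ |∏ i, lam i| * τ ^ α) :
    (∀ i, 0 < lam i) ∧ Real.log s ≤ ∑ i, Real.log (lam i) + α * Real.log τ := by
  have hp : 0 < ∏ i, lam i := by
    refine lt_of_le_of_ne (Finset.prod_nonneg fun i _ => h0 i) fun h1 => ?_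
    rw [← h1] at h; simp at h; linarith
  have hi : ∀ i, 0 < lam i := fun i => lt_of_le_of_ne (h0 i) fun h1 => hp.ne' (Finset.prod_eq_zero (Finset.mem_univ i) h1.symm)
  refine ⟨hi, ?_⟩
  rw [abs_of_pos hp] at h
  have := Real.log_le_log hs h
  rwa [Real.log_mul hp.ne' (Real.rpow_pos_of_pos hτ _).ne', Real.log_rpow hτ, Real.log_prod (fun i _ => (hi i).ne')] at this

theorem tr_ge {n : ℕ} {L : Euc n →L[ℝ] Euc n} (hL : PSD L) {α s τ : ℝ} (hα : 0 < α) (hs : 0 < s) (hτ : 0 < τ)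
    (h : s ≤ |L.det| * τ ^ α) : (n + α) * s ^ (1 / (n + α)) ≤ tr L + α * τ := by
  obtain ⟨lam, h0, h1, hd, -⟩ := PSD_eig hL
  rw [hd] at h
  obtain ⟨hi, hl⟩ := eig_sum_log hα hs hτ h0 h
  have hD : (0:ℝ) < n + α := by positivity
  set t := s ^ (1 / (n + α)) with ht
  have htp : 0 < t := Real.rpow_pos_of_pos hs _
  have hlt : Real.log s = (n + α) * Real.log t := by rw [ht, Real.log_rpow hs]; field_simp
  have k1 : ∀ x : ℝ, 0 < x → Real.log x - Real.log t ≤ x / t - 1 := fun x hx => by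
    rw [← Real.log_div hx.ne' htp.ne']; exact Real.log_le_sub_one_of_pos (by positivity)
  have k2 : ∑ i, (Real.log (lam i) - Real.log t) ≤ ∑ i, (lam i / t - 1) := Finset.sum_le_sum fun i _ => k1 _ (hi i)
  have k3 := mul_le_mul_of_nonneg_left (k1 τ hτ) hα.le
  simp only [Finset.sum_sub_distrib, Finset.sum_const, Finset.card_univ, Fintype.card_fin, nsmul_eq_mul, ← Finset.sum_div] at k2
  rw [← h1] at k2
  have k4 : n + α ≤ tr L / t + α * (τ / t) := by nlinarith
  have : (tr L / t + α * (τ / t)) * t = tr L + α * τ := by field_simp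
  rw [← this]; exact mul_le_mul_of_nonneg_right k4 htp.le

theorem norm_sub_id_le {n : ℕ} {L : Euc n →L[ℝ] Euc n} (hL : PSD L) {α s τ : ℝ} (hα : 0 < α) (hs : 1 ≤ s) (hτ : 0 < τ)
    (h : s ≤ |L.det| * τ ^ α) : 0 ≤ tr L + α * τ - (n + α) ∧ ‖L - ContinuousLinearMap.id ℝ (Euc n)‖ ≤
      n * (2 * √(tr L + α * τ - (n + α)) + (tr L + α * τ - (n + α))) := by
  obtain ⟨lam, h0, h1, hd, hn⟩ := PSD_eig hL
  rw [hd] at h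
  obtain ⟨hi, hl⟩ := eig_sum_log hα (by linarith) hτ h0 h
  have hls : 0 ≤ Real.log s := Real.log_nonneg hs
  set q := tr L + α * τ - (n + α) with hq
  have f0 : ∀ x : ℝ, 0 < x → 0 ≤ x - 1 - Real.log x := fun x hx => by have := Real.log_le_sub_one_of_pos hx; linarith
  have hsum : ∑ i, (lam i - 1 - Real.log (lam i)) ≤ q := by
    simp only [Finset.sum_sub_distrib, Finset.sum_const, Finset.card_univ, Fintype.card_fin, nsmul_eq_mul, mul_one]
    rw [← h1]
    have := mul_nonneg hα.le (f0 τ hτ)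
    nlinarith
  have hle : ∀ i, lam i - 1 - Real.log (lam i) ≤ q := fun i =>
    (Finset.single_le_sum (fun j _ => f0 _ (hi j)) (Finset.mem_univ i)).trans hsum
  have hq0 : 0 ≤ q := (Finset.sum_nonneg fun j _ => f0 _ (hi j)).trans hsum
  refine ⟨hq0, ?_⟩
  have := hn 1
  rw [one_smul] at this
  refine this.trans ?_
  have hb : ∀ i, |lam i - 1| ≤ 2 * √q + q := fun i => by
    have hr : 0 < √(lam i) := Real.sqrt_pos.2 (hi i)
    have hr2 : √(lam i) ^ 2 = lam i := Real.sq_sqrt (hi i).le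
    have hlog : Real.log (lam i) = 2 * Real.log √(lam i) := by
      rw [← hr2, Real.log_pow, hr2]; norm_num
    have h3 := Real.log_le_sub_one_of_pos hr
    have h4 : (√(lam i) - 1) ^ 2 ≤ q := by have := hle i; nlinarith
    have h5 : |√(lam i) - 1| ≤ √q := Real.abs_le_sqrt h4
    have h6 := abs_le.1 h5
    have hsq : √q ^ 2 = q := Real.sq_sqrt hq0
    have hsn := Real.sqrt_nonneg q
    have e : |lam i - 1| = |√(lam i) - 1| * (√(lam i) + 1) := by
      rw [← abs_of_pos (show 0 < √(lam i) + 1 by linarith), ← abs_mul]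
      congr 1; nlinarith
    rw [e]
    calc _ ≤ √q * (√q + 2) := mul_le_mul h5 (by linarith) (by linarith) hsn
      _ = _ := by nlinarith
  calc _ ≤ ∑ i : Fin n, (2 * √q + q) := Finset.sum_le_sum fun i _ => hb i
    _ = _ := by simp; ring
end PartO

section PartP
/-- admissible domains -/
structure Dom {n : ℕ} (S : Set (Euc n)) (w : Euc n → ℝ) (E : Set (Euc n)) : Prop where
  op : IsOpen E
  sub : E ⊆ S
  vol : mw S w E < ⊤
  per : mb S w E univ < ⊤

theorem Dom.fin {n : ℕ} {S : Set (Euc n)} {w : Euc n → ℝ} {E : Set (Euc n)} (hE : Dom S w E) :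
    IsFiniteMeasure ((mw S w).restrict E) := ⟨by simpa using hE.vol⟩

theorem Dom.finb {n : ℕ} {S : Set (Euc n)} {w : Euc n → ℝ} {E : Set (Euc n)} (hE : Dom S w E) :
    IsFiniteMeasure (mb S w E) := ⟨hE.per⟩

theorem Dom.intE {n : ℕ} {S : Set (Euc n)} {w : Euc n → ℝ} {E : Set (Euc n)} (hE : Dom S w E)
    {f : Euc n → ℝ} (hf : Measurable f) {M : ℝ} (hM : ∀ x, |f x| ≤ M) : IntegrableOn f E (mw S w) := by
  haveI := hE.fin
  exact Integrable.of_bound hf.aestronglyMeasurable M (ae_of_all _ hM)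

theorem Dom.intB {n : ℕ} {S : Set (Euc n)} {w : Euc n → ℝ} {E : Set (Euc n)} (hE : Dom S w E)
    {f : Euc n → ℝ} (hf : Measurable f) {M : ℝ} (hM : ∀ x, |f x| ≤ M) : Integrable f (mb S w E) := by
  haveI := hE.finb
  exact Integrable.of_bound hf.aestronglyMeasurable M (ae_of_all _ hM)

theorem BL.intb_norm_fderiv {n : ℕ} {S : Set (Euc n)} {w : Euc n → ℝ} {E : Set (Euc n)} (hE : Dom S w E)
    {Y : Type*} [NormedAddCommGroup Y] [NormedSpace ℝ Y] [CompleteSpace Y]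
    {f : Euc n → Y} (hf : BL f) : IntegrableOn (fun x => ‖fderiv ℝ f x‖) E (mw S w) := by
  haveI := hE.fin
  obtain ⟨K, hK, hb⟩ := hf.norm_fderiv
  refine Integrable.of_bound ((measurable_fderiv ℝ f).norm.aestronglyMeasurable) K (ae_of_all _ fun x => ?_)
  rw [norm_norm]; exact hb x

/-- the truncated divergence -/
def GJ {n : ℕ} (α : ℝ) (S : Set (Euc n)) (w : Euc n → ℝ) (T : Euc n → Euc n) (j : ℕ) (x : Euc n) : ℝ :=
  dv T x + α * min (hh α w (T x) / (wS S w x ^ (1 / α))) j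

namespace CW
variable {n k : ℕ} {α : ℝ} {S : Set (Euc n)} {w : Euc n → ℝ}

theorem GJ_meas (H : CW n k α S w) {T : Euc n → Euc n} (hT : Continuous T) (hTS : ∀ x, T x ∈ closure S) (j : ℕ) :
    Measurable (GJ α S w T j) := by
  have h1 : Continuous (fun x => hh α w (T x)) := H.hh_cont.comp_continuous hT hTS
  exact (measurable_dv T).add (((h1.measurable.div (H.wS_meas.pow_const _)).min measurable_const).const_mul α)

theorem hS_nonneg (H : CW n k α S w) {y : Euc n} (hy : y ∈ closure S) (j : ℕ) (x : Euc n) :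
    0 ≤ min (hh α w y / (wS S w x ^ (1 / α))) j :=
  le_min (div_nonneg (H.hh_nonneg hy) (Real.rpow_nonneg (H.wS_nonneg x) _)) (Nat.cast_nonneg j)

theorem GJ_nonneg (H : CW n k α S w) {T : Euc n → Euc n} (hTS : ∀ x, T x ∈ closure S)
    (hp : ∀ x, PSD (fderiv ℝ T x)) (j : ℕ) (x : Euc n) : 0 ≤ GJ α S w T j x :=
  add_nonneg (PSD_tr_nonneg (hp x)) (mul_nonneg H.hα.le (H.hS_nonneg (hTS x) j x))

theorem GJ_bdd (H : CW n k α S w) {T : Euc n → Euc n} (hT : BL T) (hTS : ∀ x, T x ∈ closure S) (j : ℕ) :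
    ∃ M : ℝ, ∀ x, |GJ α S w T j x| ≤ M := by
  obtain ⟨K, hK, hb⟩ := hT.norm_fderiv
  refine ⟨n * K + α * j, fun x => (abs_add_le _ _).trans (add_le_add ((abs_tr_le _).trans ?_) ?_)⟩
  · gcongr; exact hb x
  · rw [abs_of_nonneg (mul_nonneg H.hα.le (H.hS_nonneg (hTS x) j x))]
    exact mul_le_mul_of_nonneg_left (min_le_right _ _) H.hα.le

theorem flow (H : CW n k α S w) {E : Set (Euc n)} (hE : Dom S w E) {T : Euc n → Euc n} (hT : BL T)
    (hTS : ∀ x, T x ∈ closure S) (hd : ∀ x, DifferentiableAt ℝ T x) (hT1 : ∀ x, ‖T x‖ ≤ 1)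
    {u : Euc n → ℝ} (hu : BL u) (hu0 : ∀ x, 0 ≤ u x) (j : ℕ) :
    ∫ x in E, u x * GJ α S w T j x ∂(mw S w) ≤ ∫ x, u x * ‖T x‖ ∂(mb S w E) + ∫ x in E, ‖fderiv ℝ u x‖ ∂(mw S w) := by
  obtain ⟨M, hM⟩ := H.GJ_bdd hT hTS j
  obtain ⟨K, hK, hb⟩ := hu.norm_fderiv
  obtain ⟨Mu, hMu⟩ := hu.2
  have hM0 : 0 ≤ M := (abs_nonneg _).trans (hM 0)
  have hb1 : ∀ x, |u x * GJ α S w T j x| ≤ Mu * M := fun x => by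
    rw [abs_mul]; exact mul_le_mul (hMu x) (hM x) (abs_nonneg _) ((norm_nonneg _).trans (hMu 0))
  have hm1 : Measurable (fun x => u x * GJ α S w T j x) := hu.cont.measurable.mul (H.GJ_meas hT.cont hTS j)
  have hm2 : Measurable (fun x => ‖fderiv ℝ u x‖) := (measurable_fderiv ℝ u).norm
  have key := H.wdi hE.op hE.sub hE.vol hE.per (X := fun x => u x • T x) (hu.smul hT)
    (F := fun x => u x * GJ α S w T j x - ‖fderiv ℝ u x‖) (hm1.sub hm2) (MF := Mu * M + K)
    (fun x => (abs_sub _ _).trans (add_le_add (hb1 x) (by rw [abs_norm]; exact hb x))) (c := 0) le_rfl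
    (by
      filter_upwards [d_diff (S := S)] with x hx _
      rw [map_smul, smul_eq_mul, neg_zero, zero_mul]
      exact mul_nonneg (hu0 x) (H.fderiv_d_ge hx (hTS x)))
    (by
      filter_upwards [H.w_diff, hu.ae_diff] with x hx hux hxE
      have hxS := hE.sub hxE
      have hw0 := H.w_pos hxS
      rw [dv_smul hux (hd x), map_smul, smul_eq_mul]
      have h1 := H.fderiv_w_ge hxS (hx hxS) (hTS x)
      have h2 : min (hh α w (T x) / (wS S w x ^ (1 / α))) j ≤ hh α w (T x) / hh α w x := by
        rw [wS_eq hxS]; exact min_le_left _ _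
      have h3 : - ‖fderiv ℝ u x‖ ≤ fderiv ℝ u x (T x) := by
        have h4 : |fderiv ℝ u x (T x)| ≤ ‖fderiv ℝ u x‖ :=
          ((fderiv ℝ u x).le_opNorm _).trans (mul_le_of_le_one_right (norm_nonneg _) (hT1 x))
        exact neg_le_of_abs_le h4
      have h5 : α * w x * min (hh α w (T x) / (wS S w x ^ (1 / α))) j ≤ fderiv ℝ w x (T x) :=
        (mul_le_mul_of_nonneg_left h2 (mul_nonneg H.hα.le hw0.le)).trans h1
      have h6 := mul_le_mul_of_nonneg_left h5 (hu0 x)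
      have h7 := mul_le_mul_of_nonneg_left h3 hw0.le
      unfold GJ
      nlinarith)
  rw [integral_sub (hE.intE hm1 hb1) (hu.intb_norm_fderiv hE)] at key
  have e : ∫ x, ‖u x • T x‖ ∂(mb S w E) = ∫ x, u x * ‖T x‖ ∂(mb S w E) := by
    congr 1; ext x; rw [norm_smul, Real.norm_of_nonneg (hu0 x)]
  rw [e] at key
  linarith

/-- the limit of `GJ` -/
theorem GJ_tendsto (H : CW n k α S w) {Tj : ℕ → Euc n → Euc n} {T : Euc n → Euc n} {A : Euc n → (Euc n →L[ℝ] Euc n)}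
    (hj : ∀ j x, Tj j x ∈ closure S) {x : Euc n} (hx : x ∈ S)
    (h1 : Filter.Tendsto (fun j => Tj j x) Filter.atTop (𝓝 (T x)))
    (h2 : Filter.Tendsto (fun j => fderiv ℝ (Tj j) x) Filter.atTop (𝓝 (A x))) :
    Filter.Tendsto (fun j => GJ α S w (Tj j) j x) Filter.atTop (𝓝 (tr (A x) + α * (hh α w (T x) / hh α w x))) := by
  refine Filter.Tendsto.add ((continuous_tr.tendsto _).comp h2) (Filter.Tendsto.const_mul α ?_)
  have hT : T x ∈ closure S := isClosed_closure.mem_of_tendsto h1 (Filter.Eventually.of_forall fun j => hj j x)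
  have h3 : Filter.Tendsto (fun j => hh α w (Tj j x)) Filter.atTop (𝓝 (hh α w (T x))) :=
    (H.hh_cont _ hT).tendsto.comp (tendsto_nhdsWithin_iff.2 ⟨h1, Filter.Eventually.of_forall fun j => hj j x⟩)
  have h4 : Filter.Tendsto (fun j => hh α w (Tj j x) / hh α w x) Filter.atTop (𝓝 (hh α w (T x) / hh α w x)) :=
    h3.div_const _
  refine h4.congr' ?_
  obtain ⟨N, hN⟩ := exists_nat_gt (hh α w (T x) / hh α w x)
  filter_upwards [h4.eventually_lt_const hN, Filter.eventually_ge_atTop N] with j hj1 hj2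
  rw [wS_eq hx, min_eq_left]
  · rfl
  · exact hj1.le.trans (by exact_mod_cast hj2)

end CW
end PartP

section PartQ
theorem fatou_int {Ω : Type*} [MeasurableSpace Ω] {μ : Measure Ω} {f : ℕ → Ω → ℝ} {g : Ω → ℝ}
    (hi : ∀ j, Integrable (f j) μ) (h0 : ∀ j, ∀ᵐ x ∂μ, 0 ≤ f j x)
    (ht : ∀ᵐ x ∂μ, Filter.Tendsto (fun j => f j x) Filter.atTop (𝓝 (g x))) {C : ℝ}
    (hC : ∃ᶠ j in Filter.atTop, ∫ x, f j x ∂μ ≤ C) : Integrable g μ ∧ ∫ x, g x ∂μ ≤ C := by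
  have hgm : AEStronglyMeasurable g μ := aestronglyMeasurable_of_tendsto_ae Filter.atTop (fun j => (hi j).1) ht
  have hg0 : ∀ᵐ x ∂μ, 0 ≤ g x := by
    filter_upwards [ht, ae_all_iff.2 h0] with x h1 h2 using ge_of_tendsto' h1 h2
  have hC0 : 0 ≤ C := by
    obtain ⟨j, hj⟩ := hC.exists
    exact (integral_nonneg_of_ae (h0 j)).trans hj
  have key : ∫⁻ x, ENNReal.ofReal (g x) ∂μ ≤ ENNReal.ofReal C := by
    calc _ = ∫⁻ x, Filter.liminf (fun j => ENNReal.ofReal (f j x)) Filter.atTop ∂μ := by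
          refine lintegral_congr_ae ?_
          filter_upwards [ht] with x hx
          exact ((ENNReal.continuous_ofReal.tendsto _).comp hx).liminf_eq.symm
      _ ≤ Filter.liminf (fun j => ∫⁻ x, ENNReal.ofReal (f j x) ∂μ) Filter.atTop :=
          lintegral_liminf_le' fun j => (hi j).1.aemeasurable.ennreal_ofReal
      _ ≤ ENNReal.ofReal C := by
          refine Filter.liminf_le_of_frequently_le' (hC.mono fun j hj => ?_)
          rw [← ofReal_integral_eq_lintegral_ofReal (hi j) (h0 j)]
          exact ENNReal.ofReal_le_ofReal hj
  have hgi : Integrable g μ := by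
    refine ⟨hgm, ?_⟩
    rw [hasFiniteIntegral_iff_ofReal hg0]
    exact key.trans_lt ENNReal.ofReal_lt_top
  refine ⟨hgi, ?_⟩
  rw [← ofReal_integral_eq_lintegral_ofReal hgi hg0] at key
  exact (ENNReal.ofReal_le_ofReal_iff hC0).1 key

namespace CW
variable {n k : ℕ} {α : ℝ} {S : Set (Euc n)} {w : Euc n → ℝ}

theorem aeE {E : Set (Euc n)} {p : Euc n → Prop} (h : ∀ᵐ x, p x) : ∀ᵐ x ∂((mw S w).restrict E), p x :=
  ((Measure.restrict_le_self.absolutelyContinuous).trans mw_ac) h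

/-- conversion of the Monge-Ampere inequality -/
theorem ma_conv (H : CW n k α S w) {x y : Euc n} {s d : ℝ} (hx : x ∈ S) (hy : y ∈ S) (h : s * w x ≤ d * w y) :
    s ≤ d * (hh α w y / hh α w x) ^ α := by
  rw [Real.div_rpow (H.hh_pos hy).le (H.hh_pos hx).le, H.hh_pow (subset_closure hx), H.hh_pow (subset_closure hy),
    mul_div_assoc', le_div_iff₀ (H.w_pos hx)]
  exact h

theorem star_bdd (H : CW n k α S w) {E : Set (Euc n)} (hE : Dom S w E) {Hs : Set (Euc n)} (hm : MeasurableSet Hs)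
    (hsub : Hs ⊆ E) {R : ℝ≥0} (hR : Hs ⊆ closedBall 0 R) (hpos : 0 < mw S w Hs)
    {u : Euc n → ℝ} (hu : BL u) (hu0 : ∀ x, 0 ≤ u x) :
    (n + α) * ((mw S w (ball 0 1)).toReal / (mw S w Hs).toReal) ^ (1 / (n + α)) * ∫ x in Hs, u x ∂(mw S w) ≤
      ∫ x in E, ‖fderiv ℝ u x‖ ∂(mw S w) + ∫ x, u x ∂(mb S w E) := by
  obtain ⟨T, A, Tj, -, -, hjK, hjB, hjd, hjp, ht1, ht2, hMA, -⟩ := H.transport hm hR hpos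
  have hjS : ∀ j x, Tj j x ∈ closure S := fun j x => KK_cl (hjK j x)
  have hj1 : ∀ j x, ‖Tj j x‖ ≤ 1 := fun j x => mem_closedBall_zero_iff.1 (KK_sub (hjK j x))
  set s := (mw S w (ball 0 1)).toReal / (mw S w Hs).toReal with hs
  have hHt : mw S w Hs < ⊤ := (measure_mono hsub).trans_lt hE.vol
  have hsp : 0 < s := div_pos H.kappa_pos (ENNReal.toReal_pos hpos.ne' hHt.ne)
  obtain ⟨Mu, hMu⟩ := hu.2
  have hinteg : ∀ j, IntegrableOn (fun x => u x * GJ α S w (Tj j) j x) E (mw S w) := fun j => by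
    obtain ⟨M, hM⟩ := H.GJ_bdd (hjB j) (hjS j) j
    refine hE.intE (hu.cont.measurable.mul (H.GJ_meas (hjB j).cont (hjS j) j)) (M := Mu * M) fun x => ?_
    rw [abs_mul]; exact mul_le_mul (hMu x) (hM x) (abs_nonneg _) ((norm_nonneg _).trans (hMu 0))
  have hF := fatou_int (μ := (mw S w).restrict E) (g := fun x => u x * (tr (A x) + α * (hh α w (T x) / hh α w x)))
    (C := ∫ x in E, ‖fderiv ℝ u x‖ ∂(mw S w) + ∫ x, u x ∂(mb S w E)) hinteg
    (fun j => ae_of_all _ fun x => mul_nonneg (hu0 x) (H.GJ_nonneg (hjS j) (hjp j) j x))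
    (by
      filter_upwards [aeE ht1, aeE ht2, ae_restrict_mem hE.op.measurableSet] with x h1 h2 h3
      exact (H.GJ_tendsto hjS (hE.sub h3) h1 h2.1).const_mul _)
    (Filter.Frequently.of_forall fun j => by
      refine (H.flow hE (hjB j) (hjS j) (hjd j) (hj1 j) hu hu0 j).trans ?_
      rw [add_comm]
      refine add_le_add le_rfl ?_
      refine integral_mono (norm_intble_mb hE.per (hu.mul (hjB j).norm)) (norm_intble_mb hE.per hu) fun x => ?_
      exact mul_le_of_le_one_right (hu0 x) (hj1 j x))
  refine le_trans ?_ hF.2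
  rw [← integral_const_mul]
  refine le_trans ?_ (setIntegral_mono_set hF.1 ?_ (HasSubset.Subset.eventuallyLE hsub))
  · refine setIntegral_mono_ae_restrict ?_ (IntegrableOn.mono_set hF.1 hsub) ?_
    · exact IntegrableOn.mono_set (Integrable.const_mul (hE.intE hu.cont.measurable hMu) _) hsub
    · filter_upwards [hMA, aeE ht2, ae_restrict_mem hm] with x h1 h2 h3
      have hxS := hE.sub (hsub h3)
      have := tr_ge h2.2 H.hα hsp (div_pos (H.hh_pos h1.1) (H.hh_pos hxS)) (H.ma_conv hxS h1.1 h1.2)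
      rw [mul_comm]
      exact mul_le_mul_of_nonneg_left this (hu0 x)
  · filter_upwards [aeE ht1, aeE ht2, ae_restrict_mem hE.op.measurableSet] with x h1 h2 h3
    have hT : T x ∈ closure S := isClosed_closure.mem_of_tendsto h1 (Filter.Eventually.of_forall fun j => hjS j x)
    have hx := H.hh_pos (hE.sub h3)
    exact mul_nonneg (hu0 x) (add_nonneg (PSD_tr_nonneg h2.2) (mul_nonneg H.hα.le (div_nonneg (H.hh_nonneg hT) hx.le)))

theorem star (H : CW n k α S w) {E : Set (Euc n)} (hE : Dom S w E) {Hs : Set (Euc n)} (hm : MeasurableSet Hs)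
    (hsub : Hs ⊆ E) {u : Euc n → ℝ} (hu : BL u) (hu0 : ∀ x, 0 ≤ u x) :
    (n + α) * ((mw S w (ball 0 1)).toReal / (mw S w Hs).toReal) ^ (1 / (n + α)) * ∫ x in Hs, u x ∂(mw S w) ≤
      ∫ x in E, ‖fderiv ℝ u x‖ ∂(mw S w) + ∫ x, u x ∂(mb S w E) := by
  have hα := H.hα
  have hD : (0:ℝ) < n + α := by positivity
  have hHt : mw S w Hs < ⊤ := (measure_mono hsub).trans_lt hE.vol
  have hrhs : 0 ≤ ∫ x in E, ‖fderiv ℝ u x‖ ∂(mw S w) + ∫ x, u x ∂(mb S w E) :=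
    add_nonneg (integral_nonneg fun x => norm_nonneg _) (integral_nonneg hu0)
  obtain ⟨Mu, hMu⟩ := hu.2
  have hui : IntegrableOn u E (mw S w) := hE.intE hu.cont.measurable hMu
  have hU : (⋃ j : ℕ, Hs ∩ closedBall 0 j) = Hs := by
    rw [← inter_iUnion]
    refine inter_eq_left.2 fun x _ => mem_iUnion.2 ?_
    obtain ⟨j, hj⟩ := exists_nat_ge ‖x‖
    exact ⟨j, mem_closedBall_zero_iff.2 hj⟩
  have hlim : Filter.Tendsto (fun j : ℕ => ∫ x in Hs ∩ closedBall 0 (j:ℝ), u x ∂(mw S w)) Filter.atTop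
      (𝓝 (∫ x in Hs, u x ∂(mw S w))) := by
    have := tendsto_setIntegral_of_monotone (μ := mw S w) (f := u) (s := fun j : ℕ => Hs ∩ closedBall 0 (j:ℝ))
      (fun j => hm.inter measurableSet_closedBall)
      (fun i j hij => inter_subset_inter_right _ (closedBall_subset_closedBall (by exact_mod_cast hij)))
      (by rw [hU]; exact hui.mono_set hsub)
    rwa [hU] at this
  refine le_of_tendsto' (hlim.const_mul _) fun j => ?_
  rcases (zero_le (a := mw S w (Hs ∩ closedBall 0 (j:ℝ)))).eq_or_lt with h0 | h0
  · rw [setIntegral_measure_zero _ h0.symm, mul_zero]; exact hrhs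
  · refine le_trans ?_ (H.star_bdd hE (hm.inter measurableSet_closedBall) (inter_subset_left.trans hsub) (R := j)
      (by simpa using inter_subset_right) h0 hu hu0)
    refine mul_le_mul_of_nonneg_right (mul_le_mul_of_nonneg_left ?_ hD.le) (integral_nonneg hu0)
    refine Real.rpow_le_rpow (div_nonneg ENNReal.toReal_nonneg ENNReal.toReal_nonneg) ?_ (by positivity)
    refine div_le_div_of_nonneg_left ENNReal.toReal_nonneg (ENNReal.toReal_pos h0.ne' ((measure_mono inter_subset_left).trans_lt hHt).ne) ?_
    exact ENNReal.toReal_mono hHt.ne (measure_mono inter_subset_left)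

end CW
end PartQ

section PartR
namespace CW
variable {n k : ℕ} {α : ℝ} {S : Set (Euc n)} {w : Euc n → ℝ}

theorem exhaust {E : Set (Euc n)} (hE : Dom S w E) {ε : ℝ} (hε : 0 < ε) :
    ∃ R : ℕ, (mw S w E).toReal - ε < (mw S w (E ∩ closedBall 0 (R:ℝ))).toReal := by
  have hU : (⋃ j : ℕ, E ∩ closedBall 0 (j:ℝ)) = E := by
    rw [← inter_iUnion]
    refine inter_eq_left.2 fun x _ => mem_iUnion.2 ?_
    obtain ⟨j, hj⟩ := exists_nat_ge ‖x‖
    exact ⟨j, mem_closedBall_zero_iff.2 hj⟩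
  have h1 := tendsto_measure_iUnion_atTop (μ := mw S w) (s := fun j : ℕ => E ∩ closedBall 0 (j:ℝ))
    (fun i j hij => inter_subset_inter_right _ (closedBall_subset_closedBall (by exact_mod_cast hij)))
  rw [hU] at h1
  have h2 := (ENNReal.tendsto_toReal hE.vol.ne).comp h1
  exact (h2.eventually_const_lt (show (mw S w E).toReal - ε < _ by linarith)).exists

theorem norm_id_le' : ‖ContinuousLinearMap.id ℝ (Euc n)‖ ≤ 1 := ContinuousLinearMap.norm_id_le

set_option maxHeartbeats 1000000 in
theorem coupling (H : CW n k α S w) : ∃ C : ℝ, 0 < C ∧ ∀ E, Dom S w E → (mw S w E).toReal = (mw S w (ball 0 1)).toReal →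
    ∀ δ : ℝ, 0 < δ → δ ≤ 1 → (mb S w E univ).toReal ≤ (n + α) * (mw S w (ball 0 1)).toReal * (1 + δ) →
    ∃ X : Euc n → Euc n, BL X ∧ (∀ x, DifferentiableAt ℝ X x) ∧ (∀ x, X x ∈ KK S) ∧
      ∫ x in E, ‖fderiv ℝ X x - ContinuousLinearMap.id ℝ (Euc n)‖ ∂(mw S w) ≤ C * √δ ∧
      ∫ x, (1 - ‖X x‖) ∂(mb S w E) ≤ C * δ ∧
      ∀ (Ψ : Euc n → ℝ) (L : ℝ), 0 ≤ L → (∀ x y, |Ψ x - Ψ y| ≤ L * ‖x - y‖) → (∀ x, |Ψ x| ≤ L) →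
        |∫ x in E, Ψ (X x) ∂(mw S w) - ∫ x in ball 0 1, Ψ x ∂(mw S w)| ≤ C * L * √δ := by
  have hα := H.hα
  have hn1 : (1:ℝ) ≤ n := by exact_mod_cast H.npos
  set κ := (mw S w (ball 0 1)).toReal with hκ
  have hκ0 : 0 < κ := H.kappa_pos
  set D : ℝ := n + α with hDdef
  have hD : 0 < D := by positivity
  refine ⟨(4 * n * D + n + 1) * κ + 4 * D * κ + 3 * D * κ + 1 + 2 * κ, by positivity, fun E hE hEκ δ hδ hδ1 hper => ?_⟩
  have hsδ : 0 < √δ := Real.sqrt_pos.2 hδ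
  have hsδ2 : √δ * √δ = δ := Real.mul_self_sqrt hδ.le
  have hsδ1 : √δ ≤ 1 := Real.sqrt_le_one.2 hδ1
  have hδs : δ ≤ √δ := by nlinarith
  haveI := hE.fin
  haveI := hE.finb
  obtain ⟨R, hR⟩ := exhaust hE (show 0 < κ * δ / 2 by positivity)
  set Hs := E ∩ closedBall 0 (R:ℝ) with hHs
  have hHm : MeasurableSet Hs := hE.op.measurableSet.inter measurableSet_closedBall
  have hHE : Hs ⊆ E := inter_subset_left
  have hHt : mw S w Hs < ⊤ := (measure_mono hHE).trans_lt hE.vol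
  set m := (mw S w Hs).toReal with hm
  have hm1 : κ - κ * δ / 2 < m := by rw [← hEκ]; rw [← hEκ] at hR; exact hR
  have hm0 : 0 < m := by nlinarith
  have hmκ : m ≤ κ := by rw [← hEκ]; exact ENNReal.toReal_mono hE.vol.ne (measure_mono hHE)
  have hm2 : κ - m ≤ κ * δ := by nlinarith
  have hpos : 0 < mw S w Hs := by
    rw [pos_iff_ne_zero]; intro h; rw [hm, h] at hm0; simp at hm0
  obtain ⟨T, A, Tj, hTm, hTK, hjK, hjB, hjd, hjp, ht1, ht2, hMA, hΨT⟩ := H.transport hHm (R := R)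
    (fun x hx => by simpa using hx.2) hpos
  have hjS : ∀ j x, Tj j x ∈ closure S := fun j x => KK_cl (hjK j x)
  have hj1 : ∀ j x, ‖Tj j x‖ ≤ 1 := fun j x => mem_closedBall_zero_iff.1 (KK_sub (hjK j x))
  have hT1 : ∀ x, ‖T x‖ ≤ 1 := fun x => mem_closedBall_zero_iff.1 (KK_sub (hTK x))
  rw [← hκ, ← hm] at hMA hΨT
  set s := κ / m with hs
  have hs1 : 1 ≤ s := by rw [hs, le_div_iff₀ hm0]; linarith
  set μE := (mw S w).restrict E with hμE
  have hHmeas : μE.restrict Hs = (mw S w).restrict Hs := by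
    rw [hμE, Measure.restrict_restrict hHm, inter_eq_left.2 hHE]
  set G : Euc n → ℝ := fun x => tr (A x) + α * (hh α w (T x) / hh α w x) with hG
  have hGt : ∀ᵐ x ∂μE, Filter.Tendsto (fun j => GJ α S w (Tj j) j x) Filter.atTop (𝓝 (G x)) := by
    filter_upwards [aeE ht1, aeE ht2, ae_restrict_mem hE.op.measurableSet] with x h1 h2 h3
    exact H.GJ_tendsto hjS (hE.sub h3) h1 h2.1
  have hGJi : ∀ j, Integrable (fun x => GJ α S w (Tj j) j x) μE := fun j => by
    obtain ⟨M, hM⟩ := H.GJ_bdd (hjB j) (hjS j) j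
    exact hE.intE (H.GJ_meas (hjB j).cont (hjS j) j) hM
  have hGJ0 : ∀ j x, 0 ≤ GJ α S w (Tj j) j x := fun j x => H.GJ_nonneg (hjS j) (hjp j) j x
  have hflow : ∀ j, ∫ x, GJ α S w (Tj j) j x ∂μE ≤ ∫ x, ‖Tj j x‖ ∂(mb S w E) := fun j => by
    have := H.flow hE (hjB j) (hjS j) (hjd j) (hj1 j) (BL.const (1:ℝ)) (fun x => zero_le_one) j
    simpa using this
  have hjbi : ∀ j, Integrable (fun x => ‖Tj j x‖) (mb S w E) := fun j => norm_intble_mb hE.per (hjB j).norm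
  have hone : ∫ x, (1:ℝ) ∂(mb S w E) = (mb S w E univ).toReal := by simp [Measure.real]
  have hP : ∀ j, ∫ x, GJ α S w (Tj j) j x ∂μE ≤ D * κ * (1 + δ) := fun j => by
    refine (hflow j).trans (le_trans ?_ hper)
    rw [← hone]
    exact integral_mono (hjbi j) (integrable_const _) (hj1 j)
  obtain ⟨hGi, hGle⟩ := fatou_int hGJi (fun j => ae_of_all _ (hGJ0 j)) hGt (Filter.Frequently.of_forall hP)
  have hG0 : ∀ᵐ x ∂μE, 0 ≤ G x := by
    filter_upwards [hGt] with x hx using ge_of_tendsto' hx fun j => hGJ0 j x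
  have hq : ∀ᵐ x ∂μE, x ∈ Hs → 0 ≤ G x - D ∧ ‖A x - ContinuousLinearMap.id ℝ (Euc n)‖ ≤
      n * (2 * √(G x - D) + (G x - D)) := by
    have h1 : ∀ᵐ x ∂μE, x ∈ Hs → _ := (ae_restrict_iff' hHm).1 (hHmeas ▸ hMA)
    filter_upwards [h1, aeE ht2] with x h1 h2 h3
    have hxS := hE.sub (hHE h3)
    exact norm_sub_id_le h2.2 hα hs1 (div_pos (H.hh_pos (h1 h3).1) (H.hh_pos hxS)) (H.ma_conv hxS (h1 h3).1 (h1 h3).2)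
  have hindi : ∀ c : ℝ, Integrable (Hs.indicator fun _ => c) μE := fun c => (integrable_const c).indicator hHm
  have hindv : ∀ c : ℝ, ∫ x, Hs.indicator (fun _ => c) x ∂μE = m * c := fun c => by
    rw [integral_indicator hHm, hHmeas, setIntegral_const, smul_eq_mul, Measure.real]
  have hGge : D * m ≤ ∫ x, G x ∂μE := by
    rw [mul_comm, ← hindv D]
    refine integral_mono_ae (hindi D) hGi ?_
    filter_upwards [hq, hG0] with x h1 h2
    by_cases h : x ∈ Hs
    · rw [indicator_of_mem h]; have := (h1 h).1; linarith
    · rw [indicator_of_notMem h]; exact h2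
  have hAm : AEStronglyMeasurable A μE := aestronglyMeasurable_of_tendsto_ae Filter.atTop
    (fun j => (measurable_fderiv ℝ (Tj j)).aestronglyMeasurable) ((aeE ht2).mono fun x hx => hx.1)
  have hAG : ∀ᵐ x ∂μE, ‖A x‖ ≤ G x := by
    filter_upwards [aeE ht1, aeE ht2, ae_restrict_mem hE.op.measurableSet] with x h1 h2 h3
    refine (PSD_norm_le h2.2).trans (le_add_of_nonneg_right (mul_nonneg hα.le (div_nonneg (H.hh_nonneg (KK_cl (hTK x))) (H.hh_pos (hE.sub h3)).le)))
  have hAi : Integrable A μE := hGi.mono' hAm hAG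
  have hmE : μE.real univ = κ := by rw [hμE, measureReal_restrict_apply_univ]; exact hEκ
  -- (a1)
  have ha1 : ∫ x, ‖A x - ContinuousLinearMap.id ℝ (Euc n)‖ ∂μE ≤ (4 * n * D + n + 1) * κ * √δ := by
    have hb : ∀ᵐ x ∂μE, ‖A x - ContinuousLinearMap.id ℝ (Euc n)‖ ≤
        (2 * n / √δ) * (G x - Hs.indicator (fun _ => D) x) + (n * √δ + (1 - Hs.indicator (fun _ => 1) x)) := by
      filter_upwards [hq, hG0, hAG] with x h1 h2 h3
      have hinv : 1 ≤ 1 / √δ := by rw [le_div_iff₀ hsδ]; linarith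
      have e : 2 * (n:ℝ) / √δ = n * (2 * (1 / √δ)) := by ring
      by_cases h : x ∈ Hs
      · rw [indicator_of_mem h, indicator_of_mem h, e]
        obtain ⟨hq0, hq1⟩ := h1 h
        set q := G x - D
        have h4 : 2 * √q ≤ q * (1 / √δ) + √δ := by
          have h5 := sq_nonneg (√q - √δ)
          have h6 : √q * √q = q := Real.mul_self_sqrt hq0
          rw [mul_one_div, ← sub_le_iff_le_add, le_div_iff₀ hsδ]
          nlinarith
        refine hq1.trans ?_
        have h7 : q ≤ q * (1 / √δ) := le_mul_of_one_le_right hq0 hinv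
        have h8 : (n:ℝ) * (2 * √q + q) ≤ n * (2 * (q * (1 / √δ)) + √δ) :=
          mul_le_mul_of_nonneg_left (by linarith) (by positivity)
        linarith
      · rw [indicator_of_notMem h, indicator_of_notMem h, e]
        have h4 : ‖A x - ContinuousLinearMap.id ℝ (Euc n)‖ ≤ G x + 1 := (norm_sub_le _ _).trans (add_le_add h3 norm_id_le')
        have h5 : G x ≤ n * (2 * (1 / √δ)) * G x := le_mul_of_one_le_left h2 (by nlinarith)
        have h6 : 0 ≤ (n:ℝ) * √δ := by positivity
        linarith
    have hi1 : Integrable (fun x => (2 * n / √δ) * (G x - Hs.indicator (fun _ => D) x)) μE := (hGi.sub (hindi D)).const_mul _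
    have hi2 : Integrable (fun x => 1 - Hs.indicator (fun _ => (1:ℝ)) x) μE := (integrable_const _).sub (hindi 1)
    have hi3 : Integrable (fun x => n * √δ + (1 - Hs.indicator (fun _ => (1:ℝ)) x)) μE := (integrable_const _).add hi2
    refine (integral_mono_ae (hAi.sub (integrable_const _)).norm (hi1.add hi3) hb).trans ?_
    simp only [Pi.add_apply]
    rw [integral_add hi1 hi3, integral_const_mul, integral_sub hGi (hindi D), integral_add (integrable_const _) hi2,
      integral_sub (integrable_const _) (hindi 1), hindv, hindv, integral_const, integral_const, hmE]
    simp only [smul_eq_mul]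
    have h1 : 2 * n / √δ * (∫ x, G x ∂μE - m * D) ≤ 2 * n / √δ * (2 * D * κ * δ) := by
      gcongr; nlinarith
    have h2 : 2 * n / √δ * (2 * D * κ * δ) = 4 * n * D * κ * √δ := by
      have h9 : δ / √δ = √δ := Real.div_sqrt
      calc _ = 4 * n * D * κ * (δ / √δ) := by ring
        _ = _ := by rw [h9]
    have h3 : κ * 1 - m * 1 ≤ κ * √δ := by nlinarith
    nlinarith
  -- (a2)
  have hnorm : ∀ j, Integrable (fun x => ‖fderiv ℝ (Tj j) x - A x‖) μE := fun j => by
    obtain ⟨K, hK, hb⟩ := (hjB j).norm_fderiv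
    exact ((Integrable.of_bound (measurable_fderiv ℝ (Tj j)).aestronglyMeasurable K (ae_of_all _ hb)).sub hAi).norm
  have ha2 : ∃ᶠ j in Filter.atTop, ∫ x, ‖fderiv ℝ (Tj j) x - A x‖ ∂μE ≤ 4 * D * κ * δ := by
    intro hev
    have hi : ∀ j, Integrable (fun x => GJ α S w (Tj j) j x + G x) μE := fun j => (hGJi j).add hGi
    have := fatou_int (μ := μE) (f := fun j x => GJ α S w (Tj j) j x + G x - ‖fderiv ℝ (Tj j) x - A x‖)
      (g := fun x => G x + G x) (C := D * κ * (1 + δ) + ∫ x, G x ∂μE - 4 * D * κ * δ)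
      (fun j => (hi j).sub (hnorm j)) (fun j => by
        filter_upwards [hAG] with x hx
        have h1 := norm_sub_le (fderiv ℝ (Tj j) x) (A x)
        have h2 : ‖fderiv ℝ (Tj j) x‖ ≤ GJ α S w (Tj j) j x :=
          (PSD_norm_le (hjp j x)).trans (le_add_of_nonneg_right (mul_nonneg hα.le (H.hS_nonneg (hjS j x) j x)))
        linarith) (by
        filter_upwards [hGt, aeE ht2] with x h1 h2
        have h3 : Filter.Tendsto (fun j => ‖fderiv ℝ (Tj j) x - A x‖) Filter.atTop (𝓝 0) := by
          have := (h2.1.sub_const (A x)).norm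
          simpa using this
        simpa using (h1.add_const (G x)).sub h3) (Filter.Eventually.frequently (by
        filter_upwards [hev] with j hj
        rw [integral_sub (hi j) (hnorm j), integral_add (hGJi j) hGi]
        have := hP j
        linarith))
    have h2 := this.2
    rw [integral_add hGi hGi] at h2
    nlinarith [mul_pos (mul_pos hD hκ0) hδ]
  -- (b)
  have hb : ∀ᶠ j in Filter.atTop, D * κ - 2 * D * κ * δ < ∫ x, GJ α S w (Tj j) j x ∂μE := by
    by_contra hcon
    have hfr : ∃ᶠ j in Filter.atTop, ∫ x, GJ α S w (Tj j) j x ∂μE ≤ D * κ - 2 * D * κ * δ := by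
      simpa [Filter.Frequently] using hcon
    have := (fatou_int hGJi (fun j => ae_of_all _ (hGJ0 j)) hGt hfr).2
    nlinarith [mul_pos (mul_pos hD hκ0) hδ]
  -- (c)
  have hTmE : AEStronglyMeasurable T μE := (hTm.mono_ac ((Measure.restrict_le_self.absolutelyContinuous).trans mw_ac)).aestronglyMeasurable
  have hTj_m : ∀ j, AEStronglyMeasurable (Tj j) μE := fun j => (hjB j).cont.aestronglyMeasurable
  have hc1 : Filter.Tendsto (fun j => ∫ x, ‖Tj j x - T x‖ ∂μE) Filter.atTop (𝓝 0) := by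
    have := tendsto_integral_of_dominated_convergence (μ := μE) (F := fun j x => ‖Tj j x - T x‖) (f := fun _ => (0:ℝ))
      (fun _ => (2:ℝ)) (fun j => ((hTj_m j).sub hTmE).norm) (integrable_const _)
      (fun j => ae_of_all _ fun x => by
        rw [norm_norm]; exact (norm_sub_le _ _).trans (by linarith [hj1 j x, hT1 x]))
      (by
        filter_upwards [aeE ht1] with x hx
        have := (hx.sub_const (T x)).norm
        simpa using this)
    simpa using this
  have hc2 := hc1.eventually_lt_const hsδ
  obtain ⟨j, hja, hjb, hjc⟩ := (ha2.and_eventually (hb.and hc2)).exists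
  refine ⟨Tj j, hjB j, hjd j, hjK j, ?_, ?_, ?_⟩
  · have h1 : ∫ x, ‖fderiv ℝ (Tj j) x - ContinuousLinearMap.id ℝ (Euc n)‖ ∂μE ≤
        ∫ x, ‖fderiv ℝ (Tj j) x - A x‖ ∂μE + ∫ x, ‖A x - ContinuousLinearMap.id ℝ (Euc n)‖ ∂μE := by
      have hAIi : Integrable (fun x => ‖A x - ContinuousLinearMap.id ℝ (Euc n)‖) μE := (hAi.sub (integrable_const _)).norm
      rw [← integral_add (hnorm j) hAIi]
      refine integral_mono_of_nonneg (ae_of_all _ fun x => norm_nonneg _)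
        ((hnorm j).add (hAi.sub (integrable_const _)).norm) (ae_of_all _ fun x => ?_)
      exact norm_sub_le_norm_sub_add_norm_sub _ _ _
    refine h1.trans ((add_le_add hja ha1).trans ?_)
    have h2 : 4 * D * κ * δ ≤ 4 * D * κ * √δ := by gcongr
    have h3 : 0 ≤ (3 * D * κ + 1 + 2 * κ) * √δ := by positivity
    nlinarith
  · rw [integral_sub (integrable_const _) (hjbi j), hone]
    have := hflow j
    have h3 : 0 ≤ ((4 * n * D + n + 1) * κ + 4 * D * κ + 1 + 2 * κ) * δ := by positivity
    nlinarith
  · intro Ψ L hL hΨ1 hΨ2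
    have hΨc : Continuous Ψ := by
      refine LipschitzWith.continuous (K := L.toNNReal) (LipschitzWith.of_dist_le_mul fun x y => ?_)
      rw [Real.dist_eq, dist_eq_norm, Real.coe_toNNReal _ hL]; exact hΨ1 x y
    have hi : Integrable (fun x => Ψ (T x)) μE :=
      Integrable.of_bound (hΨc.comp_aestronglyMeasurable hTmE) L (ae_of_all _ fun x => hΨ2 _)
    have hij : Integrable (fun x => Ψ (Tj j x)) μE :=
      Integrable.of_bound (hΨc.comp_aestronglyMeasurable (hTj_m j)) L (ae_of_all _ fun x => hΨ2 _)
    have hTT : Integrable (fun x => ‖Tj j x - T x‖) μE :=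
      Integrable.of_bound ((hTj_m j).sub hTmE).norm 2 (ae_of_all _ fun x => by
        rw [norm_norm]; exact (norm_sub_le _ _).trans (by linarith [hj1 j x, hT1 x]))
    have h1 : |∫ x, Ψ (Tj j x) ∂μE - ∫ x, Ψ (T x) ∂μE| ≤ L * √δ := by
      rw [← integral_sub hij hi]
      refine (abs_integral_le_integral_abs).trans ?_
      calc _ ≤ ∫ x, L * ‖Tj j x - T x‖ ∂μE := integral_mono (hij.sub hi).abs (hTT.const_mul L) fun x => hΨ1 _ _
        _ = L * ∫ x, ‖Tj j x - T x‖ ∂μE := integral_const_mul _ _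
        _ ≤ _ := by gcongr
    have h2 : ∫ x, Ψ (T x) ∂μE - ∫ x in ball 0 1, Ψ x ∂(mw S w) =
        ∫ x, ((1 - Hs.indicator (fun _ => s) x) * Ψ (T x)) ∂μE := by
      rw [← hΨT Ψ hΨc, ← integral_const_mul, ← hHmeas, ← integral_indicator hHm, ← integral_sub hi]
      · congr 1; ext x
        by_cases h : x ∈ Hs
        · rw [indicator_of_mem h, indicator_of_mem h]; ring
        · rw [indicator_of_notMem h, indicator_of_notMem h]; ring
      · exact (hi.const_mul s).indicator hHm
    have h3 : |∫ x, ((1 - Hs.indicator (fun _ => s) x) * Ψ (T x)) ∂μE| ≤ L * (2 * (κ - m)) := by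
      refine (abs_integral_le_integral_abs).trans ?_
      have hb2 : ∀ x, |(1 - Hs.indicator (fun _ => s) x) * Ψ (T x)| ≤ (1 + Hs.indicator (fun _ => s - 2) x) * L := fun x => by
        rw [abs_mul]
        by_cases h : x ∈ Hs
        · rw [indicator_of_mem h, indicator_of_mem h, abs_sub_comm, abs_of_nonneg (by linarith)]
          refine (mul_le_mul_of_nonneg_left (hΨ2 _) (by linarith)).trans (by nlinarith)
        · rw [indicator_of_notMem h, indicator_of_notMem h]; simpa using hΨ2 _
      refine (integral_mono_of_nonneg (ae_of_all _ fun x => abs_nonneg _)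
        (((integrable_const _).add (hindi _)).mul_const L) (ae_of_all _ hb2)).trans ?_
      simp only [Pi.add_apply]
      rw [integral_mul_const, integral_add (integrable_const _) (hindi _), hindv, integral_const, hmE, smul_eq_mul]
      have : m * s = κ := by rw [hs]; field_simp
      nlinarith
    have h4 : |∫ x, Ψ (Tj j x) ∂μE - ∫ x in ball 0 1, Ψ x ∂(mw S w)| ≤ L * √δ + L * (2 * (κ - m)) := by
      rw [← h2] at h3
      have := abs_add_le (∫ x, Ψ (Tj j x) ∂μE - ∫ x, Ψ (T x) ∂μE) (∫ x, Ψ (T x) ∂μE - ∫ x in ball 0 1, Ψ x ∂(mw S w))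
      rw [sub_add_sub_cancel] at this
      linarith
    refine h4.trans ?_
    have h5 : L * (2 * (κ - m)) ≤ L * (2 * (κ * √δ)) := by
      refine mul_le_mul_of_nonneg_left ?_ hL; nlinarith
    have h6 : 0 ≤ ((4 * n * D + n + 1) * κ + 4 * D * κ + 3 * D * κ) * L * √δ := by positivity
    nlinarith

end CW
end PartR

section PartS
theorem exists_median {Ω : Type*} [MeasurableSpace Ω] (μ : Measure Ω) [IsFiniteMeasure μ] {f : Ω → ℝ} (hf : Measurable f) :
    ∃ m : ℝ, μ.real {x | m < f x} ≤ μ.real univ / 2 ∧ μ.real {x | f x < m} ≤ μ.real univ / 2 := by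
  by_cases h0 : μ.real univ = 0
  · refine ⟨0, ?_, ?_⟩ <;> rw [h0] <;> norm_num <;>
    · rw [← h0]; exact measureReal_mono (subset_univ _)
  have hpos : 0 < μ.real univ := lt_of_le_of_ne measureReal_nonneg (Ne.symm h0)
  set a := μ.real univ / 2 with ha
  have ha0 : 0 < a := by positivity
  have ha1 : a < μ.real univ := by rw [ha]; linarith
  have hm1 : ∀ t, MeasurableSet {x | t < f x} := fun t => measurableSet_lt measurable_const hf
  have hm2 : ∀ t, MeasurableSet {x | f x < t} := fun t => measurableSet_lt hf measurable_const
  set Q := {t : ℝ | μ.real {x | t < f x} ≤ a} with hQ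
  have hQne : Q.Nonempty := by
    have h1 := tendsto_measure_iInter_atTop (μ := μ) (s := fun j : ℕ => {x | (j:ℝ) < f x})
      (fun j => (hm1 j).nullMeasurableSet) (fun i j hij x hx => by
        have h9 : (i:ℝ) ≤ j := by exact_mod_cast hij
        simp only [mem_setOf_eq] at hx ⊢
        linarith) ⟨0, measure_ne_top _ _⟩
    have h2 : (⋂ j : ℕ, {x | (j:ℝ) < f x}) = ∅ := by
      ext x; simp only [mem_iInter, mem_setOf_eq, mem_empty_iff_false, iff_false, not_forall, not_lt]
      exact exists_nat_ge (f x)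
    rw [h2, measure_empty] at h1
    have h3 := (ENNReal.tendsto_toReal ENNReal.zero_ne_top).comp h1
    obtain ⟨j, hj⟩ := (h3.eventually_lt_const (show (0:ℝ≥0∞).toReal < a by simpa using ha0)).exists
    exact ⟨j, hj.le⟩
  have hQb : BddBelow Q := by
    have h1 := tendsto_measure_iUnion_atTop (μ := μ) (s := fun j : ℕ => {x | -(j:ℝ) < f x})
      (fun i j hij x hx => by
        have h9 : (i:ℝ) ≤ j := by exact_mod_cast hij
        simp only [mem_setOf_eq] at hx ⊢
        linarith)
    have h2 : (⋃ j : ℕ, {x | -(j:ℝ) < f x}) = univ := by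
      ext x; simp only [mem_iUnion, mem_setOf_eq, mem_univ, iff_true]
      obtain ⟨j, hj⟩ := exists_nat_gt (-f x)
      exact ⟨j, by linarith⟩
    rw [h2] at h1
    have h3 := (ENNReal.tendsto_toReal (measure_ne_top μ univ)).comp h1
    obtain ⟨j, hj⟩ := (h3.eventually_const_lt (show a < _ from ha1)).exists
    refine ⟨-(j:ℝ), fun t ht => ?_⟩
    by_contra hlt
    push Not at hlt
    have h4 : μ.real {x | -(j:ℝ) < f x} ≤ μ.real {x | t < f x} := measureReal_mono (fun x hx => lt_trans hlt hx)
    have h5 : a < μ.real {x | -(j:ℝ) < f x} := hj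
    have h6 : μ.real {x | t < f x} ≤ a := ht
    linarith
  refine ⟨sInf Q, ?_, ?_⟩
  · have h1 := tendsto_measure_iUnion_atTop (μ := μ) (s := fun j : ℕ => {x | sInf Q + 1 / ((j:ℝ) + 1) < f x})
      (fun i j hij x hx => by
        have h9 : (i:ℝ) ≤ j := by exact_mod_cast hij
        simp only [mem_setOf_eq] at hx ⊢
        have h8 : 1 / ((j:ℝ) + 1) ≤ 1 / ((i:ℝ) + 1) := one_div_le_one_div_of_le (by positivity) (by linarith)
        linarith)
    have h2 : (⋃ j : ℕ, {x | sInf Q + 1 / ((j:ℝ) + 1) < f x}) = {x | sInf Q < f x} := by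
      ext x; simp only [mem_iUnion, mem_setOf_eq]
      constructor
      · rintro ⟨j, hj⟩; exact lt_trans (lt_add_of_pos_right _ (by positivity)) hj
      · intro h
        obtain ⟨j, hj⟩ := exists_nat_one_div_lt (sub_pos.2 h)
        exact ⟨j, by linarith⟩
    rw [h2] at h1
    have h3 := (ENNReal.tendsto_toReal (measure_ne_top μ _)).comp h1
    refine le_of_tendsto' h3 fun j => ?_
    obtain ⟨t, ht, htl⟩ := exists_lt_of_csInf_lt hQne (show sInf Q < sInf Q + 1 / ((j:ℝ) + 1) from lt_add_of_pos_right _ (by positivity))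
    exact le_trans (measureReal_mono (fun x hx => lt_trans htl hx)) ht
  · have h1 := tendsto_measure_iUnion_atTop (μ := μ) (s := fun j : ℕ => {x | f x < sInf Q - 1 / ((j:ℝ) + 1)})
      (fun i j hij x hx => by
        have h9 : (i:ℝ) ≤ j := by exact_mod_cast hij
        simp only [mem_setOf_eq] at hx ⊢
        have h8 : 1 / ((j:ℝ) + 1) ≤ 1 / ((i:ℝ) + 1) := one_div_le_one_div_of_le (by positivity) (by linarith)
        linarith)
    have h2 : (⋃ j : ℕ, {x | f x < sInf Q - 1 / ((j:ℝ) + 1)}) = {x | f x < sInf Q} := by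
      ext x; simp only [mem_iUnion, mem_setOf_eq]
      constructor
      · rintro ⟨j, hj⟩; exact lt_trans hj (sub_lt_self _ (by positivity))
      · intro h
        obtain ⟨j, hj⟩ := exists_nat_one_div_lt (sub_pos.2 h)
        exact ⟨j, by linarith⟩
    rw [h2] at h1
    have h3 := (ENNReal.tendsto_toReal (measure_ne_top μ _)).comp h1
    refine le_of_tendsto' h3 fun j => ?_
    set t := sInf Q - 1 / ((j:ℝ) + 1) with ht
    have h4 : t ∉ Q := fun h => by
      have := csInf_le hQb h
      have : 0 < 1 / ((j:ℝ) + 1) := by positivity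
      linarith
    have h5 : a < μ.real {x | t < f x} := by simpa [hQ] using h4
    have h6 : μ.real {x | f x < t} + μ.real {x | t < f x} ≤ μ.real univ := by
      have hdj : Disjoint {x | f x < t} {x | t < f x} := disjoint_left.2 fun x hx hx2 => by
        simp only [mem_setOf_eq] at hx hx2
        exact lt_asymm hx hx2
      rw [← measureReal_union hdj (hm1 t)]
      exact measureReal_mono (subset_univ _)
    show μ.real {x | f x < t} ≤ a
    rw [ha] at h5 ⊢
    linarith

theorem fderiv_comp_le {n : ℕ} {f g : Euc n → ℝ} {x : Euc n} (hf : DifferentiableAt ℝ f x)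
    (hg : ∀ y, |g y - g x| ≤ |f y - f x|) : ‖fderiv ℝ g x‖ ≤ ‖fderiv ℝ f x‖ := by
  by_cases hd : DifferentiableAt ℝ g x
  swap
  · rw [fderiv_zero_of_not_differentiableAt hd, norm_zero]; exact norm_nonneg _
  refine le_of_forall_pos_le_add fun ε hε => ?_
  refine hd.hasFDerivAt.le_of_lip' (by positivity) ?_
  have h1 := (hf.hasFDerivAt.isLittleO.def hε)
  filter_upwards [h1] with y hy
  rw [Real.norm_eq_abs]
  refine (hg y).trans ?_
  have h2 : |f y - f x| ≤ ‖f y - f x - fderiv ℝ f x (y - x)‖ + ‖fderiv ℝ f x (y - x)‖ := by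
    have := norm_add_le (f y - f x - fderiv ℝ f x (y - x)) (fderiv ℝ f x (y - x))
    simpa using this
  have h3 := (fderiv ℝ f x).le_opNorm (y - x)
  linarith

namespace CW
variable {n k : ℕ} {α : ℝ} {S : Set (Euc n)} {w : Euc n → ℝ}

theorem trace (H : CW n k α S w) {E : Set (Euc n)} (hE : Dom S w E) (hκ : (mw S w E).toReal = (mw S w (ball 0 1)).toReal)
    {δ : ℝ} (hper : (mb S w E univ).toReal ≤ (n + α) * (mw S w (ball 0 1)).toReal * (1 + δ))
    {u : Euc n → ℝ} (hu : BL u) (hu0 : ∀ x, 0 ≤ u x) (hu1 : ∀ x, u x ≤ 1) :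
    ∫ x, u x ∂(mb S w E) ≤ ∫ x in E, ‖fderiv ℝ u x‖ ∂(mw S w) + (n + α) * (mw S w (ball 0 1)).toReal * δ +
      (n + α) * ∫ x in E, u x ∂(mw S w) := by
  haveI := hE.fin
  haveI := hE.finb
  have hκ0 := H.kappa_pos
  have hub : ∀ x, |u x| ≤ 1 := fun x => by rw [abs_of_nonneg (hu0 x)]; exact hu1 x
  have h := H.star hE hE.op.measurableSet subset_rfl (u := fun x => 1 - u x) ((BL.const (1:ℝ)).sub hu)
    (fun x => sub_nonneg.2 (hu1 x))
  rw [hκ, div_self hκ0.ne', Real.one_rpow, mul_one, integral_sub (integrable_const _) (hE.intE hu.cont.measurable hub),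
    integral_sub (integrable_const _) (hE.intB hu.cont.measurable hub)] at h
  have e1 : ∀ x, ‖fderiv ℝ (fun x => 1 - u x) x‖ = ‖fderiv ℝ u x‖ := fun x => by
    rw [fderiv_const_sub, norm_neg]
  simp only [e1] at h
  have e2 : ∫ x in E, (1:ℝ) ∂(mw S w) = (mw S w (ball 0 1)).toReal := by rw [← hκ]; simp [Measure.real]
  have e3 : ∫ x, (1:ℝ) ∂(mb S w E) = (mb S w E univ).toReal := by simp [Measure.real]
  rw [e2, e3] at h
  nlinarith

theorem poincare (H : CW n k α S w) {E : Set (Euc n)} (hE : Dom S w E) (hκ : (mw S w E).toReal = (mw S w (ball 0 1)).toReal)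
    {δ : ℝ} (hδ : 0 ≤ δ) (hper : (mb S w E univ).toReal ≤ (n + α) * (mw S w (ball 0 1)).toReal * (1 + δ))
    {u : Euc n → ℝ} (hu : BL u) (hu0 : ∀ x, 0 ≤ u x) (hu1 : ∀ x, u x ≤ 1)
    (hmed : (mw S w (E ∩ {x | 0 < u x})).toReal ≤ (mw S w (ball 0 1)).toReal / 2) :
    (n + α) * (2 ^ (1 / (n + α)) - 1) * ∫ x in E, u x ∂(mw S w) ≤
      2 * ∫ x in E, ‖fderiv ℝ u x‖ ∂(mw S w) + (n + α) * (mw S w (ball 0 1)).toReal * δ := by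
  have hα := H.hα
  have hD : (0:ℝ) < n + α := by positivity
  have hκ0 := H.kappa_pos
  have hm : MeasurableSet (E ∩ {x | 0 < u x}) := hE.op.measurableSet.inter (measurableSet_lt measurable_const hu.cont.measurable)
  have hI0 : 0 ≤ ∫ x in E, ‖fderiv ℝ u x‖ ∂(mw S w) := integral_nonneg fun x => norm_nonneg _
  have he : ∫ x in E, u x ∂(mw S w) = ∫ x in E ∩ {x | 0 < u x}, u x ∂(mw S w) := by
    refine setIntegral_eq_of_subset_of_forall_diff_eq_zero hE.op.measurableSet inter_subset_left fun x hx => ?_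
    by_contra hne
    exact hx.2 ⟨hx.1, lt_of_le_of_ne (hu0 x) (Ne.symm hne)⟩
  by_cases h0 : (mw S w (E ∩ {x | 0 < u x})).toReal = 0
  · have h1 : mw S w (E ∩ {x | 0 < u x}) = 0 := by
      rcases (ENNReal.toReal_eq_zero_iff _).1 h0 with h | h
      · exact h
      · exact absurd h ((measure_mono inter_subset_left).trans_lt hE.vol).ne
    rw [he, setIntegral_measure_zero _ h1, mul_zero]
    positivity
  have hm0 : 0 < (mw S w (E ∩ {x | 0 < u x})).toReal := lt_of_le_of_ne ENNReal.toReal_nonneg (Ne.symm h0)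
  have h1 := H.star hE hm inter_subset_left hu hu0
  have h2 := H.trace hE hκ hper hu hu0 hu1
  rw [← he] at h1
  have h3 : (2:ℝ) ^ (1 / (n + α)) ≤ ((mw S w (ball 0 1)).toReal / (mw S w (E ∩ {x | 0 < u x})).toReal) ^ (1 / (n + α)) := by
    refine Real.rpow_le_rpow (by norm_num) ?_ (by positivity)
    rw [le_div_iff₀ hm0]; linarith
  have h4 : 0 ≤ ∫ x in E, u x ∂(mw S w) := integral_nonneg hu0
  have h5 := mul_le_mul_of_nonneg_right (mul_le_mul_of_nonneg_left h3 hD.le) h4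
  linarith

/-- median inequality for a scalar differentiable Lipschitz function -/
theorem medineq (H : CW n k α S w) : ∃ C : ℝ, 0 < C ∧ ∀ E, Dom S w E → (mw S w E).toReal = (mw S w (ball 0 1)).toReal →
    ∀ δ : ℝ, 0 ≤ δ → (mb S w E univ).toReal ≤ (n + α) * (mw S w (ball 0 1)).toReal * (1 + δ) →
    ∀ f : Euc n → ℝ, (∃ K, LipschitzWith K f) → (∀ x, DifferentiableAt ℝ f x) → ∃ m : ℝ,
      ∫ x in E, min |f x - m| 1 ∂(mw S w) ≤ C * (∫ x in E, ‖fderiv ℝ f x‖ ∂(mw S w) + δ) ∧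
      ∫ x, min |f x - m| 1 ∂(mb S w E) ≤ C * (∫ x in E, ‖fderiv ℝ f x‖ ∂(mw S w) + δ) := by
  have hα := H.hα
  have hn1 : (1:ℝ) ≤ n := by exact_mod_cast H.npos
  set κ := (mw S w (ball 0 1)).toReal with hκ
  have hκ0 : 0 < κ := H.kappa_pos
  set D : ℝ := n + α with hDdef
  have hD : 0 < D := by positivity
  set θ := D * ((2:ℝ) ^ (1 / D) - 1) with hθ
  have hθ0 : 0 < θ := mul_pos hD (sub_pos.2 (Real.one_lt_rpow (by norm_num) (by positivity)))
  set C1 := (2 + D * κ) / θ with hC1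
  have hC10 : 0 < C1 := by positivity
  refine ⟨2 * C1 + 2 * (1 + D * κ + D * C1), by positivity, fun E hE hEκ δ hδ hper f hfL hfd => ?_⟩
  haveI := hE.fin
  haveI := hE.finb
  obtain ⟨K, hK⟩ := hfL
  obtain ⟨m, hm1, hm2⟩ := exists_median ((mw S w).restrict E) hK.continuous.measurable
  have hun : ((mw S w).restrict E).real univ = κ := by rw [measureReal_restrict_apply_univ]; exact hEκ
  rw [hun] at hm1 hm2
  set I := ∫ x in E, ‖fderiv ℝ f x‖ ∂(mw S w) with hI
  have hI0 : 0 ≤ I := integral_nonneg fun x => norm_nonneg _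
  have hfi : IntegrableOn (fun x => ‖fderiv ℝ f x‖) E (mw S w) :=
    hE.intE (measurable_fderiv ℝ f).norm (M := K) fun x => by
      rw [abs_norm]; exact norm_fderiv_le_of_lipschitz ℝ hK
  have key : ∀ φ : ℝ → ℝ, (∀ s t, |φ s - φ t| ≤ |s - t|) → (∀ s, 0 ≤ φ s) → (∀ s, φ s ≤ 1) →
      ((mw S w).restrict E).real {x | 0 < φ (f x)} ≤ κ / 2 → BL (fun x => φ (f x)) ∧
      ∫ x in E, φ (f x) ∂(mw S w) ≤ C1 * (I + δ) ∧
      ∫ x, φ (f x) ∂(mb S w E) ≤ (1 + D * κ + D * C1) * (I + δ) := by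
    intro φ h1 h2 h3 h4
    have hB : BL (fun x => φ (f x)) := by
      refine BL.of_dist (K := K) (M := 1) (fun x y => ?_) (fun x => ?_)
      · rw [Real.dist_eq]; exact (h1 _ _).trans (by simpa [Real.dist_eq] using hK.dist_le_mul x y)
      · rw [Real.norm_eq_abs, abs_of_nonneg (h2 _)]; exact h3 _
    have hgr : ∫ x in E, ‖fderiv ℝ (fun x => φ (f x)) x‖ ∂(mw S w) ≤ I :=
      integral_mono_of_nonneg (ae_of_all _ fun x => norm_nonneg _) hfi
        (ae_of_all _ fun x => fderiv_comp_le (hfd x) fun y => h1 _ _)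
    have hms : MeasurableSet {x | 0 < φ (f x)} := measurableSet_lt measurable_const hB.cont.measurable
    have hp := H.poincare hE hEκ hδ hper hB (fun x => h2 _) (fun x => h3 _) (by
      rw [measureReal_restrict_apply hms, inter_comm] at h4; exact h4)
    have ht := H.trace hE hEκ hper hB (fun x => h2 _) (fun x => h3 _)
    have hp' : ∫ x in E, φ (f x) ∂(mw S w) ≤ C1 * (I + δ) := by
      rw [hC1, div_mul_eq_mul_div, le_div_iff₀ hθ0, mul_comm]
      refine hp.trans ?_
      nlinarith [mul_nonneg (mul_pos hD hκ0).le hI0]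
    refine ⟨hB, hp', ?_⟩
    nlinarith [mul_nonneg (mul_pos hD hκ0).le hI0, mul_le_mul_of_nonneg_left hp' hD.le]
  obtain ⟨b1, p1, q1⟩ := key (fun s => min (max (s - m) 0) 1)
    (fun s t => by
      refine (abs_min_sub_min_le_max _ _ _ _).trans ?_
      rw [sub_self, abs_zero, max_eq_left (abs_nonneg _)]
      refine (abs_max_sub_max_le_max _ _ _ _).trans ?_
      simp)
    (fun s => le_min (le_max_right _ _) zero_le_one) (fun s => min_le_right _ _)
    (by convert hm1 using 3; ext x; simp)
  obtain ⟨b2, p2, q2⟩ := key (fun s => min (max (m - s) 0) 1)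
    (fun s t => by
      refine (abs_min_sub_min_le_max _ _ _ _).trans ?_
      rw [sub_self, abs_zero, max_eq_left (abs_nonneg _)]
      refine (abs_max_sub_max_le_max _ _ _ _).trans ?_
      simp [abs_sub_comm])
    (fun s => le_min (le_max_right _ _) zero_le_one) (fun s => min_le_right _ _)
    (by convert hm2 using 3; ext x; simp)
  have e : ∀ x, min |f x - m| 1 = min (max (f x - m) 0) 1 + min (max (m - f x) 0) 1 := fun x => by
    rcases le_total (f x) m with h | h
    · rw [max_eq_right (sub_nonpos.2 h), max_eq_left (sub_nonneg.2 h), abs_of_nonpos (sub_nonpos.2 h)]; simp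
    · rw [max_eq_left (sub_nonneg.2 h), max_eq_right (sub_nonpos.2 h), abs_of_nonneg (sub_nonneg.2 h)]; simp
  obtain ⟨-, M1, -, -, -, hM1⟩ := b1.bd
  obtain ⟨-, M2, -, -, -, hM2⟩ := b2.bd
  refine ⟨m, ?_, ?_⟩
  · simp only [e]
    rw [integral_add (hE.intE b1.cont.measurable hM1) (hE.intE b2.cont.measurable hM2)]
    have : 0 ≤ (2 * (1 + D * κ + D * C1)) * (I + δ) := by positivity
    linarith
  · simp only [e]
    rw [integral_add (hE.intB b1.cont.measurable hM1) (hE.intB b2.cont.measurable hM2)]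
    have : 0 ≤ 2 * C1 * (I + δ) := by positivity
    linarith

end CW
end PartS

section PartT
theorem norm_le_sum_abs {n : ℕ} (v : Euc n) : ‖v‖ ≤ ∑ i, |v i| := by
  conv_lhs => rw [← sum_single v]
  refine (norm_sum_le _ _).trans (Finset.sum_le_sum fun i _ => ?_)
  rw [norm_smul]; simp

theorem min_norm_le_sum {n : ℕ} (v : Euc n) : min ‖v‖ 1 ≤ ∑ i, min |v i| 1 := by
  by_cases h : ∃ i, 1 ≤ |v i|
  · obtain ⟨i, hi⟩ := h
    refine (min_le_right _ _).trans ?_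
    have := Finset.single_le_sum (f := fun i => min |v i| 1) (fun j _ => le_min (abs_nonneg _) zero_le_one) (Finset.mem_univ i)
    simpa [min_eq_right hi] using this
  · push Not at h
    refine (min_le_left _ _).trans ((norm_le_sum_abs v).trans (le_of_eq ?_))
    exact Finset.sum_congr rfl fun i _ => (min_eq_left (h i).le).symm

namespace CW
variable {n k : ℕ} {α : ℝ} {S : Set (Euc n)} {w : Euc n → ℝ}

set_option maxHeartbeats 1000000 in
theorem shift (H : CW n k α S w) : ∃ C : ℝ, 0 < C ∧ ∀ E, Dom S w E → (mw S w E).toReal = (mw S w (ball 0 1)).toReal →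
    ∀ δ : ℝ, 0 < δ → δ ≤ 1 → (mb S w E univ).toReal ≤ (n + α) * (mw S w (ball 0 1)).toReal * (1 + δ) →
    ∃ c : Euc n, ∫ x, min |‖x - c‖ - 1| 1 ∂(mb S w E) ≤ C * √δ ∧
      ∀ (Ψ : Euc n → ℝ) (L : ℝ), 0 ≤ L → (∀ x y, |Ψ x - Ψ y| ≤ L * ‖x - y‖) → (∀ x, |Ψ x| ≤ L) →
        |∫ x in E, Ψ (x - c) ∂(mw S w) - ∫ x in ball 0 1, Ψ x ∂(mw S w)| ≤ C * L * √δ := by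
  obtain ⟨C1, hC1, hcoup⟩ := H.coupling
  obtain ⟨C2, hC2, hmed⟩ := H.medineq
  have hn1 : (1:ℝ) ≤ n := by exact_mod_cast H.npos
  refine ⟨2 * (n * (C2 * (C1 + 1))) + C1, by positivity, fun E hE hEκ δ hδ hδ1 hper => ?_⟩
  obtain ⟨X, hXB, hXd, hXK, ha, hb, hc⟩ := hcoup E hE hEκ δ hδ hδ1 hper
  haveI := hE.fin
  haveI := hE.finb
  have hsδ : 0 < √δ := Real.sqrt_pos.2 hδ
  have hsδ2 : √δ * √δ = δ := Real.mul_self_sqrt hδ.le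
  have hsδ1 : √δ ≤ 1 := Real.sqrt_le_one.2 hδ1
  have hδs : δ ≤ √δ := by nlinarith
  have hX1 : ∀ x, ‖X x‖ ≤ 1 := fun x => mem_closedBall_zero_iff.1 (KK_sub (hXK x))
  have hLX : ∃ K, LipschitzWith K (fun x => X x - x) := by
    obtain ⟨K, hK⟩ := hXB.1
    exact ⟨K + 1, hK.sub LipschitzWith.id⟩
  have hdX : ∀ x, HasFDerivAt (fun x => X x - x) (fderiv ℝ X x - ContinuousLinearMap.id ℝ (Euc n)) x := fun x =>
    (hXd x).hasFDerivAt.sub (hasFDerivAt_id x)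
  have hIi : IntegrableOn (fun x => ‖fderiv ℝ X x - ContinuousLinearMap.id ℝ (Euc n)‖) E (mw S w) := by
    obtain ⟨K, hK, hbd⟩ := hXB.norm_fderiv
    refine hE.intE (((measurable_fderiv ℝ X).sub measurable_const).norm) (M := K + 1) fun x => ?_
    rw [abs_norm]; exact (norm_sub_le _ _).trans (add_le_add (hbd x) norm_id_le')
  have hcomp : ∀ i : Fin n, ∃ m : ℝ,
      ∫ x in E, min |(X x - x) i - m| 1 ∂(mw S w) ≤ C2 * (C1 + 1) * √δ ∧
      ∫ x, min |(X x - x) i - m| 1 ∂(mb S w E) ≤ C2 * (C1 + 1) * √δ := by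
    intro i
    have hd : ∀ x, HasFDerivAt (fun x => (X x - x) i) ((EuclideanSpace.proj i : Euc n →L[ℝ] ℝ).comp
        (fderiv ℝ X x - ContinuousLinearMap.id ℝ (Euc n))) x := fun x =>
      (EuclideanSpace.proj i : Euc n →L[ℝ] ℝ).hasFDerivAt.comp x (hdX x)
    obtain ⟨K, hK⟩ := hLX
    obtain ⟨m, h1, h2⟩ := hmed E hE hEκ δ hδ.le hper (fun x => (X x - x) i)
      ⟨_, (EuclideanSpace.proj i : Euc n →L[ℝ] ℝ).lipschitz.comp hK⟩ (fun x => (hd x).differentiableAt)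
    have h3 : ∫ x in E, ‖fderiv ℝ (fun x => (X x - x) i) x‖ ∂(mw S w) ≤ C1 * √δ := by
      refine le_trans (integral_mono_of_nonneg (ae_of_all _ fun x => norm_nonneg _) hIi (ae_of_all _ fun x => ?_)) ha
      simp only
      rw [(hd x).fderiv]
      refine ContinuousLinearMap.opNorm_le_bound _ (norm_nonneg _) fun v => ?_
      have h5 := abs_coord_le ((fderiv ℝ X x - ContinuousLinearMap.id ℝ (Euc n)) v) i
      exact h5.trans ((fderiv ℝ X x - ContinuousLinearMap.id ℝ (Euc n)).le_opNorm v)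
    have h4 : C2 * (∫ x in E, ‖fderiv ℝ (fun x => (X x - x) i) x‖ ∂(mw S w) + δ) ≤ C2 * (C1 + 1) * √δ := by
      rw [mul_assoc]; exact mul_le_mul_of_nonneg_left (by linarith) hC2.le
    exact ⟨m, h1.trans h4, h2.trans h4⟩
  choose m hm1 hm2 using hcomp
  set c : Euc n := - WithLp.toLp 2 m with hcdef
  set Z : Euc n → ℝ := fun x => min ‖X x - (x - c)‖ 1 with hZ
  have hco : ∀ x i, (X x - (x - c)) i = (X x - x) i - m i := fun x i => by simp [hcdef]; ring
  have hZle : ∀ x, Z x ≤ ∑ i, min |(X x - x) i - m i| 1 := fun x => by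
    refine (min_norm_le_sum _).trans (le_of_eq (Finset.sum_congr rfl fun i _ => by rw [hco]))
  have hXc := hXB.cont
  have hZc : Continuous Z := by fun_prop
  have hZ0 : ∀ x, 0 ≤ Z x := fun x => le_min (norm_nonneg _) zero_le_one
  have hZb : ∀ x, |Z x| ≤ 1 := fun x => by rw [abs_of_nonneg (hZ0 x)]; exact min_le_right _ _
  have hsc : ∀ i, Continuous (fun x => min |(X x - x) i - m i| 1) := fun i => by fun_prop
  have hsb : ∀ i x, |(fun x => min |(X x - x) i - m i| 1) x| ≤ 1 := fun i x => by
    simp only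
    rw [abs_of_nonneg (le_min (abs_nonneg _) zero_le_one)]; exact min_le_right _ _
  have hZE : ∫ x in E, Z x ∂(mw S w) ≤ n * (C2 * (C1 + 1)) * √δ := by
    refine (integral_mono (hE.intE hZc.measurable hZb) (integrable_finsetSum _ fun i _ => hE.intE (hsc i).measurable (hsb i)) hZle).trans ?_
    rw [integral_finsetSum _ fun i _ => hE.intE (hsc i).measurable (hsb i)]
    refine (Finset.sum_le_sum fun i _ => hm1 i).trans (le_of_eq ?_)
    simp; ring
  have hZB : ∫ x, Z x ∂(mb S w E) ≤ n * (C2 * (C1 + 1)) * √δ := by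
    refine (integral_mono (hE.intB hZc.measurable hZb) (integrable_finsetSum _ fun i _ => hE.intB (hsc i).measurable (hsb i)) hZle).trans ?_
    rw [integral_finsetSum _ fun i _ => hE.intB (hsc i).measurable (hsb i)]
    refine (Finset.sum_le_sum fun i _ => hm2 i).trans (le_of_eq ?_)
    simp; ring
  have hpos : 0 ≤ n * (C2 * (C1 + 1)) * √δ := by positivity
  refine ⟨c, ?_, ?_⟩
  · have hi2 : Integrable (fun x => 1 - ‖X x‖) (mb S w E) :=
      (integrable_const _).sub (norm_intble_mb hE.per hXB.norm)
    have hi1 : Integrable Z (mb S w E) := hE.intB hZc.measurable hZb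
    have h1 : ∫ x, min |‖x - c‖ - 1| 1 ∂(mb S w E) ≤ ∫ x, (Z x + (1 - ‖X x‖)) ∂(mb S w E) := by
      refine integral_mono_of_nonneg (ae_of_all _ fun x => le_min (abs_nonneg _) zero_le_one) (hi1.add hi2) (ae_of_all _ fun x => ?_)
      simp only [hZ]
      have h2 := hX1 x
      rcases le_total ‖X x - (x - c)‖ 1 with h | h
      · rw [min_eq_left h]
        refine (min_le_left _ _).trans ?_
        have h3 := abs_norm_sub_norm_le (X x) (x - c)
        rw [abs_le] at h3 ⊢
        constructor <;> linarith
      · rw [min_eq_right h]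
        exact (min_le_right _ _).trans (by linarith)
    rw [integral_add hi1 hi2] at h1
    have : C1 * δ ≤ C1 * √δ := by gcongr
    linarith
  · intro Ψ L hL hΨ1 hΨ2
    have hΨc : Continuous Ψ := by
      refine LipschitzWith.continuous (K := L.toNNReal) (LipschitzWith.of_dist_le_mul fun x y => ?_)
      rw [Real.dist_eq, dist_eq_norm, Real.coe_toNNReal _ hL]; exact hΨ1 x y
    have hi1 : IntegrableOn (fun x => Ψ (x - c)) E (mw S w) :=
      hE.intE (by fun_prop : Continuous fun x => Ψ (x - c)).measurable (M := L) fun x => hΨ2 _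
    have hi2 : IntegrableOn (fun x => Ψ (X x)) E (mw S w) :=
      hE.intE (by fun_prop : Continuous fun x => Ψ (X x)).measurable (M := L) fun x => hΨ2 _
    have h1 : |∫ x in E, Ψ (x - c) ∂(mw S w) - ∫ x in E, Ψ (X x) ∂(mw S w)| ≤ 2 * L * (n * (C2 * (C1 + 1)) * √δ) := by
      rw [← integral_sub hi1 hi2]
      refine abs_integral_le_integral_abs.trans ?_
      have h2 : ∫ x in E, |Ψ (x - c) - Ψ (X x)| ∂(mw S w) ≤ ∫ x in E, 2 * L * Z x ∂(mw S w) := by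
        refine integral_mono_of_nonneg (ae_of_all _ fun x => abs_nonneg _) ((hE.intE hZc.measurable hZb).const_mul _) (ae_of_all _ fun x => ?_)
        simp only [hZ]
        have h3 := hΨ1 (x - c) (X x)
        rw [norm_sub_rev] at h3
        rcases le_total ‖X x - (x - c)‖ 1 with h | h
        · rw [min_eq_left h]
          nlinarith [mul_nonneg hL (norm_nonneg (X x - (x - c)))]
        · rw [min_eq_right h]
          refine (abs_sub _ _).trans ?_
          linarith [hΨ2 (x - c), hΨ2 (X x)]
      refine h2.trans ?_
      rw [integral_const_mul]
      exact mul_le_mul_of_nonneg_left hZE (by positivity)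
    have h2 := hc Ψ L hL hΨ1 hΨ2
    have h3 := abs_sub_le (∫ x in E, Ψ (x - c) ∂(mw S w)) (∫ x in E, Ψ (X x) ∂(mw S w)) (∫ x in ball 0 1, Ψ x ∂(mw S w))
    linarith

end CW
end PartT

section PartU
theorem BL_cc {n : ℕ} {Y : Type*} [NormedAddCommGroup Y] [NormedSpace ℝ Y] {f : Euc n → Y} (hf : ContDiff ℝ 1 f)
    (hc : HasCompactSupport f) : BL f :=
  ⟨hf.lipschitzWith_of_hasCompactSupport hc one_ne_zero, hf.continuous.bounded_above_of_compact_support hc⟩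

/-- test functions, compactly supported in the open unit ball -/
def Tst {n : ℕ} (ζ : Euc n → ℝ) : Prop :=
  ContDiff ℝ 2 ζ ∧ ∃ ρ : ℝ, 0 ≤ ρ ∧ ρ < 1 ∧ ∀ x, ρ ≤ ‖x‖ → ζ x = 0

namespace Tst
variable {n : ℕ} {ζ ζ₂ : Euc n → ℝ}

theorem hcs (h : Tst ζ) : HasCompactSupport ζ := by
  obtain ⟨ρ, -, -, h1⟩ := h.2
  refine HasCompactSupport.intro (isCompact_closedBall (0 : Euc n) ρ) fun x hx => h1 x ?_
  rw [mem_closedBall_zero_iff, not_le] at hx; exact hx.le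

theorem neg (h : Tst ζ) : Tst (fun x => - ζ x) := by
  obtain ⟨h0, ρ, h1, h2, h3⟩ := h
  exact ⟨h0.neg, ρ, h1, h2, fun x hx => by simp only [h3 x hx, neg_zero]⟩

theorem add (h : Tst ζ) (h' : Tst ζ₂) : Tst (fun x => ζ x + ζ₂ x) := by
  obtain ⟨h0, ρ, h1, h2, h3⟩ := h
  obtain ⟨k0, σ, k1, k2, k3⟩ := h'
  exact ⟨h0.add k0, max ρ σ, le_max_of_le_left h1, max_lt h2 k2, fun x hx => by
    simp only [h3 x ((le_max_left _ _).trans hx), k3 x ((le_max_right _ _).trans hx), add_zero]⟩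

theorem const_mul (h : Tst ζ) (a : ℝ) : Tst (fun x => a * ζ x) := by
  obtain ⟨h0, ρ, h1, h2, h3⟩ := h
  exact ⟨contDiff_const.mul h0, ρ, h1, h2, fun x hx => by simp only [h3 x hx, mul_zero]⟩

theorem zero : Tst (fun _ : Euc n => (0:ℝ)) := ⟨contDiff_const, 0, le_rfl, one_pos, fun _ _ => rfl⟩

theorem bl (h : Tst ζ) : BL ζ := BL_cc (h.1.of_le (by norm_num)) h.hcs

theorem diff (h : Tst ζ) (x : Euc n) : DifferentiableAt ℝ ζ x := h.1.differentiable (by norm_num) x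

theorem cd_fderiv (h : Tst ζ) : ContDiff ℝ 1 (fderiv ℝ ζ) := h.1.fderiv_right (by norm_num)

theorem bl_fderiv (h : Tst ζ) : BL (fderiv ℝ ζ) := BL_cc h.cd_fderiv (h.hcs.fderiv ℝ)

theorem bl_vec (h : Tst ζ) (b : Euc n) : BL (fun y => ζ y • (y + b)) :=
  BL_cc ((h.1.of_le (by norm_num)).smul (contDiff_id.add contDiff_const)) h.hcs.smul_right

theorem bl_eul (h : Tst ζ) (D : ℝ) : BL (fun y => D * ζ y + fderiv ℝ ζ y y) := by
  refine ((BL.const D).mul h.bl).add (BL_cc (h.cd_fderiv.clm_apply contDiff_id) ?_)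
  refine (h.hcs.fderiv ℝ).mono fun x hx => ?_
  rw [Function.mem_support] at hx ⊢
  intro h0; exact hx (by rw [h0]; rfl)

/-- quantitative Lipschitz bound -/
theorem quant (h : Tst ζ) (D : ℝ) : ∃ M : ℝ, 0 < M ∧ ∀ b : Euc n,
    (∀ x y, |(D * ζ x + fderiv ℝ ζ x (x + b)) - (D * ζ y + fderiv ℝ ζ y (y + b))| ≤ M * (1 + ‖b‖) * ‖x - y‖) ∧
    (∀ x, |D * ζ x + fderiv ℝ ζ x (x + b)| ≤ M * (1 + ‖b‖)) := by
  obtain ⟨K1, M1, hK1, hM1, h1, h2⟩ := h.bl_fderiv.bd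
  obtain ⟨K2, M2, hK2, hM2, h3, h4⟩ := (h.bl_eul D).bd
  refine ⟨K1 + K2 + M1 + M2 + 1, by positivity, fun b => ⟨fun x y => ?_, fun x => ?_⟩⟩
  · have e : (D * ζ x + fderiv ℝ ζ x (x + b)) - (D * ζ y + fderiv ℝ ζ y (y + b)) =
      ((D * ζ x + fderiv ℝ ζ x x) - (D * ζ y + fderiv ℝ ζ y y)) + (fderiv ℝ ζ x - fderiv ℝ ζ y) b := by
      rw [map_add, map_add, ContinuousLinearMap.sub_apply]; ring
    rw [e]
    refine (abs_add_le _ _).trans ?_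
    have a1 := h3 x y
    rw [Real.dist_eq, dist_eq_norm] at a1
    have a2 := ((fderiv ℝ ζ x - fderiv ℝ ζ y).le_opNorm b)
    have a3 := h1 x y
    rw [dist_eq_norm, dist_eq_norm] at a3
    rw [Real.norm_eq_abs] at a2
    have a4 := mul_le_mul_of_nonneg_right a3 (norm_nonneg b)
    have hb := norm_nonneg b
    have hxy := norm_nonneg (x - y)
    have : (K1 + K2 + M1 + M2 + 1) * (1 + ‖b‖) * ‖x - y‖ = K2 * ‖x - y‖ + K1 * ‖x-y‖ * ‖b‖ +
      (K1 * ‖x - y‖ + K2 * (‖b‖ * ‖x - y‖) + (M1 + M2 + 1) * ((1 + ‖b‖) * ‖x - y‖)) := by ring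
    have : 0 ≤ (K1 * ‖x - y‖ + K2 * (‖b‖ * ‖x - y‖) + (M1 + M2 + 1) * ((1 + ‖b‖) * ‖x - y‖)) := by positivity
    linarith
  · rw [map_add, ← add_assoc]
    refine (abs_add_le _ _).trans ?_
    have a1 := h4 x
    have a2 := (fderiv ℝ ζ x).le_opNorm b
    have a3 := mul_le_mul_of_nonneg_right (h2 x) (norm_nonneg b)
    rw [Real.norm_eq_abs] at a1 a2
    have hb := norm_nonneg b
    have : (K1 + K2 + M1 + M2 + 1) * (1 + ‖b‖) = M2 + M1 * ‖b‖ + (M1 + M2 * ‖b‖ + (K1 + K2 + 1) * (1 + ‖b‖)) := by ring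
    have : 0 ≤ (M1 + M2 * ‖b‖ + (K1 + K2 + 1) * (1 + ‖b‖)) := by positivity
    linarith

/-- vanishing at the boundary -/
theorem bdry (h : Tst ζ) : ∃ M : ℝ, 0 < M ∧ ∀ b y : Euc n, ‖ζ y • (y + b)‖ ≤ M * (1 + ‖b‖) * min |‖y‖ - 1| 1 := by
  obtain ⟨-, M, -, hM, -, h2⟩ := h.bl.bd
  obtain ⟨ρ, h0, h1, h3⟩ := h.2
  have hρ : 0 < 1 - ρ := by linarith
  refine ⟨(M + 1) / (1 - ρ), by positivity, fun b y => ?_⟩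
  by_cases hy : ρ ≤ ‖y‖
  · rw [h3 y hy, zero_smul, norm_zero]; positivity
  push Not at hy
  rw [norm_smul]
  have e : min |‖y‖ - 1| 1 = 1 - ‖y‖ := by
    rw [abs_of_nonpos (by linarith), min_eq_left] <;> linarith [norm_nonneg y]
  rw [e]
  have h4 : ‖y + b‖ ≤ 1 + ‖b‖ := (norm_add_le _ _).trans (by linarith)
  have h5 : ‖ζ y‖ ≤ M + 1 := (h2 y).trans (by linarith)
  have h6 : M + 1 ≤ (M + 1) / (1 - ρ) * (1 - ‖y‖) := by
    rw [div_mul_eq_mul_div, le_div_iff₀ hρ]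
    exact mul_le_mul_of_nonneg_left (by linarith) (by linarith)
  calc _ ≤ (M + 1) * (1 + ‖b‖) := by gcongr
    _ ≤ ((M + 1) / (1 - ρ) * (1 - ‖y‖)) * (1 + ‖b‖) := by gcongr
    _ = _ := by ring

end Tst

namespace CW
variable {n k : ℕ} {α : ℝ} {S : Set (Euc n)} {w : Euc n → ℝ}

theorem test_div1 (H : CW n k α S w) {E : Set (Euc n)} (hE : Dom S w E) {ζ : Euc n → ℝ} (hζ : Tst ζ) {x0 : Euc n}
    (hx0 : x0 ∈ linSpan n k) (c : Euc n) :
    ∫ x in E, ((n + α) * ζ (x - c) + fderiv ℝ ζ (x - c) (x - c + (c - x0))) ∂(mw S w) ≤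
      ∫ x, ‖ζ (x - c) • (x - c + (c - x0))‖ ∂(mb S w E) := by
  have hsh : ∃ K, LipschitzWith K (fun x : Euc n => x - c) := ⟨1 + 0, LipschitzWith.id.sub (LipschitzWith.const c)⟩
  have hB : BL (fun x => ζ (x - c) • (x - c + (c - x0))) := BL.comp (f := fun x : Euc n => x - c) (g := fun y => ζ y • (y + (c - x0))) hsh (hζ.bl_vec (c - x0))
  obtain ⟨M, hM, hq⟩ := hζ.quant (n + α)
  obtain ⟨-, M0, -, hM0, -, hb0⟩ := hζ.bl.bd
  have hcF : Continuous (fun x => (n + α) * ζ (x - c) + fderiv ℝ ζ (x - c) (x - c + (c - x0))) := by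
    have h1 := hζ.bl.cont
    have h2 := hζ.bl_fderiv.cont
    fun_prop
  refine H.wdi hE.op hE.sub hE.vol hE.per hB hcF.measurable (fun x => (hq (c - x0)).2 (x - c)) hM0 ?_ ?_
  · filter_upwards [d_diff (S := S)] with x hx _
    rw [sub_add_sub_cancel, map_smul, H.fderiv_d_eq hx hx0, smul_eq_mul]
    have := hb0 (x - c)
    rw [Real.norm_eq_abs, abs_le] at this
    exact mul_le_mul_of_nonneg_right this.1 infDist_nonneg
  · filter_upwards [H.w_diff] with x hx hxE
    have hd1 : HasFDerivAt (fun x => ζ (x - c)) (fderiv ℝ ζ (x - c)) x := by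
      have := (hζ.diff (x - c)).hasFDerivAt.comp x ((hasFDerivAt_id x).sub_const c)
      exact this.congr_fderiv (by ext v; simp)
    have hd2 : HasFDerivAt (fun x => x - c + (c - x0)) (ContinuousLinearMap.id ℝ (Euc n)) x :=
      ((hasFDerivAt_id x).sub_const c).add_const _
    rw [dv_smul hd1.differentiableAt hd2.differentiableAt, dv, hd2.fderiv, hd1.fderiv, tr_one]
    rw [sub_add_sub_cancel, map_smul, H.fderiv_w_eq (hE.sub hxE) (hx (hE.sub hxE)) hx0, smul_eq_mul]
    apply le_of_eq; ring

theorem test_div (H : CW n k α S w) {E : Set (Euc n)} (hE : Dom S w E) {ζ : Euc n → ℝ} (hζ : Tst ζ) {x0 : Euc n}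
    (hx0 : x0 ∈ linSpan n k) (c : Euc n) :
    |∫ x in E, ((n + α) * ζ (x - c) + fderiv ℝ ζ (x - c) (x - c + (c - x0))) ∂(mw S w)| ≤
      ∫ x, ‖ζ (x - c) • (x - c + (c - x0))‖ ∂(mb S w E) := by
  have h1 := H.test_div1 hE hζ hx0 c
  have h2 := H.test_div1 hE hζ.neg hx0 c
  simp only [fderiv_fun_neg, neg_smul, norm_neg] at h2
  have e : ∀ x, (n + α) * -ζ (x - c) + (-fderiv ℝ ζ (x - c)) (x - c + (c - x0)) =
    -((n + α) * ζ (x - c) + fderiv ℝ ζ (x - c) (x - c + (c - x0))) := fun x => by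
      rw [ContinuousLinearMap.neg_apply]; ring
  simp only [e] at h2
  rw [integral_neg] at h2
  rw [abs_le]; constructor <;> linarith

theorem dom_ball (H : CW n k α S w) : Dom S w (ball 0 1 ∩ S) where
  op := isOpen_ball.inter H.isOpen
  sub := inter_subset_right
  vol := (measure_mono (inter_subset_left.trans ball_subset_closedBall)).trans_lt (H.mw_ball_lt 1)
  per := H.per_ball_le.trans_lt (ENNReal.mul_lt_top ENNReal.ofReal_lt_top
    ((measure_mono ball_subset_closedBall).trans_lt (H.mw_ball_lt 1)))

theorem restrict_S (H : CW n k α S w) (B : Set (Euc n)) (hB : MeasurableSet B) :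
    (mw S w).restrict (B ∩ S) = (mw S w).restrict B := by
  refine Measure.restrict_congr_set ?_
  filter_upwards [H.ae_mw_S] with x hx
  exact propext ⟨fun h => h.1, fun h => ⟨h, hx⟩⟩

theorem zero_lin : (0 : Euc n) ∈ linSpan n k := fun _ _ => rfl

theorem test_zero (H : CW n k α S w) {ζ : Euc n → ℝ} (hζ : Tst ζ) :
    ∫ x in ball 0 1, ((n + α) * ζ x + fderiv ℝ ζ x x) ∂(mw S w) = 0 := by
  have h := H.test_div H.dom_ball hζ zero_lin 0
  simp only [sub_zero, add_zero] at h
  rw [H.restrict_S _ measurableSet_ball] at h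
  have h0 : ∫ x, ‖ζ x • x‖ ∂(mb S w (ball 0 1 ∩ S)) = 0 := by
    refine integral_eq_zero_of_ae ?_
    have h1 : ∀ᵐ x ∂(mb S w (ball 0 1 ∩ S)), x ∈ frontier (ball 0 1 ∩ S) :=
      (withDensity_absolutelyContinuous _ _).ae_le (ae_restrict_mem isClosed_frontier.measurableSet)
    filter_upwards [h1, H.ae_mb_S _] with x hx hxS
    obtain ⟨ρ, -, hρ, h3⟩ := hζ.2
    have := H.frontier_ball_sub hx hxS
    rw [mem_sphere_zero_iff_norm] at this
    simp [h3 x (by rw [this]; exact hρ.le)]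
  rw [h0] at h
  exact abs_nonpos_iff.1 h

theorem test_trans (H : CW n k α S w) {C : ℝ} (hC : 0 < C) {ζ : Euc n → ℝ} (hζ : Tst ζ) : ∃ A : ℝ, 0 < A ∧
    ∀ (E : Set (Euc n)) (δ : ℝ) (c x0 : Euc n), Dom S w E → x0 ∈ linSpan n k →
    ∫ x, min |‖x - c‖ - 1| 1 ∂(mb S w E) ≤ C * √δ →
      (∀ (Ψ : Euc n → ℝ) (L : ℝ), 0 ≤ L → (∀ x y, |Ψ x - Ψ y| ≤ L * ‖x - y‖) → (∀ x, |Ψ x| ≤ L) →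
        |∫ x in E, Ψ (x - c) ∂(mw S w) - ∫ x in ball 0 1, Ψ x ∂(mw S w)| ≤ C * L * √δ) →
    |∫ x in ball 0 1, fderiv ℝ ζ x (c - x0) ∂(mw S w)| ≤ A * (1 + ‖c - x0‖) * √δ := by
  obtain ⟨M1, hM1, hq⟩ := hζ.quant (n + α)
  obtain ⟨M2, hM2, hb⟩ := hζ.bdry
  refine ⟨(M1 + M2) * C, by positivity, fun E δ c x0 hE hx0 h1 h2 => ?_⟩
  set b := c - x0 with hbdef
  have h3 := H.test_div hE hζ hx0 c
  rw [← hbdef] at h3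
  have h4 : ∫ x, ‖ζ (x - c) • (x - c + b)‖ ∂(mb S w E) ≤ M2 * (1 + ‖b‖) * (C * √δ) := by
    refine le_trans ?_ (mul_le_mul_of_nonneg_left h1 (by positivity))
    rw [← integral_const_mul]
    refine integral_mono_of_nonneg (ae_of_all _ fun x => norm_nonneg _) ?_ (ae_of_all _ fun x => hb b (x - c))
    refine (hE.intB (by fun_prop : Continuous fun x : Euc n => min |‖x - c‖ - 1| 1).measurable (M := 1) fun x => ?_).const_mul _
    rw [abs_of_nonneg (le_min (abs_nonneg _) zero_le_one)]; exact min_le_right _ _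
  have h5 := h2 (fun y => (n + α) * ζ y + fderiv ℝ ζ y (y + b)) (M1 * (1 + ‖b‖)) (by positivity) (hq b).1 (hq b).2
  haveI : IsFiniteMeasure ((mw S w).restrict (ball 0 1)) :=
    ⟨by simpa using (measure_mono ball_subset_closedBall).trans_lt (H.mw_ball_lt 1)⟩
  have h6 : ∫ x in ball 0 1, ((n + α) * ζ x + fderiv ℝ ζ x (x + b)) ∂(mw S w) =
      ∫ x in ball 0 1, fderiv ℝ ζ x b ∂(mw S w) := by
    have e : ∀ x, (n + α) * ζ x + fderiv ℝ ζ x (x + b) = ((n + α) * ζ x + fderiv ℝ ζ x x) + fderiv ℝ ζ x b := fun x => by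
      rw [map_add, add_assoc]
    simp only [e]
    obtain ⟨K3, M3, -, -, -, hb3⟩ := (hζ.bl_eul (n + α)).bd
    obtain ⟨K4, M4, -, -, -, hb4⟩ := hζ.bl_fderiv.bd
    rw [integral_add, H.test_zero hζ, zero_add]
    · exact Integrable.of_bound (hζ.bl_eul (n + α)).cont.aestronglyMeasurable M3 (ae_of_all _ hb3)
    · have hc4 := hζ.bl_fderiv.cont
      refine Integrable.of_bound (by fun_prop : Continuous fun x => fderiv ℝ ζ x b).aestronglyMeasurable (M4 * ‖b‖) (ae_of_all _ fun x => ?_)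
      exact ((fderiv ℝ ζ x).le_opNorm b).trans (mul_le_mul_of_nonneg_right (hb4 x) (norm_nonneg _))
  rw [h6] at h5
  have h7 := h3.trans h4
  rw [abs_le] at h5 h7 ⊢
  have e : (M1 + M2) * C * (1 + ‖b‖) * √δ = C * (M1 * (1 + ‖b‖)) * √δ + M2 * (1 + ‖b‖) * (C * √δ) := by ring
  rw [e]
  constructor <;> linarith

end CW
end PartU

section PartV
namespace CW
variable {n k : ℕ} {α : ℝ} {S : Set (Euc n)} {w : Euc n → ℝ}

theorem fin_ball (H : CW n k α S w) : IsFiniteMeasure ((mw S w).restrict (ball 0 1)) := by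
  constructor
  rw [Measure.restrict_apply_univ]
  exact (measure_mono ball_subset_closedBall).trans_lt (H.mw_ball_lt 1)

theorem test_small (H : CW n k α S w) {f q : Euc n} (hf : ∀ ζ, Tst ζ → ∫ x in ball 0 1, fderiv ℝ ζ x f ∂(mw S w) = 0)
    (hq : q ∈ S) (hs : ‖q‖ + ‖f‖ ≤ 1/2) : q + f ∈ closure S := by
  by_contra hcon
  obtain ⟨ε, hε, hεs⟩ := Metric.isOpen_iff.1 isClosed_closure.isOpen_compl (q + f) hcon
  let ρ := min ε (1/4)
  have hρ : 0 < ρ := by positivity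
  have hρ1 : ρ ≤ ε := min_le_left _ _
  have hρ2 : ρ ≤ 1/4 := min_le_right _ _
  let ψ : ContDiffBump q := ⟨ρ/2, ρ, by positivity, by linarith⟩
  have hψC : ContDiff ℝ 2 ψ := ψ.contDiff
  have hψ0 : ∀ y, ρ ≤ dist y q → ψ y = 0 := fun y hy => ψ.zero_of_le_dist hy
  have hT : ∀ s : ℝ, 0 ≤ s → s ≤ 1 → Tst (fun y => ψ (y - s • f)) := by
    intro s h0 h1
    refine ⟨hψC.comp (by fun_prop), 3/4, by norm_num, by norm_num, fun y hy => hψ0 _ ?_⟩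
    rw [dist_eq_norm]
    have e1 : ‖y‖ ≤ ‖y - s • f - q‖ + (‖q‖ + ‖f‖) := by
      calc ‖y‖ = ‖(y - s • f - q) + (q + s • f)‖ := by congr 1; abel
        _ ≤ ‖y - s • f - q‖ + (‖q‖ + ‖s • f‖) := (norm_add_le _ _).trans (by gcongr; exact norm_add_le _ _)
        _ ≤ _ := by
          gcongr
          rw [norm_smul, Real.norm_eq_abs, abs_of_nonneg h0]
          nlinarith [norm_nonneg f]
    linarith
  haveI := H.fin_ball
  have hcs : HasCompactSupport (ψ : Euc n → ℝ) := ψ.hasCompactSupport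
  have hb1 := (BL_cc (hψC.of_le (by norm_num)) hcs)
  have hb2 : BL (fderiv ℝ ψ) := BL_cc (hψC.fderiv_right (by norm_num)) (hcs.fderiv ℝ)
  obtain ⟨K, M, hK, hM, -, hψM⟩ := hb1.bd
  obtain ⟨K', M', hK', hM', -, hψM'⟩ := hb2.bd
  have hd : ∀ s : ℝ, HasDerivAt (fun s : ℝ => ∫ y in ball 0 1, ψ (y - s • f) ∂(mw S w))
      (∫ y in ball 0 1, - fderiv ℝ ψ (y - s • f) f ∂(mw S w)) s := by
    intro s
    refine (hasDerivAt_integral_of_dominated_loc_of_deriv_le (F := fun (s : ℝ) y => ψ (y - s • f))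
      (F' := fun (s : ℝ) y => - fderiv ℝ ψ (y - s • f) f) (bound := fun _ => M' * ‖f‖) (s := univ) Filter.univ_mem ?_ ?_ ?_ ?_ ?_ ?_).2
    · exact Filter.Eventually.of_forall fun s => (hb1.cont.comp (by fun_prop)).aestronglyMeasurable
    · exact Integrable.of_bound (hb1.cont.comp (by fun_prop)).aestronglyMeasurable M (Filter.Eventually.of_forall fun y => hψM _)
    · refine Continuous.aestronglyMeasurable ?_
      have : Continuous fun y => fderiv ℝ ψ (y - s • f) := hb2.cont.comp (by fun_prop)
      fun_prop
    · refine Filter.Eventually.of_forall fun y s _ => ?_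
      rw [norm_neg]
      exact (ContinuousLinearMap.le_opNorm _ _).trans (by gcongr; exact hψM' _)
    · exact integrable_const _
    · refine Filter.Eventually.of_forall fun y s _ => ?_
      have e1 : HasDerivAt (fun s : ℝ => y - s • f) (-f) s := by
        have := ((hasDerivAt_id s).smul_const f).const_sub y
        simpa using this
      have e2 := ((hψC.differentiable (by norm_num)) (y - s • f)).hasFDerivAt.comp_hasDerivAt s e1
      rw [map_neg] at e2
      exact e2
  have hd0 : ∀ s : ℝ, 0 ≤ s → s ≤ 1 → ∫ y in ball 0 1, - fderiv ℝ ψ (y - s • f) f ∂(mw S w) = 0 := by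
    intro s h0 h1
    have := hf _ (hT s h0 h1)
    rw [integral_neg, neg_eq_zero, ← this]
    congr 1; ext y
    rw [fderiv_comp_sub]
  have hc := constant_of_has_deriv_right_zero (f := fun s : ℝ => ∫ y in ball 0 1, ψ (y - s • f) ∂(mw S w)) (a := 0) (b := 1)
    (fun s _ => (hd s).continuousAt.continuousWithinAt)
    (fun s hs => by
      have := (hd s).hasDerivWithinAt (s := Ici s)
      rwa [hd0 s hs.1 hs.2.le] at this) 1 ⟨by norm_num, le_rfl⟩
  simp only [one_smul, zero_smul, sub_zero] at hc
  have h1 : ∫ y in ball 0 1, ψ (y - f) ∂(mw S w) = 0 := by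
    refine integral_eq_zero_of_ae ?_
    have := ae_restrict_of_ae (s := ball 0 1) H.ae_mw_S
    filter_upwards [this] with y hy
    refine hψ0 _ ?_
    by_contra h
    push Not at h
    have : y ∈ ball (q + f) ε := by
      rw [mem_ball, dist_eq_norm]; rw [dist_eq_norm] at h
      have : y - (q + f) = y - f - q := by abel
      rw [this]; linarith
    exact hεs this (subset_closure hy)
  have h2 : 0 < ∫ y in ball 0 1, ψ y ∂(mw S w) := by
    rw [integral_pos_iff_support_of_nonneg (fun y => ψ.nonneg)
      (Integrable.of_bound hb1.cont.aestronglyMeasurable M (Filter.Eventually.of_forall fun y => hψM _))]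
    rw [ψ.support_eq, Measure.restrict_apply measurableSet_ball]
    refine H.mw_open_pos (isOpen_ball.inter isOpen_ball) ⟨q, ⟨mem_ball_self hρ, ?_⟩, hq⟩
    rw [mem_ball_zero_iff]; linarith [norm_nonneg f]
  linarith

theorem test_lin (H : CW n k α S w) {e : Euc n} (he : ∀ ζ, Tst ζ → ∫ x in ball 0 1, fderiv ℝ ζ x e ∂(mw S w) = 0) :
    e ∈ linSpan n k := by
  have hcl : ∀ p ∈ S, ∀ t : ℝ, p + t • e ∈ closure S := by
    intro p hp t
    let l := 1 / (2 * (‖p‖ + ‖t • e‖ + 1))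
    have hl : 0 < l := by positivity
    have h1 : l • p + l • t • e ∈ closure S := by
      refine H.test_small (fun ζ hζ => ?_) (H.smul_mem hp hl) ?_
      · simp only [map_smul, smul_eq_mul]
        rw [integral_const_mul, integral_const_mul, he ζ hζ]; simp
      · rw [norm_smul, norm_smul l, Real.norm_eq_abs, abs_of_pos hl, ← mul_add]
        have : l * (‖p‖ + ‖t • e‖ + 1) = 1/2 := by
          simp only [l]; field_simp
        linarith
    have h2 := H.smul_mem_cl h1 (inv_pos.2 hl)
    rwa [← smul_add, inv_smul_smul₀ hl.ne'] at h2
  obtain ⟨p, hp⟩ := H.nonempty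
  refine H.hNL (p + p) e fun t => ?_
  rw [add_assoc]
  exact H.add_mem hp (hcl p hp t)

theorem test_intble (H : CW n k α S w) {ζ : Euc n → ℝ} (hζ : Tst ζ) (v : Euc n) :
    Integrable (fun x => fderiv ℝ ζ x v) ((mw S w).restrict (ball 0 1)) := by
  haveI := H.fin_ball
  obtain ⟨K', M', hK', hM', -, hM⟩ := hζ.bl_fderiv.bd
  have := hζ.bl_fderiv.cont
  refine Integrable.of_bound (by apply Continuous.aestronglyMeasurable; fun_prop) (M' * ‖v‖) (Filter.Eventually.of_forall fun x => ?_)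
  exact (ContinuousLinearMap.le_opNorm _ _).trans (by gcongr; exact hM _)

/-- functionals realized by test functions -/
def tstSub (H : CW n k α S w) : Submodule ℝ (Module.Dual ℝ (Euc n)) where
  carrier := {φ | ∃ ζ, Tst ζ ∧ ∀ v, φ v = ∫ x in ball 0 1, fderiv ℝ ζ x v ∂(mw S w)}
  zero_mem' := ⟨_, Tst.zero, fun v => by simp⟩
  add_mem' := by
    rintro a b ⟨ζ, h1, h2⟩ ⟨ξ, g1, g2⟩
    refine ⟨_, h1.add g1, fun v => ?_⟩
    rw [LinearMap.add_apply, h2, g2, ← integral_add (H.test_intble h1 v) (H.test_intble g1 v)]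
    congr 1; ext x
    rw [fderiv_fun_add (h1.diff x) (g1.diff x)]; rfl
  smul_mem' := by
    rintro a b ⟨ζ, h1, h2⟩
    refine ⟨_, h1.const_mul a, fun v => ?_⟩
    rw [LinearMap.smul_apply, h2, smul_eq_mul, ← integral_const_mul]
    congr 1; ext x
    rw [fderiv_const_mul (h1.diff x)]; rfl

theorem test_coord (H : CW n k α S w) (i : Fin n) (hi : k ≤ (i : ℕ)) : ∃ ζ, Tst ζ ∧
    ∀ v : Euc n, ∫ x in ball 0 1, fderiv ℝ ζ x v ∂(mw S w) = v i := by
  let φ : Module.Dual ℝ (Euc n) := (EuclideanSpace.proj i : Euc n →L[ℝ] ℝ).toLinearMap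
  have h : φ ∈ H.tstSub := by
    rw [← Subspace.dualCoannihilator_dualAnnihilator_eq (W := H.tstSub), Submodule.mem_dualAnnihilator]
    intro e he
    rw [Submodule.mem_dualCoannihilator] at he
    have := H.test_lin (e := e) fun ζ hζ => by
      have hmem : ({ toFun := fun v => ∫ x in ball 0 1, fderiv ℝ ζ x v ∂(mw S w)
                     map_add' := fun u v => by
                      simp only [map_add]
                      exact integral_add (H.test_intble hζ u) (H.test_intble hζ v)
                     map_smul' := fun a v => by
                      simp only [map_smul, smul_eq_mul, RingHom.id_apply]
                      exact integral_const_mul _ _ } : Module.Dual ℝ (Euc n)) ∈ H.tstSub :=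
        ⟨ζ, hζ, fun v => rfl⟩
      exact he _ hmem
    exact this i hi
  obtain ⟨ζ, h1, h2⟩ := h
  exact ⟨ζ, h1, fun v => (h2 v).symm⟩

end CW
end PartV

section PartW
theorem deriv_nonneg_of_right' {g : ℝ → ℝ} {g' : ℝ} (hg : HasDerivAt g g' 0) (h0 : g 0 = 0)
    (hpos : ∀ᶠ s in 𝓝[>] (0:ℝ), 0 ≤ g s) : 0 ≤ g' := by
  have h1 := hg.tendsto_slope_zero_right
  refine ge_of_tendsto h1 ?_
  filter_upwards [self_mem_nhdsWithin, hpos] with t ht ht'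
  rw [zero_add, h0, sub_zero]
  exact smul_nonneg (inv_nonneg.2 (le_of_lt ht)) ht'

/-- capped distance to the unit ball -/
def mm {n : ℕ} (y : Euc n) : ℝ := min (max (‖y‖ - 1) 0) 1
def qq {n : ℕ} (y : Euc n) : ℝ := (max ‖y‖ 1)⁻¹

variable {n : ℕ}
theorem mm_nonneg (y : Euc n) : 0 ≤ mm y := le_min (le_max_right _ _) zero_le_one
theorem mm_le_one (y : Euc n) : mm y ≤ 1 := min_le_right _ _
theorem mm_abs (y : Euc n) : |mm y| ≤ 1 := by rw [abs_of_nonneg (mm_nonneg y)]; exact mm_le_one y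
theorem mm_le (y : Euc n) : mm y ≤ min |‖y‖ - 1| 1 :=
  min_le_min (max_le (le_abs_self _) (abs_nonneg _)) le_rfl
theorem mm_lip' (x y : Euc n) : |mm x - mm y| ≤ ‖x - y‖ := by
  unfold mm
  have h1 := abs_min_sub_min_le_max (max (‖x‖ - 1) 0) 1 (max (‖y‖ - 1) 0) 1
  have h2 := abs_max_sub_max_le_max (‖x‖ - 1) 0 (‖y‖ - 1) 0
  have h3 := abs_norm_sub_norm_le x y
  simp only [sub_self, abs_zero, sub_sub_sub_cancel_right] at h1 h2
  have h4 : max |(‖x‖ - ‖y‖)| 0 = |(‖x‖ - ‖y‖)| := max_eq_left (abs_nonneg _)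
  rw [h4] at h2
  exact h1.trans (max_le (h2.trans h3) (norm_nonneg _))
theorem mm_BL : BL (mm : Euc n → ℝ) :=
  BL.of_dist (K := 1) (M := 1) (fun x y => by rw [Real.dist_eq, dist_eq_norm, one_mul]; exact mm_lip' x y) mm_abs

theorem qq_diff (x y : Euc n) : |qq x - qq y| * max ‖y‖ 1 ≤ ‖x - y‖ := by
  unfold qq
  have hx : 1 ≤ max ‖x‖ 1 := le_max_right _ _
  have hy : 1 ≤ max ‖y‖ 1 := le_max_right _ _
  have h2 := abs_max_sub_max_le_max ‖y‖ 1 ‖x‖ 1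
  have h3 := abs_norm_sub_norm_le y x
  rw [norm_sub_rev] at h3
  simp only [sub_self, abs_zero] at h2
  have h4 : max |(‖y‖ - ‖x‖)| 0 = |(‖y‖ - ‖x‖)| := max_eq_left (abs_nonneg _)
  rw [h4] at h2
  set a := max ‖x‖ 1
  set b := max ‖y‖ 1
  have ha : 0 < a := by linarith
  have hb : 0 < b := by linarith
  rw [inv_sub_inv ha.ne' hb.ne', abs_div, abs_of_pos (mul_pos ha hb)]
  have e : |b - a| / (a * b) * b = |b - a| / a := by field_simp
  rw [e]
  exact (div_le_self (abs_nonneg _) hx).trans (h2.trans h3)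

theorem qq_pos (y : Euc n) : 0 < qq y := inv_pos.2 (lt_of_lt_of_le one_pos (le_max_right _ _))
theorem qq_le (y : Euc n) : qq y ≤ 1 := inv_le_one_of_one_le₀ (le_max_right _ _)

theorem qq_BL : BL (qq : Euc n → ℝ) := by
  refine BL.of_dist (K := 1) (M := 1) (fun x y => ?_) (fun y => ?_)
  · rw [Real.dist_eq, dist_eq_norm, one_mul]
    exact (le_mul_of_one_le_right (abs_nonneg _) (le_max_right _ _)).trans (qq_diff x y)
  · rw [Real.norm_eq_abs, abs_of_pos (qq_pos y)]; exact qq_le y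

theorem qq_norm_le (y : Euc n) : ‖qq y • y‖ ≤ 1 := by
  rw [norm_smul, Real.norm_eq_abs, abs_of_pos (qq_pos y)]
  unfold qq
  have hy : 1 ≤ max ‖y‖ 1 := le_max_right _ _
  rw [inv_mul_le_iff₀ (by linarith), mul_one]; exact le_max_left _ _

theorem qqv_BL : BL (fun y : Euc n => qq y • y) := by
  refine BL.of_dist (K := 2) (M := 1) (fun x y => ?_) qq_norm_le
  rw [dist_eq_norm, dist_eq_norm]
  have e : qq x • x - qq y • y = qq x • (x - y) + (qq x - qq y) • y := by
    rw [smul_sub, sub_smul]; abel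
  rw [e]
  refine (norm_add_le _ _).trans ?_
  rw [norm_smul, norm_smul, Real.norm_eq_abs, Real.norm_eq_abs, abs_of_pos (qq_pos x)]
  have h1 : |qq x - qq y| * ‖y‖ ≤ ‖x - y‖ := (by gcongr; exact le_max_left _ _ : _ ≤ _).trans (qq_diff x y)
  have h2 : qq x * ‖x - y‖ ≤ ‖x - y‖ := mul_le_of_le_one_left (norm_nonneg _) (qq_le x)
  linarith

/-- indicator of the annulus -/
def ff {n : ℕ} (y : Euc n) : ℝ := if 1 ≤ ‖y‖ ∧ ‖y‖ < 2 then 1 else 0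
theorem ff_meas : Measurable (ff : Euc n → ℝ) :=
  Measurable.ite ((measurableSet_le measurable_const measurable_norm).inter (measurableSet_lt measurable_norm measurable_const))
    measurable_const measurable_const
theorem ff_abs (y : Euc n) : |ff y| ≤ 1 := by unfold ff; split_ifs <;> simp
theorem ff_nonneg (y : Euc n) : 0 ≤ ff y := by unfold ff; split_ifs <;> simp

theorem mq_mono (y : Euc n) {s : ℝ} (hs : 0 < s) : mm y * qq y ≤ (1 + s) * (mm (y + s • y) * qq (y + s • y)) := by
  have e : ‖y + s • y‖ = (1 + s) * ‖y‖ := by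
    have : y + s • y = (1 + s) • y := by rw [add_smul, one_smul]
    rw [this, norm_smul, Real.norm_eq_abs, abs_of_pos (by linarith)]
  rcases le_total ‖y‖ 1 with h | h
  · have : mm y = 0 := by unfold mm; rw [max_eq_right (by linarith)]; simp
    rw [this, zero_mul]
    have := mm_nonneg (y + s • y); have := qq_pos (y + s • y); positivity
  · have h' : 1 ≤ (1 + s) * ‖y‖ := by nlinarith
    unfold mm qq
    rw [e, max_eq_left h, max_eq_left h', mul_inv]
    have e2 : ∀ a : ℝ, (1 + s) * (a * ((1 + s)⁻¹ * ‖y‖⁻¹)) = a * ‖y‖⁻¹ := fun a => by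
      have : 1 + s ≠ 0 := by positivity
      field_simp
    rw [e2]
    gcongr
    nlinarith

theorem mq_ann (y : Euc n) (h1 : 1 ≤ ‖y‖) (h2 : ‖y‖ < 2) {s : ℝ} (hs : 0 < s) (hs2 : (1 + s) * ‖y‖ < 2) :
    (1 + s) * (mm (y + s • y) * qq (y + s • y)) = mm y * qq y + s := by
  have e : ‖y + s • y‖ = (1 + s) * ‖y‖ := by
    have : y + s • y = (1 + s) • y := by rw [add_smul, one_smul]
    rw [this, norm_smul, Real.norm_eq_abs, abs_of_pos (by linarith)]
  have h' : 1 ≤ (1 + s) * ‖y‖ := by nlinarith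
  unfold mm qq
  rw [e, max_eq_left h1, max_eq_left h', max_eq_left (by linarith), max_eq_left (by linarith), min_eq_left (by linarith), min_eq_left (by linarith)]
  have : 1 + s ≠ 0 := by positivity
  have : ‖y‖ ≠ 0 := by positivity
  field_simp
  ring

theorem mq_deriv (y : Euc n) (hd : DifferentiableAt ℝ (fun y : Euc n => mm y * qq y) y) :
    ff y ≤ mm y * qq y + fderiv ℝ (fun y : Euc n => mm y * qq y) y y := by
  have h1 := CW.hasDerivAt_line hd y
  have h2 : HasDerivAt (fun s : ℝ => (1 + s) * (mm (y + s • y) * qq (y + s • y)) - mm y * qq y - s * ff y)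
      (mm y * qq y + fderiv ℝ (fun y : Euc n => mm y * qq y) y y - ff y) 0 := by
    have h3 : HasDerivAt (fun s : ℝ => 1 + s) 1 0 := (hasDerivAt_id (0:ℝ)).const_add 1
    have h4 : HasDerivAt (fun s : ℝ => s * ff y) (1 * ff y) 0 := (hasDerivAt_id (0:ℝ)).mul_const _
    have h5 := ((h3.mul h1).sub_const (mm y * qq y)).sub h4
    refine h5.congr_deriv ?_
    simp
  have := deriv_nonneg_of_right' h2 (by simp) ?_
  · linarith
  · by_cases hy : 1 ≤ ‖y‖ ∧ ‖y‖ < 2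
    · have hlt : ∀ᶠ s in 𝓝[>] (0:ℝ), (1 + s) * ‖y‖ < 2 := by
        have : Filter.Tendsto (fun s : ℝ => (1 + s) * ‖y‖) (𝓝 0) (𝓝 ((1 + 0) * ‖y‖)) := by
          apply Continuous.tendsto; fun_prop
        exact (this.mono_left nhdsWithin_le_nhds).eventually_lt_const (by linarith [hy.2])
      filter_upwards [self_mem_nhdsWithin, hlt] with s hs hs2
      rw [mq_ann y hy.1 hy.2 hs hs2]
      unfold ff; rw [if_pos hy]; linarith
    · filter_upwards [self_mem_nhdsWithin] with s hs
      have := mq_mono y hs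
      unfold ff; rw [if_neg hy]; linarith

namespace CW
variable {k : ℕ} {α : ℝ} {S : Set (Euc n)} {w : Euc n → ℝ}

theorem ann (H : CW n k α S w) {E : Set (Euc n)} (hE : Dom S w E) {x0 : Euc n}
    (hx0 : x0 ∈ linSpan n k) :
    ∫ x in E, ff (x - x0) ∂(mw S w) ≤ ∫ x, mm (x - x0) ∂(mb S w E) := by
  have hsh : ∃ K, LipschitzWith K (fun x : Euc n => x - x0) := ⟨1 + 0, LipschitzWith.id.sub (LipschitzWith.const x0)⟩
  have hφ : BL (fun x : Euc n => mm (x - x0) * qq (x - x0)) :=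
    BL.comp (f := fun x : Euc n => x - x0) (g := fun y => mm y * qq y) hsh (mm_BL.mul qq_BL)
  have hX0 : BL (fun x : Euc n => mm (x - x0) • qq (x - x0) • (x - x0)) :=
    BL.comp (f := fun x : Euc n => x - x0) (g := fun y => mm y • qq y • y) hsh (mm_BL.smul qqv_BL)
  have hX : BL (fun x : Euc n => (mm (x - x0) * qq (x - x0)) • (x - x0)) := by
    simpa only [mul_smul] using hX0
  have hφ0 : ∀ x, 0 ≤ mm (x - x0) * qq (x - x0) := fun x => mul_nonneg (mm_nonneg _) (qq_pos _).le
  have key := H.wdi hE.op hE.sub hE.vol hE.per hX (F := fun x => ff (x - x0)) (ff_meas.comp (measurable_id.sub_const x0))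
    (fun x => ff_abs _) le_rfl ?_ ?_
  · refine key.trans (integral_mono_of_nonneg (ae_of_all _ fun x => norm_nonneg _) ?_ (ae_of_all _ fun x => ?_))
    · exact hE.intB ((mm_BL.cont.comp (by fun_prop)).measurable) (fun x => mm_abs (x - x0))
    · simp only [mul_smul]
      rw [norm_smul, Real.norm_eq_abs, abs_of_nonneg (mm_nonneg _)]
      exact mul_le_of_le_one_right (mm_nonneg _) (qq_norm_le _)
  · filter_upwards [d_diff (S := S)] with x hx _
    rw [map_smul, H.fderiv_d_eq hx hx0, smul_eq_mul, neg_zero, zero_mul]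
    exact mul_nonneg (hφ0 x) infDist_nonneg
  · filter_upwards [H.w_diff, hφ.ae_diff] with x hx hx2 hxE
    have hd2 : HasFDerivAt (fun x => x - x0) (ContinuousLinearMap.id ℝ (Euc n)) x :=
      (hasFDerivAt_id x).sub_const x0
    have hxS := hE.sub hxE
    rw [dv_smul hx2 hd2.differentiableAt, dv, hd2.fderiv, tr_one, map_smul,
      H.fderiv_w_eq hxS (hx hxS) hx0, smul_eq_mul]
    have hd : DifferentiableAt ℝ (fun y : Euc n => mm y * qq y) (x - x0) := by
      have e : (fun y : Euc n => mm y * qq y) = (fun x : Euc n => mm (x - x0) * qq (x - x0)) ∘ (fun y => y + x0) := by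
        ext y; simp
      rw [e]
      refine DifferentiableAt.comp _ ?_ (by fun_prop)
      simpa using hx2
    have h3 := mq_deriv _ hd
    have e3 : fderiv ℝ (fun x : Euc n => mm (x - x0) * qq (x - x0)) x = fderiv ℝ (fun y : Euc n => mm y * qq y) (x - x0) :=
      fderiv_comp_sub (f := fun y : Euc n => mm y * qq y) x0
    rw [e3]
    have hw0 := H.w_nonneg (subset_closure hxS)
    have hn1 : (1:ℝ) ≤ n := by exact_mod_cast H.npos
    have hα := H.hα
    have h4 := hφ0 x
    nlinarith [mul_le_mul_of_nonneg_right h3 hw0, mul_nonneg (mul_nonneg h4 hw0) (by linarith : (0:ℝ) ≤ n - 1 + α)]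

end CW
end PartW

section PartX
namespace CW
variable {n k : ℕ} {α : ℝ} {S : Set (Euc n)} {w : Euc n → ℝ}

theorem near (H : CW n k α S w) : ∃ C : ℝ, 0 < C ∧ ∀ E, Dom S w E → (mw S w E).toReal = (mw S w (ball 0 1)).toReal →
    ∀ δ : ℝ, 0 < δ → δ ≤ 1 → (mb S w E univ).toReal ≤ (n + α) * (mw S w (ball 0 1)).toReal * (1 + δ) →
    ∃ c x0 : Euc n, x0 ∈ linSpan n k ∧ ∫ x, min |‖x - c‖ - 1| 1 ∂(mb S w E) ≤ C * √δ ∧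
      ∫ x in E, mm (x - c) ∂(mw S w) ≤ C * √δ ∧ ‖c - x0‖ ≤ C * (1 + ‖c - x0‖) * √δ := by
  obtain ⟨C, hC, hsh⟩ := H.shift
  have hA : ∀ i : Fin n, ∃ A : ℝ, 0 < A ∧ ∀ (E : Set (Euc n)) (δ : ℝ) (c x0 : Euc n), Dom S w E → x0 ∈ linSpan n k →
      ((i:ℕ) < k → x0 i = c i) → ∫ x, min |‖x - c‖ - 1| 1 ∂(mb S w E) ≤ C * √δ →
      (∀ (Ψ : Euc n → ℝ) (L : ℝ), 0 ≤ L → (∀ x y, |Ψ x - Ψ y| ≤ L * ‖x - y‖) → (∀ x, |Ψ x| ≤ L) →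
        |∫ x in E, Ψ (x - c) ∂(mw S w) - ∫ x in ball 0 1, Ψ x ∂(mw S w)| ≤ C * L * √δ) →
      |(c - x0) i| ≤ A * (1 + ‖c - x0‖) * √δ := by
    intro i
    by_cases hi : (i : ℕ) < k
    · refine ⟨1, one_pos, fun E δ c x0 _ _ h _ _ => ?_⟩
      rw [PiLp.sub_apply, h hi, sub_self, abs_zero]; positivity
    · obtain ⟨ζ, hζ, h1⟩ := H.test_coord i (not_lt.1 hi)
      obtain ⟨A, hA, h2⟩ := H.test_trans hC hζ
      refine ⟨A, hA, fun E δ c x0 hE hx0 _ hb hΨ => ?_⟩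
      rw [← h1]
      exact h2 E δ c x0 hE hx0 hb hΨ
  choose A hA0 hA1 using hA
  have hsum : 0 ≤ ∑ i, A i := Finset.sum_nonneg fun i _ => (hA0 i).le
  refine ⟨C + ∑ i, A i, by positivity, fun E hE hEκ δ hδ hδ1 hper => ?_⟩
  obtain ⟨c, hb, hΨ⟩ := hsh E hE hEκ δ hδ hδ1 hper
  have hmono : C * √δ ≤ (C + ∑ i, A i) * √δ := by gcongr; linarith
  let x0 : Euc n := WithLp.toLp 2 (fun i => if (i:ℕ) < k then c i else 0)
  have hx0 : x0 ∈ linSpan n k := fun i hi => by simp [x0, not_lt.2 hi]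
  refine ⟨c, x0, hx0, hb.trans hmono, ?_, ?_⟩
  · have h1 := hΨ mm 1 zero_le_one (fun x y => by rw [one_mul]; exact mm_lip' x y) mm_abs
    have h2 : ∫ x in ball 0 1, mm x ∂(mw S w) = 0 := by
      refine setIntegral_eq_zero_of_forall_eq_zero fun x hx => ?_
      rw [mem_ball_zero_iff] at hx
      unfold mm; rw [max_eq_right (by linarith)]; simp
    rw [h2, sub_zero, mul_one] at h1
    exact (le_abs_self _).trans (h1.trans hmono)
  · refine (norm_le_sum_abs _).trans ?_
    calc ∑ i, |(c - x0) i| ≤ ∑ i, A i * (1 + ‖c - x0‖) * √δ := Finset.sum_le_sum fun i _ =>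
          hA1 i E δ c x0 hE hx0 (fun hi => by simp [x0, hi]) hb hΨ
      _ = (∑ i, A i) * (1 + ‖c - x0‖) * √δ := by rw [Finset.sum_mul, Finset.sum_mul]
      _ ≤ _ := by gcongr; linarith

theorem final (H : CW n k α S w) : ∃ C : ℝ, 0 < C ∧ ∀ E, Dom S w E → (mw S w E).toReal = (mw S w (ball 0 1)).toReal →
    ∀ δ : ℝ, 0 < δ → δ ≤ 1 → (mb S w E univ).toReal ≤ (n + α) * (mw S w (ball 0 1)).toReal * (1 + δ) →
    ∃ x0 : Euc n, x0 ∈ linSpan n k ∧ (mw S w (E \ ball x0 1)).toReal ≤ C * √δ := by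
  obtain ⟨C, hC, hne⟩ := H.near
  set κ := (mw S w (ball 0 1)).toReal with hκ
  have hκ0 : 0 ≤ κ := ENNReal.toReal_nonneg
  have hn0 : (0:ℝ) ≤ n := Nat.cast_nonneg n
  have hα := H.hα
  refine ⟨2 * C * κ + (2 * C + 2 * C * (κ + (n + α) * κ * 2)), by positivity, fun E hE hEκ δ hδ hδ1 hper => ?_⟩
  obtain ⟨c, x0, hx0, h1, h2, h3⟩ := hne E hE hEκ δ hδ hδ1 hper
  refine ⟨x0, hx0, ?_⟩
  haveI := hE.fin
  haveI := hE.finb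
  by_cases hs : C * √δ ≤ 1/2
  swap
  · have e1 : (mw S w (E \ ball x0 1)).toReal ≤ κ := by
      rw [← hEκ]
      exact ENNReal.toReal_mono hE.vol.ne (measure_mono diff_subset)
    have e2 : κ ≤ 2 * C * κ * √δ := by nlinarith
    have e3 : 0 ≤ (2 * C + 2 * C * (κ + (n + α) * κ * 2)) * √δ := by positivity
    rw [add_mul]; linarith
  have hb : ‖c - x0‖ ≤ 2 * C * √δ := by nlinarith [norm_nonneg (c - x0)]
  have hmm : ∀ x : Euc n, mm (x - x0) ≤ mm (x - c) + ‖c - x0‖ := by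
    intro x
    have := (abs_le.1 (mm_lip' (x - x0) (x - c))).2
    rw [sub_sub_sub_cancel_left] at this
    linarith
  have hmeas : ∀ a : Euc n, Measurable fun x : Euc n => mm (x - a) := fun a => (mm_BL.cont.comp (by fun_prop)).measurable
  have i1 : ∀ a : Euc n, IntegrableOn (fun x : Euc n => mm (x - a)) E (mw S w) := fun a => hE.intE (hmeas a) (fun x => mm_abs _)
  have i2 : ∀ a : Euc n, Integrable (fun x : Euc n => mm (x - a)) (mb S w E) := fun a => hE.intB (hmeas a) (fun x => mm_abs _)
  have i3 : IntegrableOn (fun x : Euc n => ff (x - x0)) E (mw S w) :=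
    hE.intE (ff_meas.comp (measurable_id.sub_const x0)) (fun x => ff_abs _)
  have b1 : ∫ x in E, mm (x - x0) ∂(mw S w) ≤ C * √δ + ‖c - x0‖ * κ := by
    calc _ ≤ ∫ x in E, (mm (x - c) + ‖c - x0‖) ∂(mw S w) := integral_mono (i1 x0) ((i1 c).add (integrable_const _)) hmm
      _ = ∫ x in E, mm (x - c) ∂(mw S w) + ‖c - x0‖ * κ := by
        rw [integral_add (i1 c) (integrable_const _), integral_const, measureReal_restrict_apply_univ, smul_eq_mul, mul_comm]
        rw [← hEκ]; rfl
      _ ≤ _ := by gcongr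
  have b2 : ∫ x, mm (x - x0) ∂(mb S w E) ≤ C * √δ + ‖c - x0‖ * ((n + α) * κ * 2) := by
    calc _ ≤ ∫ x, (mm (x - c) + ‖c - x0‖) ∂(mb S w E) := integral_mono (i2 x0) ((i2 c).add (integrable_const _)) hmm
      _ = ∫ x, mm (x - c) ∂(mb S w E) + ‖c - x0‖ * (mb S w E univ).toReal := by
        rw [integral_add (i2 c) (integrable_const _), integral_const, smul_eq_mul, mul_comm]
        rfl
      _ ≤ _ := by
        gcongr
        · refine le_trans (integral_mono_of_nonneg (ae_of_all _ fun x => mm_nonneg _) ?_ (ae_of_all _ fun x => mm_le _)) h1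
          refine hE.intB (M := 1) (by fun_prop) fun x => ?_
          rw [abs_of_nonneg (le_min (abs_nonneg _) zero_le_one)]; exact min_le_right _ _
        · refine hper.trans ?_
          gcongr; linarith
  have b3 := H.ann hE hx0
  have hset : MeasurableSet (ball x0 1)ᶜ := measurableSet_ball.compl
  have b4 : (mw S w (E \ ball x0 1)).toReal ≤ ∫ x in E, (ff (x - x0) + mm (x - x0)) ∂(mw S w) := by
    have e : (mw S w (E \ ball x0 1)).toReal = ∫ x in E, (ball x0 1)ᶜ.indicator (fun _ => (1:ℝ)) x ∂(mw S w) := by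
      rw [integral_indicator hset, Measure.restrict_restrict hset, integral_const, smul_eq_mul, mul_one,
        measureReal_restrict_apply_univ, diff_eq, inter_comm]; rfl
    rw [e]
    refine integral_mono ((integrable_const (1:ℝ)).indicator hset) (i3.add (i1 x0)) fun x => ?_
    by_cases hx : x ∈ ball x0 1
    · rw [indicator_of_notMem (by simpa using hx)]
      exact add_nonneg (ff_nonneg _) (mm_nonneg _)
    · rw [indicator_of_mem (by simpa using hx)]
      rw [mem_ball, dist_eq_norm, not_lt] at hx
      by_cases h : ‖x - x0‖ < 2
      · have : ff (x - x0) = 1 := if_pos ⟨hx, h⟩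
        simp only [this]; linarith [mm_nonneg (x - x0)]
      · have : mm (x - x0) = 1 := by
          unfold mm; rw [max_eq_left (by linarith), min_eq_right (by linarith)]
        simp only [this]; linarith [ff_nonneg (x - x0)]
  rw [integral_add i3 (i1 x0)] at b4
  have b5 : ‖c - x0‖ * (κ + (n + α) * κ * 2) ≤ 2 * C * √δ * (κ + (n + α) * κ * 2) := by gcongr
  have b6 : 0 ≤ 2 * C * κ * √δ := by positivity
  nlinarith

end CW
end PartX

section PartY
namespace CW
variable {n k : ℕ} {α : ℝ} {S : Set (Euc n)} {w : Euc n → ℝ}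

theorem scale_gen (H : CW n k α S w) {μ : Measure (Euc n)} {r : ℝ} (hr : 0 < r) {c : ℝ≥0∞}
    (hμ : ∀ s, μ ((fun x : Euc n => r • x) ⁻¹' s) = c * μ s) {A : Set (Euc n)} (hA : MeasurableSet A) :
    ∫⁻ x in (fun x : Euc n => r • x) ⁻¹' A, ENNReal.ofReal (wS S w x) ∂μ =
      (ENNReal.ofReal (r ^ α))⁻¹ * (c * ∫⁻ x in A, ENNReal.ofReal (wS S w x) ∂μ) := by
  have hm : Measurable (fun x : Euc n => r • x) := by fun_prop
  have hmap : μ.map (fun x : Euc n => r • x) = c • μ := by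
    ext s hs
    rw [Measure.map_apply hm hs, hμ, Measure.smul_apply, smul_eq_mul]
  have h1 := setLIntegral_map (μ := μ) hA H.wS_meas.ennreal_ofReal hm
  rw [hmap, Measure.restrict_smul, lintegral_smul_measure, smul_eq_mul] at h1
  rw [h1]
  have hra : 0 < r ^ α := Real.rpow_pos_of_pos hr _
  have e : ∀ x, ENNReal.ofReal (wS S w (r • x)) = ENNReal.ofReal (r ^ α) * ENNReal.ofReal (wS S w x) := fun x => by
    rw [H.wS_smul x hr, ENNReal.ofReal_mul hra.le]
  simp only [e]
  rw [lintegral_const_mul _ H.wS_meas.ennreal_ofReal, ← mul_assoc,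
    ENNReal.inv_mul_cancel (by simpa using hra) ENNReal.ofReal_ne_top, one_mul]

theorem mw_scale (H : CW n k α S w) {r : ℝ} (hr : 0 < r) {A : Set (Euc n)} (hA : MeasurableSet A) :
    mw S w ((fun x : Euc n => r • x) ⁻¹' A) = (ENNReal.ofReal (r ^ α))⁻¹ * (ENNReal.ofReal ((r ^ n)⁻¹) * mw S w A) := by
  have hm : Measurable (fun x : Euc n => r • x) := by fun_prop
  rw [mw_apply hA, mw_apply (hm hA)]
  refine H.scale_gen hr (fun s => ?_) hA
  rw [Measure.addHaar_preimage_smul _ hr.ne', abs_of_pos (by positivity)]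
  simp

theorem mb_scale (H : CW n k α S w) {r : ℝ} (hr : 0 < r) (A : Set (Euc n)) :
    mb S w ((fun x : Euc n => r • x) ⁻¹' A) univ =
      (ENNReal.ofReal (r ^ α))⁻¹ * (ENNReal.ofReal ((r ^ (n - 1))⁻¹) * mb S w A univ) := by
  rw [mb_univ, mb_univ]
  have e : frontier ((fun x : Euc n => r • x) ⁻¹' A) = (fun x : Euc n => r • x) ⁻¹' frontier A :=
    ((Homeomorph.smulOfNeZero r hr.ne').preimage_frontier A).symm
  rw [e]
  refine H.scale_gen hr (fun s => ?_) isClosed_frontier.measurableSet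
  rw [Set.preimage_smul₀ hr.ne', Measure.euclideanHausdorffMeasure_smul₀ _ (inv_ne_zero hr.ne')]
  rw [ENNReal.smul_def, smul_eq_mul]
  congr 1
  rw [ENNReal.ofReal, ENNReal.coe_inj]
  ext
  rw [Real.coe_toNNReal _ (by positivity)]
  simp [abs_of_pos hr]

theorem wVol_eq (H : CW n k α S w) {A : Set (Euc n)} (hA : MeasurableSet A) (hAS : A ⊆ S) : wVol w A = mw S w A := by
  rw [mw_apply hA, wVol]
  exact setLIntegral_congr_fun hA fun x hx => by simp only [wS_eq (hAS hx)]

theorem wPer_eq (H : CW n k α S w) : ∃ s : ℝ≥0, s ≠ 0 ∧ ∀ A : Set (Euc n), mb S w A univ = s * wPer S w A := by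
  refine ⟨_, Measure.addHaarScalarFactor_volume_hausdorffMeasure_ne_zero (n - 1), fun A => ?_⟩
  have hn : ((n - 1 : ℕ) : ℝ) = (n : ℝ) - 1 := by
    rw [Nat.cast_sub H.npos, Nat.cast_one]
  rw [mb_univ, Measure.euclideanHausdorffMeasure_def, Measure.restrict_smul, lintegral_smul_measure, ENNReal.smul_def, smul_eq_mul]
  congr 1
  rw [wPer, inter_comm, hn, ← Measure.restrict_restrict H.isOpen.measurableSet, ← lintegral_indicator H.isOpen.measurableSet]
  refine lintegral_congr fun x => ?_
  by_cases hx : x ∈ S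
  · rw [wS_eq hx, indicator_of_mem hx]
  · rw [wS, indicator_of_notMem hx, indicator_of_notMem hx, ENNReal.ofReal_zero]

theorem per_pos (H : CW n k α S w) : 0 < (mb S w (ball 0 1 ∩ S) univ).toReal := by
  have h := H.star H.dom_ball (isOpen_ball.inter H.isOpen).measurableSet (Subset.refl _) (u := fun _ => 1) (BL.const 1)
    (fun _ => zero_le_one)
  have hα := H.hα
  have e : mw S w (ball 0 1 ∩ S) = mw S w (ball 0 1) := by
    have := congrArg (fun μ => μ univ) (H.restrict_S (ball 0 1) measurableSet_ball)
    simpa using this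
  have hκ := H.kappa_pos
  rw [e, div_self hκ.ne', Real.one_rpow] at h
  simp only [integral_const, smul_eq_mul, mul_one, measureReal_restrict_apply_univ, fderiv_fun_const, norm_zero, Pi.zero_apply,
    mul_zero, zero_add, Measure.real, e] at h
  rw [Measure.restrict_apply_univ, e] at h
  have : 0 < (n + α) * (mw S w (ball 0 1)).toReal := by positivity
  linarith

theorem mw_ball_lin (H : CW n k α S w) {x0 : Euc n} (hx0 : x0 ∈ linSpan n k) (r : ℝ) :
    mw S w (ball x0 r) = mw S w (ball 0 r) := by
  rw [mw_apply measurableSet_ball, mw_apply measurableSet_ball]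
  have h := (measurePreserving_add_right (volume : Measure (Euc n)) x0).setLIntegral_comp_preimage
    (measurableSet_ball (x := x0) (ε := r)) H.wS_meas.ennreal_ofReal
  rw [← h]
  have e : (fun x : Euc n => x + x0) ⁻¹' ball x0 r = ball 0 r := by
    ext x; simp [dist_eq_norm]
  rw [e]
  refine lintegral_congr fun x => ?_
  by_cases hx : x ∈ S
  · rw [wS_eq hx, wS_eq ((H.mem_add_lin hx0).2 hx), H.w_add_lin (subset_closure hx) hx0]
  · rw [wS, indicator_of_notMem hx, indicator_of_notMem (fun h => hx ((H.mem_add_lin hx0).1 h))]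

theorem mw_ball_S (H : CW n k α S w) {B : Set (Euc n)} (hB : MeasurableSet B) : mw S w (B ∩ S) = mw S w B := by
  have := congrArg (fun μ => μ univ) (H.restrict_S _ hB)
  simpa using this

end CW
end PartY

section PartZ
namespace CW
variable {n k : ℕ} {α : ℝ} {S : Set (Euc n)} {w : Euc n → ℝ}

theorem mw_scaleR (H : CW n k α S w) {r : ℝ} (hr : 0 < r) {A : Set (Euc n)} (hA : MeasurableSet A) :
    (mw S w ((fun x : Euc n => r • x) ⁻¹' A)).toReal = (r ^ ((n:ℝ) + α))⁻¹ * (mw S w A).toReal := by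
  have hra : 0 < r ^ α := Real.rpow_pos_of_pos hr _
  rw [H.mw_scale hr hA, ENNReal.toReal_mul, ENNReal.toReal_mul, ENNReal.toReal_inv, ENNReal.toReal_ofReal hra.le,
    ENNReal.toReal_ofReal (by positivity), Real.rpow_add hr, Real.rpow_natCast, mul_inv]
  ring

theorem mb_scaleR (H : CW n k α S w) {r : ℝ} (hr : 0 < r) (A : Set (Euc n)) :
    (mb S w ((fun x : Euc n => r • x) ⁻¹' A) univ).toReal = (r ^ ((n:ℝ) + α - 1))⁻¹ * (mb S w A univ).toReal := by
  have hra : 0 < r ^ α := Real.rpow_pos_of_pos hr _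
  have e : (n:ℝ) + α - 1 = ((n - 1 : ℕ) : ℝ) + α := by
    rw [Nat.cast_sub H.npos, Nat.cast_one]; ring
  rw [H.mb_scale hr, ENNReal.toReal_mul, ENNReal.toReal_mul, ENNReal.toReal_inv, ENNReal.toReal_ofReal hra.le,
    ENNReal.toReal_ofReal (by positivity), e, Real.rpow_add hr, Real.rpow_natCast, mul_inv]
  ring

theorem pre_ball {r : ℝ} (hr : 0 < r) (x0 : Euc n) : (fun x : Euc n => r • x) ⁻¹' ball (r • x0) r = ball x0 1 := by
  ext x
  rw [mem_preimage, mem_ball, mem_ball, dist_eq_norm, dist_eq_norm, ← smul_sub, norm_smul, Real.norm_eq_abs, abs_of_pos hr]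
  constructor
  · intro h; by_contra h'; push Not at h'; nlinarith
  · intro h; nlinarith

theorem main (H : CW n k α S w) :
    ∃ C : ℝ, 0 < C ∧
      ∀ E : Set (Euc n), E ⊆ S → IsOpen E →
        0 < wVol w E → wVol w E < ⊤ → wPer S w E < ⊤ →
        ∀ r : ℝ, 0 < r → wVol w (ball (0 : Euc n) r ∩ S) = wVol w E →
          wAsym S w k E r ≤ C * Real.sqrt (wDeficit S α w E) := by
  obtain ⟨C, hC, hfin⟩ := H.final
  obtain ⟨s, hs0, hs⟩ := H.wPer_eq
  have hspos : (0:ℝ) < s := NNReal.coe_pos.2 (pos_iff_ne_zero.2 hs0)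
  have hκ := H.kappa_pos
  set κ := (mw S w (ball 0 1)).toReal with hκdef
  have hα := H.hα
  have hn0 : (0:ℝ) < n := by exact_mod_cast H.npos
  have hD : (0:ℝ) < n + α := by positivity
  refine ⟨2 * C / κ + 2, by positivity, fun E hES hE hv0 hv hp r hr hrE => ?_⟩
  have hEm := hE.measurableSet
  have hm : Measurable (fun x : Euc n => r • x) := by fun_prop
  have hvE : wVol w E = mw S w E := H.wVol_eq hEm hES
  rw [H.wVol_eq (measurableSet_ball.inter H.isOpen.measurableSet) inter_subset_right, H.mw_ball_S measurableSet_ball, hvE] at hrE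
  rw [hvE] at hv0 hv
  -- the total volume
  have hVpos : 0 < (mw S w E).toReal := ENNReal.toReal_pos hv0.ne' hv.ne
  have hrD : 0 < r ^ ((n:ℝ) + α) := Real.rpow_pos_of_pos hr _
  have hVκ : (mw S w E).toReal = r ^ ((n:ℝ) + α) * κ := by
    have h1 := H.mw_scaleR hr (measurableSet_ball (x := r • (0 : Euc n)) (ε := r))
    rw [pre_ball hr, smul_zero, hrE] at h1
    rw [hκdef, h1, mul_inv_cancel_left₀ hrD.ne']
  -- asymmetry bounds
  have hasym : ∀ x0 ∈ linSpan n k, wAsym S w k E r ≤ 2 * (mw S w (E \ ball x0 r)).toReal / (mw S w E).toReal := by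
    intro x0 hx0
    have hb : mw S w (ball x0 r) = mw S w E := by rw [H.mw_ball_lin hx0, hrE]
    have hle : wAsym S w k E r ≤ (wVol w (symmDiff E (ball x0 r ∩ S))).toReal / (wVol w E).toReal := by
      refine csInf_le ⟨0, ?_⟩ ⟨x0, hx0, rfl⟩
      rintro a ⟨y, -, rfl⟩
      positivity
    refine hle.trans ?_
    rw [hvE]
    have hBm : MeasurableSet (ball x0 r ∩ S) := measurableSet_ball.inter H.isOpen.measurableSet
    have hBS : mw S w (ball x0 r ∩ S) = mw S w E := by rw [H.mw_ball_S measurableSet_ball, hb]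
    have hsub : symmDiff E (ball x0 r ∩ S) ⊆ S := by
      rintro x (hx | hx)
      · exact hES hx.1
      · exact hx.1.2
    rw [H.wVol_eq (hEm.symmDiff hBm) hsub]
    have hd1 : E \ (ball x0 r ∩ S) = E \ ball x0 r := by
      ext x; simp only [mem_diff, mem_inter_iff]
      constructor
      · rintro ⟨h1, h2⟩; exact ⟨h1, fun h => h2 ⟨h, hES h1⟩⟩
      · rintro ⟨h1, h2⟩; exact ⟨h1, fun h => h2 h.1⟩
    have hfinI : ∀ A B : Set (Euc n), A ⊆ E → mw S w A ≠ ⊤ := fun A _ h => ((measure_mono h).trans_lt hv).ne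
    have e1 : mw S w ((ball x0 r ∩ S) \ E) = mw S w (E \ (ball x0 r ∩ S)) := by
      have a1 := measure_diff_add_inter (μ := mw S w) E hBm
      have a2 := measure_diff_add_inter (μ := mw S w) (ball x0 r ∩ S) hEm
      rw [inter_comm _ E, hBS, ← a1] at a2
      exact (ENNReal.add_left_inj (hfinI _ E inter_subset_left)).1 a2
    have e2 : mw S w (symmDiff E (ball x0 r ∩ S)) = mw S w (E \ ball x0 r) + mw S w (E \ ball x0 r) := by
      rw [Set.symmDiff_def, measure_union (disjoint_sdiff_sdiff) (hBm.diff hEm), e1, hd1]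
    rw [e2, ENNReal.toReal_add (hfinI _ E diff_subset) (hfinI _ E diff_subset), ← two_mul]
  -- the rescaled set
  set E' : Set (Euc n) := (fun x : Euc n => r • x) ⁻¹' E with hE'
  have hDom : Dom S w E' := by
    refine ⟨hE.preimage (by fun_prop), fun x hx => (H.smul_mem_iff hr).1 (hES hx), ?_, ?_⟩
    · rw [hE', H.mw_scale hr hEm]
      refine ENNReal.mul_lt_top ?_ (ENNReal.mul_lt_top ENNReal.ofReal_lt_top hv)
      exact (ENNReal.inv_ne_top.2 (by simpa using Real.rpow_pos_of_pos hr α)).lt_top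
    · rw [hE', H.mb_scale hr, hs]
      refine ENNReal.mul_lt_top ?_ (ENNReal.mul_lt_top ENNReal.ofReal_lt_top (ENNReal.mul_lt_top ENNReal.coe_lt_top hp))
      exact (ENNReal.inv_ne_top.2 (by simpa using Real.rpow_pos_of_pos hr α)).lt_top
  have hE'κ : (mw S w E').toReal = κ := by
    rw [hE', H.mw_scaleR hr hEm, hVκ, inv_mul_cancel_left₀ hrD.ne']
  set δ0 := wDeficit S α w E with hδ0
  have hP1 := H.per_pos
  have hper : (mb S w E' univ).toReal = (mb S w (ball 0 1 ∩ S) univ).toReal * (1 + δ0) := by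
    rw [hE', H.mb_scaleR hr, hs, hs, ENNReal.toReal_mul, ENNReal.toReal_mul, hδ0, wDeficit, isoQuot, isoQuot, hvE,
      H.wVol_eq (measurableSet_ball.inter H.isOpen.measurableSet) inter_subset_right, H.mw_ball_S measurableSet_ball, ← hκdef, hVκ,
      Real.mul_rpow hrD.le hκ.le, ← Real.rpow_mul hr.le, mul_div_cancel₀ _ hD.ne']
    rw [hs, ENNReal.toReal_mul] at hP1
    have hP1' : (wPer S w (ball 0 1 ∩ S)).toReal ≠ 0 := fun h => by rw [h, mul_zero] at hP1; exact lt_irrefl _ hP1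
    have hk1 : κ ^ (((n:ℝ) + α - 1) / (n + α)) ≠ 0 := (Real.rpow_pos_of_pos hκ _).ne'
    have hr1 : r ^ ((n:ℝ) + α - 1) ≠ 0 := (Real.rpow_pos_of_pos hr _).ne'
    field_simp
    ring
  have hP1le : (mb S w (ball 0 1 ∩ S) univ).toReal ≤ (n + α) * κ := by
    have h := ENNReal.toReal_mono (ENNReal.mul_ne_top ENNReal.ofReal_ne_top
      ((measure_mono ball_subset_closedBall).trans_lt (H.mw_ball_lt 1)).ne) H.per_ball_le
    rwa [ENNReal.toReal_mul, ENNReal.toReal_ofReal hD.le] at h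
  have hδ1 : 0 ≤ 1 + δ0 := by
    have : 0 ≤ (mb S w (ball 0 1 ∩ S) univ).toReal * (1 + δ0) := hper ▸ ENNReal.toReal_nonneg
    exact nonneg_of_mul_nonneg_right this hP1
  have key : ∀ δ : ℝ, 0 < δ → δ ≤ 1 → δ0 ≤ δ → wAsym S w k E r ≤ (2 * C / κ) * √δ := by
    intro δ h0 h1 h2
    obtain ⟨x0, hx0, hx1⟩ := hfin E' hDom hE'κ δ h0 h1 (by
      rw [hper]
      gcongr)
    refine (hasym (r • x0) (lin_smul hx0 r)).trans ?_
    have e : (mw S w (E' \ ball x0 1)).toReal = (r ^ ((n:ℝ) + α))⁻¹ * (mw S w (E \ ball (r • x0) r)).toReal := by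
      rw [← H.mw_scaleR hr (hEm.diff measurableSet_ball), preimage_diff, pre_ball hr]
    rw [e] at hx1
    rw [hVκ]
    have hx2 : (mw S w (E \ ball (r • x0) r)).toReal ≤ r ^ ((n:ℝ) + α) * (C * √δ) := by
      rwa [inv_mul_le_iff₀ hrD] at hx1
    rw [div_le_iff₀ (by positivity)]
    calc 2 * (mw S w (E \ ball (r • x0) r)).toReal ≤ 2 * (r ^ ((n:ℝ) + α) * (C * √δ)) := by gcongr
      _ = _ := by field_simp
  rcases le_or_gt δ0 0 with h | h
  · have h1 : wAsym S w k E r ≤ 0 := by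
      have ht : Filter.Tendsto (fun δ : ℝ => (2 * C / κ) * √δ) (𝓝[>] 0) (𝓝 0) := by
        have : Filter.Tendsto (fun δ : ℝ => (2 * C / κ) * √δ) (𝓝 0) (𝓝 ((2 * C / κ) * √0)) := by
          apply Continuous.tendsto; fun_prop
        rw [Real.sqrt_zero, mul_zero] at this
        exact this.mono_left nhdsWithin_le_nhds
      refine ge_of_tendsto ht ?_
      filter_upwards [Ioc_mem_nhdsGT (zero_lt_one' ℝ)] with δ hδ
      exact key δ hδ.1 hδ.2 (h.trans hδ.1.le)
    exact h1.trans (by positivity)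
  · rcases le_or_gt δ0 1 with h1 | h1
    · refine (key δ0 h h1 le_rfl).trans ?_
      gcongr; linarith
    · have h2 : wAsym S w k E r ≤ 2 := by
        refine (hasym 0 zero_lin).trans ?_
        rw [div_le_iff₀ hVpos]
        gcongr
        · exact hv.ne
        · exact diff_subset
      have h3 : 1 ≤ √δ0 := Real.one_le_sqrt.2 h1.le
      have h4 : 0 ≤ 2 * C / κ := by positivity
      nlinarith

end CW
end PartZ

/-- Sharp quantitative stability for the weighted isoperimetric inequality in a convex cone. -/
theorem stmt_2 {n k : ℕ} (hn : 1 ≤ n) (hk : k < n) (α : ℝ) (hα : 0 < α)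
    (S : Set (Euc n)) (hS : IsOpenConvexCone S)
    (hSL : ∀ x ∈ S, ∀ v ∈ linSpan n k, x + v ∈ S)
    (hNoLine : ∀ p v : Euc n, (∀ t : ℝ, p + t • v ∈ S) → v ∈ linSpan n k)
    (w : Euc n → ℝ) (hw : IsAdmissibleWeight S α w) :
    ∃ C : ℝ, 0 < C ∧
      ∀ E : Set (Euc n), E ⊆ S → IsOpen E →
        0 < wVol w E → wVol w E < ⊤ → wPer S w E < ⊤ →
        ∀ r : ℝ, 0 < r → wVol w (ball (0 : Euc n) r ∩ S) = wVol w E →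
          wAsym S w k E r ≤ C * Real.sqrt (wDeficit S α w E) := by
  exact CW.main (⟨hk, hα, hS, hSL, hNoLine, hw⟩ : CW n k α S w)
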